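/- Every non-K-trivial computably enumerable K-degree bounds a Turing complete computably enumerable K-degree strictly below it together with a further non-K-trivial c.e. K-degree strictly below that: for every c.e. set A that is not K-trivial there are c.e. sets B and C with ∅ <_K C <_K B <_K A and B Turing equivalent to ∅′. -/

import Mathlib

open Part Filter

open scoped Classical

namespace KPaper

/-- Binary strings. -/
abbrev Str := List Bool

/-! ### Oracle (Turing) reducibility -/

/-- The functions `ℕ →. ℕ` that are partial recursive relative to an oracle `O : ℕ →. ℕ`.
This mirrors Mathlib's `Nat.Partrec`, with an extra base case for the oracle. -/
inductive RecursiveIn (O : ℕ →. ℕ) : (ℕ →. ℕ) → Prop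
  | oracle : RecursiveIn O O
  | zero : RecursiveIn O (pure 0)
  | succ : RecursiveIn O ↑Nat.succ
  | left : RecursiveIn O ↑fun n : ℕ => n.unpair.1
  | right : RecursiveIn O ↑fun n : ℕ => n.unpair.2
  | pair {f g} : RecursiveIn O f → RecursiveIn O g →
      RecursiveIn O fun n => Nat.pair <$> f n <*> g n
  | comp {f g} : RecursiveIn O f → RecursiveIn O g → RecursiveIn O fun n => g n >>= f
  | prec {f g} : RecursiveIn O f → RecursiveIn O g → RecursiveIn O (Nat.unpaired fun a n =>
      n.rec (f a) fun y IH => do let i ← IH; g (Nat.pair a (Nat.pair y i)))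
  | rfind {f} : RecursiveIn O f →
      RecursiveIn O fun a => Nat.rfind fun n => (fun m => m = 0) <$> f (Nat.pair a n)

/-- The characteristic (partial) function of a set of naturals, used as a Turing oracle. -/
noncomputable def chi (A : Set ℕ) : ℕ →. ℕ := fun n => Part.some (if n ∈ A then 1 else 0)

/-- The characteristic function of an infinite binary sequence, used as a Turing oracle. -/
def chiSeq (X : ℕ → Bool) : ℕ →. ℕ := fun n => Part.some (cond (X n) 1 0)

/-- `A` is Turing reducible to `B`. -/
noncomputable def TuringLeSet (A B : Set ℕ) : Prop := RecursiveIn (chi B) (chi A)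

/-- `A` is Turing equivalent to `B`. -/
noncomputable def TuringEquivSet (A B : Set ℕ) : Prop := TuringLeSet A B ∧ TuringLeSet B A

/-- Turing equivalence between a set and an infinite binary sequence. -/
noncomputable def TuringEquivSetSeq (A : Set ℕ) (X : ℕ → Bool) : Prop :=
  RecursiveIn (chiSeq X) (chi A) ∧ RecursiveIn (chi A) (chiSeq X)

/-- The halting problem `∅'`. -/
def haltingSet : Set ℕ := {n | ((Denumerable.ofNat Nat.Partrec.Code n).eval n).Dom}

/-- A set of naturals is computably enumerable iff it is the domain of a
partial computable function. -/
def CESet (A : Set ℕ) : Prop := ∃ f : ℕ →. ℕ, Nat.Partrec f ∧ ∀ n, n ∈ A ↔ (f n).Dom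

/-! ### Machines and Kolmogorov complexity -/

/-- A (plain) machine is a partial computable map from binary strings to binary strings. -/
def PlainMachine (M : Str →. Str) : Prop := Partrec M

/-- A prefix-free machine: a partial computable map on binary strings whose
domain is an antichain under the prefix relation. -/
def PFMachine (M : Str →. Str) : Prop :=
  Partrec M ∧ ∀ ρ₁ ρ₂ : Str, (M ρ₁).Dom → (M ρ₂).Dom → ρ₁ <+: ρ₂ → ρ₁ = ρ₂

/-- The Kolmogorov complexity of a string `σ` with respect to a machine `M`:
the least length of an `M`-description of `σ` (`⊤` if there is none). -/
noncomputable def KC (M : Str →. Str) (σ : Str) : ℕ∞ :=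
  ⨅ ρ : {ρ : Str // σ ∈ M ρ}, ((ρ : Str).length : ℕ∞)

/-- An optimal prefix-free machine: a prefix-free machine whose associated complexity
is minimal, up to an additive constant, among all prefix-free machines. -/
def OptimalPF (U : Str →. Str) : Prop :=
  PFMachine U ∧ ∀ M : Str →. Str, PFMachine M → ∃ c : ℕ, ∀ σ : Str, KC U σ ≤ KC M σ + c

/-- An optimal plain machine. -/
def OptimalPlain (V : Str →. Str) : Prop :=
  PlainMachine V ∧ ∀ M : Str →. Str, PlainMachine M → ∃ c : ℕ, ∀ σ : Str, KC V σ ≤ KC M σ + c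

/-! ### Initial segments -/

/-- The first `n` bits of the characteristic sequence of a set of naturals. -/
noncomputable def restrSet (A : Set ℕ) (n : ℕ) : Str :=
  (List.range n).map fun i => decide (i ∈ A)

/-- The first `n` bits of an infinite binary sequence. -/
def restrSeq (X : ℕ → Bool) (n : ℕ) : Str := (List.range n).map X

/-- The string `0^n`; `K(n)` is identified with `K(0^n)`. -/
def zeroStr (n : ℕ) : Str := List.replicate n false

/-! ### `≤_K`, `<_K`, `K`-triviality (and the `≤_C` analogues) -/

def KLeSet (U : Str →. Str) (A B : Set ℕ) : Prop :=
  ∃ c : ℕ, ∀ n, KC U (restrSet A n) ≤ KC U (restrSet B n) + c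

def KLtSet (U : Str →. Str) (A B : Set ℕ) : Prop := KLeSet U A B ∧ ¬ KLeSet U B A

def KTrivialSet (U : Str →. Str) (A : Set ℕ) : Prop :=
  ∃ c : ℕ, ∀ n, KC U (restrSet A n) ≤ KC U (zeroStr n) + c

def KLeSeq (U : Str →. Str) (X Y : ℕ → Bool) : Prop :=
  ∃ c : ℕ, ∀ n, KC U (restrSeq X n) ≤ KC U (restrSeq Y n) + c

def KLtSeq (U : Str →. Str) (X Y : ℕ → Bool) : Prop := KLeSeq U X Y ∧ ¬ KLeSeq U Y X

def KTrivialSeq (U : Str →. Str) (X : ℕ → Bool) : Prop :=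
  ∃ c : ℕ, ∀ n, KC U (restrSeq X n) ≤ KC U (zeroStr n) + c

/-! ### Computably enumerable reals -/

/-- The real number in `[0,1]` whose binary expansion is the sequence `X`. -/
noncomputable def realOfSeq (X : ℕ → Bool) : ℝ := ∑' i : ℕ, cond (X i) ((2 : ℝ) ^ (i + 1))⁻¹ 0

/-- `X` (identified with the real it is the binary expansion of) is a computably
enumerable real: it is the limit of a nondecreasing computable sequence of
(dyadic) rationals. -/
def CEReal (X : ℕ → Bool) : Prop :=
  ∃ f : ℕ → ℤ, Computable f ∧
    (∀ s, (f s : ℝ) / 2 ^ s ≤ (f (s + 1) : ℝ) / 2 ^ (s + 1)) ∧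
    Tendsto (fun s => (f s : ℝ) / 2 ^ s) atTop (nhds (realOfSeq X))

/-- The characteristic sequence of a set of naturals. -/
noncomputable def seqOfSet (A : Set ℕ) : ℕ → Bool := fun i => decide (i ∈ A)

/-! ### Solovay reducibility -/

/-- Solovay reducibility on c.e. reals: `X ≤_S Y` iff there are nondecreasing computable
rational approximations to `X` and `Y` and a constant `c` such that at each stage the
distance to `X` is bounded by `c` times the distance to `Y`. -/
def SolovayLe (X Y : ℕ → Bool) : Prop :=
  ∃ (c : ℕ) (f g : ℕ → ℤ), Computable f ∧ Computable g ∧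
    (∀ s, (f s : ℝ) / 2 ^ s ≤ (f (s + 1) : ℝ) / 2 ^ (s + 1)) ∧
    (∀ s, (g s : ℝ) / 2 ^ s ≤ (g (s + 1) : ℝ) / 2 ^ (s + 1)) ∧
    Tendsto (fun s => (f s : ℝ) / 2 ^ s) atTop (nhds (realOfSeq X)) ∧
    Tendsto (fun s => (g s : ℝ) / 2 ^ s) atTop (nhds (realOfSeq Y)) ∧
    ∀ s, realOfSeq X - (f s : ℝ) / 2 ^ s ≤ (c : ℝ) * (realOfSeq Y - (g s : ℝ) / 2 ^ s)


end KPaper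

namespace KPaper
/-! ### Automation for primitive recursiveness -/

attribute [fun_prop] Primrec
attribute [fun_prop] PrimrecPred

section prim
variable {α β σ : Type} [Primcodable α] [Primcodable β] [Primcodable σ]
@[fun_prop] theorem pr_id : Primrec (fun x : α => x) := Primrec.id
@[fun_prop] theorem pr_const (b : β) : Primrec (fun _ : α => b) := Primrec.const b
@[fun_prop] theorem pr_comp {f : β → σ} {g : α → β} (hf : Primrec f) (hg : Primrec g) :
    Primrec fun a => f (g a) := hf.comp hg
@[fun_prop] theorem pr_fst {f : α → β × σ} (hf : Primrec f) : Primrec fun a => (f a).1 :=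
  Primrec.fst.comp hf
@[fun_prop] theorem pr_snd {f : α → β × σ} (hf : Primrec f) : Primrec fun a => (f a).2 :=
  Primrec.snd.comp hf
@[fun_prop] theorem pr_mk {f : α → β} {g : α → σ} (hf : Primrec f) (hg : Primrec g) :
    Primrec fun a => (f a, g a) := hf.pair hg
@[fun_prop] theorem pr_add {f g : α → ℕ} (hf : Primrec f) (hg : Primrec g) :
    Primrec fun a => f a + g a := Primrec.nat_add.comp hf hg
@[fun_prop] theorem pr_sub {f g : α → ℕ} (hf : Primrec f) (hg : Primrec g) :
    Primrec fun a => f a - g a := Primrec.nat_sub.comp hf hg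
@[fun_prop] theorem pr_mul {f g : α → ℕ} (hf : Primrec f) (hg : Primrec g) :
    Primrec fun a => f a * g a := Primrec.nat_mul.comp hf hg
@[fun_prop] theorem pr_div {f g : α → ℕ} (hf : Primrec f) (hg : Primrec g) :
    Primrec fun a => f a / g a := Primrec.nat_div.comp hf hg
@[fun_prop] theorem pr_mod {f g : α → ℕ} (hf : Primrec f) (hg : Primrec g) :
    Primrec fun a => f a % g a := Primrec.nat_mod.comp hf hg
theorem pr_pow₂ : Primrec₂ ((· ^ ·) : ℕ → ℕ → ℕ) := Primrec₂.unpaired'.1 Nat.Primrec.pow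
@[fun_prop] theorem pr_pow {f g : α → ℕ} (hf : Primrec f) (hg : Primrec g) :
    Primrec fun a => f a ^ g a := pr_pow₂.comp hf hg
@[fun_prop] theorem pr_le {f g : α → ℕ} (hf : Primrec f) (hg : Primrec g) :
    PrimrecPred fun a => f a ≤ g a := Primrec.nat_le.comp hf hg
@[fun_prop] theorem pr_lt {f g : α → ℕ} (hf : Primrec f) (hg : Primrec g) :
    PrimrecPred fun a => f a < g a := Primrec.nat_lt.comp hf hg
@[fun_prop] theorem pr_eq {f g : α → β} (hf : Primrec f) (hg : Primrec g) :
    PrimrecPred fun a => f a = g a := Primrec.eq.comp hf hg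
@[fun_prop] theorem pr_and {f g : α → Prop} (hf : PrimrecPred f) (hg : PrimrecPred g) :
    PrimrecPred fun a => f a ∧ g a := hf.and hg
@[fun_prop] theorem pr_or {f g : α → Prop} (hf : PrimrecPred f) (hg : PrimrecPred g) :
    PrimrecPred fun a => f a ∨ g a := hf.or hg
@[fun_prop] theorem pr_not {f : α → Prop} (hf : PrimrecPred f) :
    PrimrecPred fun a => ¬ f a := hf.not
@[fun_prop] theorem pr_predcomp {f : β → Prop} {g : α → β} (hf : PrimrecPred f) (hg : Primrec g) :
    PrimrecPred fun a => f (g a) := hf.comp hg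
@[fun_prop] theorem pr_ite {c : α → Prop} [DecidablePred c] {f g : α → σ} (hc : PrimrecPred c)
    (hf : Primrec f) (hg : Primrec g) : Primrec fun a => if c a then f a else g a :=
  Primrec.ite hc hf hg
@[fun_prop] theorem pr_decide {c : α → Prop} [DecidablePred c] (hc : PrimrecPred c) :
    Primrec fun a => decide (c a) := hc.decide
@[fun_prop] theorem pr_some {f : α → β} (hf : Primrec f) : Primrec fun a => Option.some (f a) :=
  Primrec.option_some.comp hf
@[fun_prop] theorem pr_unpair {f : α → ℕ} (hf : Primrec f) : Primrec fun a => (f a).unpair :=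
  Primrec.unpair.comp hf
@[fun_prop] theorem pr_npair {f g : α → ℕ} (hf : Primrec f) (hg : Primrec g) :
    Primrec fun a => Nat.pair (f a) (g a) := Primrec₂.natPair.comp hf hg
@[fun_prop] theorem pr_length {f : α → List β} (hf : Primrec f) :
    Primrec fun a => (f a).length := Primrec.list_length.comp hf
@[fun_prop] theorem pr_isSome {f : α → Option β} (hf : Primrec f) :
    Primrec fun a => (f a).isSome := Primrec.option_isSome.comp hf
@[fun_prop] theorem pr_decode {f : α → ℕ} (hf : Primrec f) :
    Primrec fun a => (Encodable.decode (f a) : Option β) := Primrec.decode.comp hf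
@[fun_prop] theorem pr_encode {f : α → β} (hf : Primrec f) :
    Primrec fun a => Encodable.encode (f a) := Primrec.encode.comp hf

@[fun_prop] theorem pr_bind {f : α → Option β} {g : α → β → Option σ} (hf : Primrec f)
    (hg : Primrec fun p : α × β => g p.1 p.2) : Primrec fun a => (f a).bind (g a) :=
  Primrec.option_bind hf hg
@[fun_prop] theorem pr_omap {f : α → Option β} {g : α → β → σ} (hf : Primrec f)
    (hg : Primrec fun p : α × β => g p.1 p.2) : Primrec fun a => (f a).map (g a) :=
  Primrec.option_map hf hg
@[fun_prop] theorem pr_getD {f : α → Option β} {g : α → β} (hf : Primrec f)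
    (hg : Primrec g) : Primrec fun a => (f a).getD (g a) :=
  Primrec.option_getD.comp hf hg
@[fun_prop] theorem pr_elim {f : α → Option β} {d : α → σ} {g : α → β → σ} (hf : Primrec f)
    (hd : Primrec d) (hg : Primrec fun p : α × β => g p.1 p.2) :
    Primrec fun a => (f a).elim (d a) (g a) :=
  (Primrec.option_casesOn (σ := σ) hf hd (g := g) hg).of_eq fun a => by cases f a <;> rfl
@[fun_prop] theorem pr_lgetD {f : α → List β} {n : α → ℕ} {d : α → β} (hf : Primrec f)
    (hn : Primrec n) (hd : Primrec d) : Primrec fun a => (f a).getD (n a) (d a) :=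
  (Primrec.option_getD.comp (Primrec.list_getElem?.comp hf hn) hd).of_eq fun a => by simp
@[fun_prop] theorem pr_lmap {f : α → List β} {g : α → β → σ} (hf : Primrec f)
    (hg : Primrec fun p : α × β => g p.1 p.2) : Primrec fun a => (f a).map (g a) :=
  Primrec.list_map hf hg
@[fun_prop] theorem pr_range {f : α → ℕ} (hf : Primrec f) : Primrec fun a => List.range (f a) :=
  Primrec.list_range.comp hf
@[fun_prop] theorem pr_append {f g : α → List β} (hf : Primrec f) (hg : Primrec g) :
    Primrec fun a => f a ++ g a := Primrec.list_append.comp hf hg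
@[fun_prop] theorem pr_cons {f : α → β} {g : α → List β} (hf : Primrec f) (hg : Primrec g) :
    Primrec fun a => f a :: g a := Primrec.list_cons.comp hf hg

theorem pr_natrec {f : α → ℕ} {g : α → β} {h : α → ℕ → β → β} (hf : Primrec f) (hg : Primrec g)
    (hh : Primrec fun p : α × ℕ × β => h p.1 p.2.1 p.2.2) :
    Primrec fun a => Nat.rec (motive := fun _ => β) (g a) (h a) (f a) :=
  Primrec.nat_rec' (h := fun a p => h a p.1 p.2) hf hg hh

@[fun_prop] theorem pr_sum {f : α → ℕ} {F : α → ℕ → ℕ} (hf : Primrec f)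
    (hF : Primrec fun p : α × ℕ => F p.1 p.2) :
    Primrec fun a => ∑ i ∈ Finset.range (f a), F a i := by
  have := pr_natrec (h := fun a i r => r + F a i) hf (Primrec.const (α := α) 0) (by
    have : Primrec fun p : α × ℕ × ℕ => F p.1 p.2.1 := hF.comp (g := fun p : α × ℕ × ℕ => (p.1, p.2.1)) (by fun_prop)
    fun_prop)
  refine this.of_eq fun a => ?_
  induction f a with
  | zero => rfl
  | succ n ih => rw [Finset.sum_range_succ, ← ih]

@[fun_prop] theorem pr_ex {f : α → ℕ} {R : α → ℕ → Prop} (hf : Primrec f)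
    (hF : PrimrecPred fun p : α × ℕ => R p.1 p.2) :
    PrimrecPred fun a => ∃ i < f a, R a i := by
  have : PrimrecPred fun a => 0 < ∑ i ∈ Finset.range (f a), if R a i then 1 else 0 := by
    fun_prop
  refine this.of_eq fun a => ?_
  rw [Finset.sum_pos_iff]
  constructor
  · rintro ⟨i, h1, h2⟩
    refine ⟨i, Finset.mem_range.1 h1, ?_⟩
    by_contra h; simp [h] at h2
  · rintro ⟨i, h1, h2⟩
    exact ⟨i, Finset.mem_range.2 h1, by simp [h2]⟩

/-- The least `i < n` with `p i`, or `n` if there is none. -/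
noncomputable def mu (n : ℕ) (p : ℕ → Prop) : ℕ :=
  ∑ i ∈ Finset.range n, if ∃ j < i + 1, p j then 0 else 1

@[fun_prop] theorem pr_mu {f : α → ℕ} {R : α → ℕ → Prop} (hf : Primrec f)
    (hF : PrimrecPred fun p : α × ℕ => R p.1 p.2) :
    Primrec fun a => mu (f a) (R a) := by
  unfold mu
  have : PrimrecPred fun p : (α × ℕ) × ℕ => R p.1.1 p.2 :=
    hF.comp (f := fun p : (α × ℕ) × ℕ => (p.1.1, p.2)) (by fun_prop)
  fun_prop
end prim

theorem mu_succ (n : ℕ) (p : ℕ → Prop) :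
    mu (n+1) p = mu n p + if ∃ j < n + 1, p j then 0 else 1 := Finset.sum_range_succ _ _

theorem mu_eq_of_none {n : ℕ} {p : ℕ → Prop} (h : ∀ i < n, ¬ p i) : mu n p = n := by
  induction n with
  | zero => rfl
  | succ n ih =>
    rw [mu_succ, ih fun i hi => h i (by omega), if_neg]
    rintro ⟨j, hj, hp⟩; exact h j hj hp

theorem mu_eq_of_first {n k : ℕ} {p : ℕ → Prop} (hk : k < n) (hp : p k) (h : ∀ i < k, ¬ p i) :
    mu n p = k := by
  induction n with
  | zero => omega
  | succ n ih =>
    rw [mu_succ, if_pos ⟨k, hk, hp⟩]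
    rcases Nat.lt_succ_iff_lt_or_eq.1 hk with h1 | h1
    · simp [ih h1]
    · subst h1; simp [mu_eq_of_none h]

theorem mu_spec (n : ℕ) (p : ℕ → Prop) :
    (mu n p < n ∧ p (mu n p) ∧ ∀ i < mu n p, ¬ p i) ∨ (mu n p = n ∧ ∀ i < n, ¬ p i) := by
  by_cases h : ∃ i, i < n ∧ p i
  · left
    have h1 := Nat.find_spec h
    have : mu n p = Nat.find h := mu_eq_of_first h1.1 h1.2 fun i hi hp =>
      Nat.find_min h hi ⟨hi.trans h1.1, hp⟩
    rw [this]
    exact ⟨h1.1, h1.2, fun i hi hp => Nat.find_min h hi ⟨hi.trans h1.1, hp⟩⟩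
  · right
    push Not at h
    exact ⟨mu_eq_of_none h, h⟩

example (R : ℕ → ℕ → ℕ → Prop) (h : PrimrecPred fun p : ℕ × ℕ × ℕ => R p.1 p.2.1 p.2.2) : Primrec fun p : ℕ × ℕ =>
  ∑ i ∈ Finset.range p.1, if ∃ j < i + p.2, R p.1 i j then 2 ^ (i - p.1) else 0 := by fun_prop
end KPaper

namespace KPaper
/-! ### The Kraft-Chaitin theorem -/

/-- weight of a request -/
noncomputable def rw' (x : Option (ℕ × Str)) : ℝ := x.elim 0 fun p => (1/2 : ℝ) ^ p.1

theorem rw'_nonneg (x : Option (ℕ × Str)) : 0 ≤ rw' x := by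
  cases x with
  | none => simp [rw']
  | some p => simp [rw']

def bits (n m : ℕ) : Str := (List.range n).map fun j => decide (m / 2^(n-1-j) % 2 = 1)

theorem bits_pref {n m n' m' : ℕ} (hm : m < 2^n) (hm' : m' < 2^n')
    (h : bits n m <+: bits n' m') : n ≤ n' ∧ m = m' / 2^(n'-n) := by
  have hn : n ≤ n' := by simpa [bits] using h.length_le
  refine ⟨hn, ?_⟩
  apply Nat.eq_of_testBit_eq
  intro k
  rw [Nat.testBit_div_two_pow]
  by_cases hk : k < n
  · have h1 := List.prefix_iff_getElem.1 h
    obtain ⟨hl, h1⟩ := h1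
    have h2 := h1 (n-1-k) (by simp [bits]; omega)
    simp only [bits, List.getElem_map, List.getElem_range] at h2
    rw [← Nat.testBit_eq_decide_div_mod_eq, ← Nat.testBit_eq_decide_div_mod_eq] at h2
    rw [show n - 1 - (n-1-k) = k by omega, show n' - 1 - (n-1-k) = n' - n + k by omega] at h2
    first | exact h2 | (rw [h2, add_comm])
  · rw [Nat.testBit_lt_two_pow (lt_of_lt_of_le hm (Nat.pow_le_pow_right (by norm_num) (by omega)))]
    symm
    apply Nat.testBit_lt_two_pow (lt_of_lt_of_le hm' (Nat.pow_le_pow_right (by norm_num) (by omega)))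

section KCT
variable (r : ℕ → Option (ℕ × Str))

def kd (i : ℕ) : ℕ := (r i).elim 0 fun p => p.1
def kD (i : ℕ) : ℕ := ∑ l ∈ Finset.range (i+1), kd r l
def kN (i : ℕ) : ℕ := ∑ l ∈ Finset.range i, if (r l).isSome = true then 2 ^ (kD r i - kd r l) else 0
def km (i : ℕ) : ℕ := (kN r i * 2 ^ (kd r i + 1) + (2 ^ kD r i - 1)) / 2 ^ kD r i
def kcode (i : ℕ) : Str := bits (kd r i + 1) (km r i)

theorem kcode_pr (hr : Primrec r) : Primrec (kcode r) := by
  have h1 : Primrec (kd r) := by unfold kd; fun_prop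
  have h2 : Primrec (kD r) := by unfold kD; fun_prop
  have h3 : Primrec (kN r) := by unfold kN; fun_prop
  have h4 : Primrec (km r) := by unfold km; fun_prop
  unfold kcode bits; fun_prop

noncomputable def kS (i : ℕ) : ℝ := ∑ l ∈ Finset.range i, rw' (r l)

theorem kd_le (i l : ℕ) (h : l ≤ i) : kd r l ≤ kD r i :=
  Finset.single_le_sum (f := kd r) (fun _ _ => Nat.zero_le _) (Finset.mem_range.2 (by omega))

theorem kN_eq (i : ℕ) : (kN r i : ℝ) = 2 ^ kD r i * kS r i := by
  unfold kN kS
  rw [Finset.mul_sum]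
  push_cast
  refine Finset.sum_congr rfl fun l hl => ?_
  have hd := kd_le r i l (Finset.mem_range.1 hl).le
  rcases h : r l with _ | p
  · simp [rw']
  · have : kd r l = p.1 := by simp [kd, h]
    simp only [rw', Option.isSome, Option.elim, if_true]
    rw [this] at hd ⊢
    rw [one_div, inv_pow, pow_sub₀ _ (by norm_num) hd]

theorem km_bounds (i : ℕ) : kS r i * 2 ^ (kd r i + 1) ≤ km r i ∧
    (km r i : ℝ) < kS r i * 2 ^ (kd r i + 1) + 1 := by
  have hpos : 0 < 2 ^ kD r i := by positivity
  have hposR : (0:ℝ) < 2 ^ kD r i := by positivity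
  set x := kN r i * 2 ^ (kd r i + 1) with hx
  have e : (x : ℝ) = 2 ^ kD r i * (kS r i * 2 ^ (kd r i + 1)) := by
    rw [hx]; push_cast; rw [kN_eq]; ring
  have h1 : x ≤ 2 ^ kD r i * km r i := by
    have := Nat.lt_div_mul_add hpos (a := x + (2 ^ kD r i - 1))
    have h3 : km r i = (x + (2 ^ kD r i - 1)) / 2 ^ kD r i := rfl
    rw [← h3] at this
    rw [mul_comm]; omega
  have h2 : 2 ^ kD r i * km r i < x + 2 ^ kD r i := by
    have := Nat.div_mul_le_self (x + (2 ^ kD r i - 1)) (2 ^ kD r i)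
    have h3 : km r i = (x + (2 ^ kD r i - 1)) / 2 ^ kD r i := rfl
    rw [← h3] at this
    rw [mul_comm]; omega
  have h1' : (x:ℝ) ≤ 2 ^ kD r i * km r i := by exact_mod_cast h1
  have h2' : (2:ℝ) ^ kD r i * km r i < x + 2 ^ kD r i := by exact_mod_cast h2
  rw [e] at h1' h2'
  constructor
  · exact le_of_mul_le_mul_left h1' hposR
  · refine lt_of_mul_lt_mul_left (a := (2:ℝ) ^ kD r i) ?_ hposR.le
    linarith

theorem kcode_inj (hS : ∀ i, kS r i ≤ 1) {i j : ℕ} (hi : (r i).isSome) (hj : (r j).isSome)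
    (h : kcode r i <+: kcode r j) : i = j := by
  have main : ∀ i, (r i).isSome → km r i < 2 ^ (kd r i + 1) ∧
      kS r i ≤ km r i / 2 ^ (kd r i + 1) ∧ (km r i + 1 : ℝ) / 2 ^ (kd r i + 1) ≤ kS r (i+1) := by
    intro i hi
    have hb := km_bounds r i
    have hs : kS r (i+1) = kS r i + (1/2)^kd r i := by
      unfold kS; rw [Finset.sum_range_succ]
      congr 1
      obtain ⟨p, hp⟩ := Option.isSome_iff_exists.1 hi
      simp [rw', kd, hp]
    have hp : (0:ℝ) < 2 ^ (kd r i + 1) := by positivity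
    have h2 : (1/2:ℝ)^kd r i * 2 ^ (kd r i + 1) = 2 := by
      rw [pow_succ, ← mul_assoc, ← mul_pow]; norm_num
    refine ⟨?_, ?_, ?_⟩
    · have h1 := hS (i+1)
      rw [hs] at h1
      have : (km r i : ℝ) < 2 ^ (kd r i + 1) := by
        have := mul_le_mul_of_nonneg_right h1 hp.le
        rw [add_mul, h2] at this
        linarith
      exact_mod_cast this
    · rw [le_div_iff₀ hp]; exact hb.1
    · rw [div_le_iff₀ hp, hs, add_mul, h2]; linarith
  have mono : Monotone (kS r) := by
    apply monotone_nat_of_le_succ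
    intro n; unfold kS; rw [Finset.sum_range_succ]; linarith [rw'_nonneg (r n)]
  obtain ⟨a1, a2, a3⟩ := main i hi
  obtain ⟨b1, b2, b3⟩ := main j hj
  obtain ⟨hd, hm⟩ := bits_pref a1 b1 h
  set n := kd r i + 1
  set n' := kd r j + 1
  have hpow : (2:ℝ)^n' = 2^n * 2^(n'-n) := by rw [← pow_add]; congr 1; omega
  have hq : (0:ℝ) < 2^(n'-n) := by positivity
  have hn : (0:ℝ) < 2^n := by positivity
  have c1 : (km r i : ℝ) * 2^(n'-n) ≤ km r j := by
    have := Nat.div_mul_le_self (km r j) (2^(n'-n))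
    rw [← hm] at this; exact_mod_cast this
  have c2 : (km r j : ℝ) + 1 ≤ (km r i + 1) * 2^(n'-n) := by
    have := Nat.lt_div_mul_add (a := km r j) (b := 2^(n'-n)) (by positivity)
    rw [← hm] at this
    have : km r j + 1 ≤ (km r i + 1) * 2^(n'-n) := by rw [add_mul]; omega
    exact_mod_cast this
  have d1 : (km r i : ℝ) / 2^n ≤ km r j / 2^n' := by
    rw [hpow, div_le_div_iff₀ hn (by positivity)]
    nlinarith
  have d2 : ((km r j : ℝ)+1) / 2^n' ≤ (km r i + 1) / 2^n := by
    rw [hpow, div_le_div_iff₀ (by positivity) hn]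
    nlinarith
  have d3 : (km r j : ℝ) / 2^n' < (km r j + 1) / 2^n' := by gcongr; linarith
  rcases lt_trichotomy i j with hl | hl | hl
  · have := mono (show i+1 ≤ j from hl); linarith
  · exact hl
  · have := mono (show j+1 ≤ i from hl)
    have d4 : (km r i : ℝ) / 2^n < (km r i + 1) / 2^n := by gcongr; linarith
    linarith

theorem kraft_chaitin1 (U : Str →. Str) (hU : OptimalPF U) (hr : Primrec r)
    (hS : ∀ i, kS r i ≤ 1) : ∃ c : ℕ, ∀ i d τ, r i = Option.some (d, τ) → KC U τ ≤ d + c := by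
  let M : Str →. Str := fun ρ => Nat.rfindOpt fun i =>
    if kcode r i = ρ then (r i).map fun p => p.2 else none
  have hM : ∀ ρ τ, τ ∈ M ρ → ∃ i d, kcode r i = ρ ∧ r i = Option.some (d, τ) := by
    intro ρ τ h
    obtain ⟨i, hi⟩ := Nat.rfindOpt_spec h
    by_cases hc : kcode r i = ρ
    · simp [hc] at hi
      obtain ⟨d, hd⟩ := hi
      exact ⟨i, d, hc, hd⟩
    · simp [hc] at hi
  have hPF : PFMachine M := by
    refine ⟨?_, ?_⟩
    · apply Partrec.rfindOpt
      apply Primrec.to_comp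
      have := kcode_pr r hr
      show Primrec fun p : Str × ℕ => if kcode r p.2 = p.1 then (r p.2).map fun p => p.2 else none
      fun_prop
    · intro ρ₁ ρ₂ h1 h2 h
      obtain ⟨i, d, hi, hd⟩ := hM ρ₁ _ (Part.get_mem h1)
      obtain ⟨j, d', hj, hd'⟩ := hM ρ₂ _ (Part.get_mem h2)
      have : i = j := kcode_inj r hS (by simp [hd]) (by simp [hd']) (by rw [hi, hj]; exact h)
      rw [← hi, ← hj, this]
  obtain ⟨c, hc⟩ := hU.2 M hPF
  refine ⟨c + 1, fun i d τ h => ?_⟩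
  have hin : τ ∈ M (kcode r i) := by
    have hdom : (M (kcode r i)).Dom := by
      rw [Nat.rfindOpt_dom]
      exact ⟨i, τ, by simp [h]⟩
    obtain ⟨τ', hτ'⟩ := Part.dom_iff_mem.1 hdom
    obtain ⟨j, d', hj, hd'⟩ := hM _ _ hτ'
    have : j = i := kcode_inj r hS (by simp [hd']) (by simp [h]) (by rw [hj])
    subst this
    rw [hd'] at h
    simp at h
    rw [← h.2]; exact hτ'
  have h1 : KC M τ ≤ ((d + 1 : ℕ) : ℕ∞) := by
    refine (iInf_le _ (⟨_, hin⟩ : {ρ : Str // τ ∈ M ρ})).trans ?_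
    simp [kcode, bits, kd, h]
  calc KC U τ ≤ KC M τ + c := hc τ
    _ ≤ ((d+1 : ℕ) : ℕ∞) + c := by gcongr
    _ = _ := by push_cast; ring

end KCT

theorem kraft_chaitin (U : Str →. Str) (hU : OptimalPF U) (r : ℕ → Option (ℕ × Str))
    (hr : Primrec r) (C : ℕ) (hS : ∀ F : Finset ℕ, ∑ i ∈ F, rw' (r i) ≤ C) :
    ∃ c : ℕ, ∀ i d τ, r i = Option.some (d, τ) → KC U τ ≤ d + c := by
  let r' : ℕ → Option (ℕ × Str) := fun i => (r i).map fun p => (p.1 + C, p.2)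
  have hrw : ∀ i, rw' (r' i) = rw' (r i) * (1/2)^C := by
    intro i
    rcases h : r i with _ | p
    · simp [r', rw', h]
    · simp [r', rw', h, pow_add]; ring
  obtain ⟨c, hc⟩ := kraft_chaitin1 r' U hU (by show Primrec fun i => (r i).map fun p => (p.1 + C, p.2); fun_prop) (by
    intro i
    unfold kS
    simp_rw [hrw]
    rw [← Finset.sum_mul]
    have h1 := hS (Finset.range i)
    have h2 : (C:ℝ) * (1/2)^C ≤ 1 := by
      rw [one_div, inv_pow, ← div_eq_mul_inv, div_le_one (by positivity)]
      exact_mod_cast (Nat.lt_two_pow_self (n := C)).le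
    have : (0:ℝ) ≤ (1/2)^C := by positivity
    nlinarith)
  refine ⟨c + C, fun i d τ h => ?_⟩
  have := hc i (d + C) τ (by simp [r', h])
  refine this.trans (le_of_eq ?_)
  push_cast; ring
end KPaper

namespace KPaper
/-! ### The environment -/

/-- Enumeration of a universal machine, with the associated complexity. -/
structure KEnv where
  us : ℕ → Option Str
  ul : ℕ → ℕ
  K : Str → ℕ
  us_pr : Primrec us
  ul_pr : Primrec ul
  ul_le : ∀ t, ul t ≤ t
  us_le : ∀ t σ, us t = Option.some σ → σ.length ≤ t
  kraft : ∀ F : Finset ℕ, (∀ t ∈ F, us t ≠ Option.none) → ∑ t ∈ F, (1/2 : ℝ) ^ ul t ≤ 1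
  K_le : ∀ t σ, us t = Option.some σ → K σ ≤ ul t
  K_ex : ∀ σ, ∃ t, us t = Option.some σ ∧ ul t = K σ
  K_sum : ∀ σ (F : Finset ℕ), (∀ t ∈ F, us t = Option.some σ) →
    ∑ t ∈ F, (1/2 : ℝ) ^ ul t ≤ 2 * (1/2) ^ K σ
  kc : ∀ r : ℕ → Option (ℕ × Str), Primrec r → ∀ C : ℕ,
    (∀ F : Finset ℕ, ∑ i ∈ F, rw' (r i) ≤ C) →
    ∃ c : ℕ, ∀ i d τ, r i = Option.some (d, τ) → K τ ≤ d + c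

theorem sum_geom_Ico (m : ℕ) : ∀ n, ∑ i ∈ Finset.Ico m n, (1/2:ℝ)^i ≤ 2 * (1/2)^m - if m ≤ n then 2 * (1/2)^n else 0 := by
  intro n
  induction n with
  | zero =>
    rcases Nat.eq_zero_or_pos m with h | h
    · simp [h]
    · simp [Nat.ne_of_gt h]
  | succ n ih =>
    by_cases h : m ≤ n
    · rw [Finset.sum_Ico_succ_top h]
      rw [if_pos h] at ih
      rw [if_pos (by omega), pow_succ]; linarith
    · by_cases h2 : m = n+1
      · subst h2; simp
      · rw [Finset.Ico_eq_empty (by omega), if_neg (by omega)]; simp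

/-- sum of distinct powers of 1/2 with exponents at least `m`. -/
theorem sum_geom_inj {ι : Type} (F : Finset ι) (f : ι → ℕ) (hf : Set.InjOn f F) (m : ℕ)
    (hm : ∀ i ∈ F, m ≤ f i) : ∑ i ∈ F, (1/2:ℝ)^f i ≤ 2 * (1/2)^m := by
  rw [← Finset.sum_image (f := fun n => (1/2:ℝ)^n) (s := F) (g := f) hf]
  have hsub : F.image f ⊆ Finset.Ico m ((F.image f).sup id + 1) := by
    intro n hn
    rw [Finset.mem_Ico]
    refine ⟨?_, Nat.lt_succ_of_le (Finset.le_sup (f := id) hn)⟩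
    obtain ⟨i, hi, rfl⟩ := Finset.mem_image.1 hn
    exact hm i hi
  refine (Finset.sum_le_sum_of_subset_of_nonneg hsub fun _ _ _ => by positivity).trans ?_
  refine (sum_geom_Ico _ _).trans ?_
  split_ifs
  · have : (0:ℝ) ≤ 2 * (1/2)^((F.image f).sup id + 1) := by positivity
    linarith
  · simp

theorem kraft_pf (S : Finset Str) (h : ∀ a ∈ S, ∀ b ∈ S, a <+: b → a = b) :
    ∑ ρ ∈ S, (1/2:ℝ)^ρ.length ≤ 1 := by
  by_cases he : [] ∈ S
  · have : S = {[]} := by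
      apply Finset.eq_singleton_iff_unique_mem.2
      exact ⟨he, fun x hx => (h _ he x hx ⟨x, rfl⟩).symm⟩
    rw [this]; simp
  · have ud : InformationTheory.UniquelyDecodable (S : Set Str) := by
      intro L₁
      induction L₁ with
      | nil =>
        intro L₂ _ h2 h3
        cases L₂ with
        | nil => rfl
        | cons x L =>
          exfalso
          simp at h3
          exact he (h3.1 ▸ h2 x (by simp))
      | cons x L ih =>
        intro L₂ h1 h2 h3
        cases L₂ with
        | nil =>
          exfalso
          simp at h3
          exact he (h3.1 ▸ h1 x (by simp))
        | cons y L' =>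
          simp only [List.flatten_cons] at h3
          have hx : x ∈ S := h1 x (by simp)
          have hy : y ∈ S := h2 y (by simp)
          have hxy : x = y := by
            have hpx : x <+: x ++ L.flatten := List.prefix_append _ _
            have hpy : y <+: x ++ L.flatten := h3 ▸ List.prefix_append _ _
            rcases le_total x.length y.length with h4 | h4
            · exact h x hx y hy (List.prefix_of_prefix_length_le hpx hpy h4)
            · exact (h y hy x hx (List.prefix_of_prefix_length_le hpy hpx h4)).symm
          subst hxy
          rw [ih L' (fun w hw => h1 w (by simp [hw])) (fun w hw => h2 w (by simp [hw]))
            (List.append_cancel_left h3)]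
    have := InformationTheory.kraft_mcmillan_inequality ud
    simpa using this

theorem pr_evaln {α : Type} [Primcodable α] (c : Nat.Partrec.Code) {f g : α → ℕ} (hf : Primrec f) (hg : Primrec g) :
    Primrec fun a => Nat.Partrec.Code.evaln (f a) c (g a) :=
  Nat.Partrec.Code.primrec_evaln.comp ((hf.pair (Primrec.const c)).pair hg)

section mkEnv
variable (c : Nat.Partrec.Code)

/-- raw enumeration of the graph -/
def rawE (t : ℕ) : Option (Str × Str) :=
  (Encodable.decode t.unpair.1 : Option Str).bind fun ρ =>
    (Nat.Partrec.Code.evaln t.unpair.2 c (Encodable.encode ρ)).bind fun m =>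
      (Encodable.decode m : Option Str).bind fun σ =>
        if ρ.length ≤ t ∧ σ.length ≤ t then Option.some (ρ, σ) else none

noncomputable def uE (t : ℕ) : Option (Str × Str) :=
  (rawE c t).bind fun p =>
    if ∃ t' < t, ((rawE c t').elim 0 fun q => if q.2 = p.2 ∧ q.1.length ≤ p.1.length then 1 else 0) = 1
    then none else Option.some p

theorem rawE_pr : Primrec (rawE c) := by
  unfold rawE
  have := @pr_evaln (ℕ × Str) _ c (fun p => p.1.unpair.2) (fun p => Encodable.encode p.2) (by fun_prop) (by fun_prop)
  fun_prop

theorem uE_pr : Primrec (uE c) := by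
  have := rawE_pr c
  unfold uE
  fun_prop

theorem uE_spec {t : ℕ} {p : Str × Str} : uE c t = Option.some p ↔ rawE c t = Option.some p ∧
    ∀ t' < t, ∀ q, rawE c t' = Option.some q → q.2 = p.2 → p.1.length < q.1.length := by
  unfold uE
  constructor
  · intro h
    obtain ⟨p', hp', h⟩ := Option.bind_eq_some_iff.1 h
    split_ifs at h with h1
    simp only [Option.some.injEq] at h
    subst h
    refine ⟨hp', fun t' ht' q hq he => ?_⟩
    by_contra hcon
    exact h1 ⟨t', ht', by simp [hq, he, not_lt.1 hcon]⟩
  · rintro ⟨h1, h2⟩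
    rw [h1, Option.bind_some, if_neg]
    rintro ⟨t', ht', h3⟩
    rcases hq : rawE c t' with _ | q
    · simp [hq] at h3
    · rw [hq] at h3
      simp only [Option.elim] at h3
      split_ifs at h3 with h4
      exact absurd (h2 t' ht' q hq h4.1) (by omega)
end mkEnv

theorem exists_env (U : Str →. Str) (hU : OptimalPF U) :
    ∃ E : KEnv, ∀ σ, KC U σ = E.K σ := by
  obtain ⟨c, hc⟩ := Nat.Partrec.Code.exists_code.1 hU.1.1
  have hraw : ∀ t ρ σ, rawE c t = Option.some (ρ, σ) → σ ∈ U ρ ∧ ρ.length ≤ t ∧ σ.length ≤ t := by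
    intro t ρ σ h
    unfold rawE at h
    obtain ⟨ρ', h1, h⟩ := Option.bind_eq_some_iff.1 h
    obtain ⟨m, h2, h⟩ := Option.bind_eq_some_iff.1 h
    obtain ⟨σ', h3, h⟩ := Option.bind_eq_some_iff.1 h
    split_ifs at h with h4
    simp only [Option.some.injEq, Prod.mk.injEq] at h
    obtain ⟨rfl, rfl⟩ := h
    refine ⟨?_, h4⟩
    have := Nat.Partrec.Code.evaln_sound h2
    rw [hc] at this
    simp at this
    obtain ⟨a, ha, rfl⟩ := this
    simp at h3; rw [← h3]; exact ha
  have hrawc : ∀ ρ σ, σ ∈ U ρ → ∃ t, rawE c t = Option.some (ρ, σ) := by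
    intro ρ σ h
    have : Encodable.encode σ ∈ c.eval (Encodable.encode ρ) := by
      rw [hc]; simpa using h
    obtain ⟨k, hk⟩ := Nat.Partrec.Code.evaln_complete.1 this
    refine ⟨Nat.pair (Encodable.encode ρ) (k + ρ.length + σ.length), ?_⟩
    have h1 := Nat.Partrec.Code.evaln_mono (show k ≤ k + ρ.length + σ.length by omega) hk
    have h2 := Nat.right_le_pair (Encodable.encode ρ) (k + ρ.length + σ.length)
    unfold rawE
    simp only [Nat.unpair_pair, Encodable.encodek, Option.bind_some]
    rw [h1]
    simp only [Encodable.encodek, Option.bind_some]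
    rw [if_pos]
    constructor <;> omega
  have hfin : ∀ σ, KC U σ ≠ ⊤ := by
    obtain ⟨c', hc'⟩ := kraft_chaitin U hU (fun i => (Encodable.decode i : Option Str).map fun σ => (i, σ))
      (by fun_prop) 2 (by
        intro F
        have : ∀ i ∈ F, rw' ((Encodable.decode i : Option Str).map fun σ => (i, σ)) ≤ (1/2:ℝ)^i := by
          intro i _
          rcases (Encodable.decode i : Option Str) with _ | σ <;> simp [rw']
        refine (Finset.sum_le_sum this).trans ?_
        have := sum_geom_inj F id (fun _ _ _ _ h => h) 0 (by simp)
        simpa using this)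
    intro σ h
    have := hc' (Encodable.encode σ) _ σ (by simp; rfl)
    rw [h] at this
    simp at this
  have hK : ∀ σ, ((KC U σ).toNat : ℕ∞) = KC U σ := fun σ => ENat.natCast_toNat (hfin σ)
  have hKle : ∀ ρ σ, σ ∈ U ρ → (KC U σ).toNat ≤ ρ.length := by
    intro ρ σ h
    have : KC U σ ≤ ρ.length := iInf_le (fun ρ : {ρ : Str // σ ∈ U ρ} => ((ρ : Str).length : ℕ∞)) ⟨ρ, h⟩
    rw [← hK] at this; exact_mod_cast this
  have hKex : ∀ σ, ∃ ρ, σ ∈ U ρ ∧ ρ.length = (KC U σ).toNat := by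
    intro σ
    have hne : Nonempty {ρ : Str // σ ∈ U ρ} := by
      by_contra h
      rw [not_nonempty_iff] at h
      exact hfin σ (by simp [KC])
    obtain ⟨⟨ρ, hρ⟩, h⟩ := ENat.exists_eq_iInf (fun ρ : {ρ : Str // σ ∈ U ρ} => ((ρ : Str).length : ℕ∞))
    refine ⟨ρ, hρ, ?_⟩
    have : ((ρ.length : ℕ) : ℕ∞) = KC U σ := h
    rw [← this]; simp
  let us : ℕ → Option Str := fun t => (uE c t).map fun p => p.2
  let ul : ℕ → ℕ := fun t => (uE c t).elim 0 fun p => p.1.length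
  have hus : ∀ t σ, us t = Option.some σ → ∃ ρ, uE c t = Option.some (ρ, σ) ∧ ul t = ρ.length := by
    intro t σ h
    obtain ⟨⟨ρ, σ'⟩, h1, h2⟩ := Option.map_eq_some_iff.1 h
    simp at h2; subst h2
    exact ⟨ρ, h1, by simp [ul, h1]⟩
  have hinj : ∀ σ t t', us t = Option.some σ → us t' = Option.some σ → t < t' → ul t' < ul t := by
    intro σ t t' h h' hlt
    obtain ⟨ρ, h1, h2⟩ := hus t σ h
    obtain ⟨ρ', h1', h2'⟩ := hus t' σ h'
    rw [h2, h2']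
    exact ((uE_spec c).1 h1').2 t hlt (ρ, σ) ((uE_spec c).1 h1).1 rfl
  refine ⟨⟨us, ul, fun σ => (KC U σ).toNat, ?_, ?_, ?_, ?_, ?_, ?_, ?_, ?_, ?_⟩, fun σ => (hK σ).symm⟩
  · have := uE_pr c; show Primrec fun t => (uE c t).map fun p => p.2; fun_prop
  · have := uE_pr c; show Primrec fun t => (uE c t).elim 0 fun p => p.1.length; fun_prop
  · intro t
    rcases h : uE c t with _ | p
    · simp [ul, h]
    · have := (hraw t p.1 p.2 ((uE_spec c).1 h).1).2.1
      simpa [ul, h] using this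
  · intro t σ h
    obtain ⟨ρ, h1, h2⟩ := hus t σ h
    exact (hraw t ρ σ ((uE_spec c).1 h1).1).2.2
  · intro F hF
    let ρf : ℕ → Str := fun t => (uE c t).elim [] fun p => p.1
    have hρ : ∀ t ∈ F, ∃ σ, uE c t = Option.some (ρf t, σ) ∧ ul t = (ρf t).length := by
      intro t ht
      obtain ⟨σ, hσ⟩ := Option.ne_none_iff_exists'.1 (hF t ht)
      obtain ⟨ρ, h1, h2⟩ := hus t σ hσ
      have : ρf t = ρ := by simp [ρf, h1]
      exact ⟨σ, by rw [this, h1], by rw [this, h2]⟩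
    have hi : Set.InjOn ρf F := by
      intro t ht t' ht' heq
      obtain ⟨σ, h1, h2⟩ := hρ t ht
      obtain ⟨σ', h1', h2'⟩ := hρ t' ht'
      have e1 := (hraw _ _ _ ((uE_spec c).1 h1).1).1
      have e2 := (hraw _ _ _ ((uE_spec c).1 h1').1).1
      rw [← heq] at e2
      have : σ = σ' := Part.mem_unique e1 e2
      subst this
      have u1 : us t = Option.some σ := by simp [us, h1]
      have u2 : us t' = Option.some σ := by simp [us, h1']
      rcases lt_trichotomy t t' with h | h | h
      · have := hinj σ t t' u1 u2 h; rw [h2, h2', heq] at this; omega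
      · exact h
      · have := hinj σ t' t u2 u1 h; rw [h2, h2', heq] at this; omega
    have : ∑ t ∈ F, (1/2:ℝ)^ul t = ∑ t ∈ F, (1/2:ℝ)^(ρf t).length :=
      Finset.sum_congr rfl fun t ht => by obtain ⟨σ, h1, h2⟩ := hρ t ht; rw [h2]
    rw [this, ← Finset.sum_image (f := fun ρ : Str => (1/2:ℝ)^ρ.length) (g := ρf) hi]
    apply kraft_pf
    intro a ha b hb hab
    obtain ⟨t, ht, rfl⟩ := Finset.mem_image.1 ha
    obtain ⟨t', ht', rfl⟩ := Finset.mem_image.1 hb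
    obtain ⟨σ, h1, h2⟩ := hρ t ht
    obtain ⟨σ', h1', h2'⟩ := hρ t' ht'
    exact hU.1.2 _ _ (Part.dom_iff_mem.2 ⟨σ, (hraw _ _ _ ((uE_spec c).1 h1).1).1⟩)
      (Part.dom_iff_mem.2 ⟨σ', (hraw _ _ _ ((uE_spec c).1 h1').1).1⟩) hab
  · intro t σ h
    obtain ⟨ρ, h1, h2⟩ := hus t σ h
    rw [h2]; exact hKle ρ σ (hraw _ _ _ ((uE_spec c).1 h1).1).1
  · intro σ
    have hex : ∃ t ρ, rawE c t = Option.some (ρ, σ) ∧ ρ.length = (KC U σ).toNat := by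
      obtain ⟨ρ, h1, h2⟩ := hKex σ
      obtain ⟨t, ht⟩ := hrawc ρ σ h1
      exact ⟨t, ρ, ht, h2⟩
    obtain ⟨ρ, h1, h2⟩ := Nat.find_spec hex
    have : uE c (Nat.find hex) = Option.some (ρ, σ) := by
      refine (uE_spec c).2 ⟨h1, fun t' ht' q hq hqe => ?_⟩
      simp only at hqe ⊢
      by_contra hcon
      have h3 := Nat.find_min hex ht'
      apply h3
      obtain ⟨q1, q2⟩ := q
      simp only at hqe hcon
      subst hqe
      refine ⟨q1, hq, ?_⟩
      have := hKle q1 q2 (hraw _ _ _ hq).1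
      omega
    exact ⟨Nat.find hex, by simp [us, this], by simp [ul, this, h2]⟩
  · intro σ F hF
    apply sum_geom_inj
    · intro t ht t' ht' heq
      rcases lt_trichotomy t t' with h | h | h
      · have := hinj σ t t' (hF t ht) (hF t' ht') h; omega
      · exact h
      · have := hinj σ t' t (hF t' ht') (hF t ht) h; omega
    · intro t ht
      obtain ⟨ρ, h1, h2⟩ := hus t σ (hF t ht)
      rw [h2]; exact hKle ρ σ (hraw _ _ _ ((uE_spec c).1 h1).1).1
  · intro r hr C hC
    obtain ⟨c', h⟩ := kraft_chaitin U hU r hr C hC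
    refine ⟨c', fun i d τ hi => ?_⟩
    have := h i d τ hi
    rw [← hK] at this
    exact_mod_cast this
end KPaper

namespace KPaper
/-! ### The construction -/

/-- Everything the construction needs: a universal machine and enumerations of two c.e. sets. -/
structure Dat extends KEnv where
  aS : ℕ → Set ℕ
  hS : ℕ → Set ℕ
  aS_pr : PrimrecPred fun p : ℕ × ℕ => p.2 ∈ aS p.1
  hS_pr : PrimrecPred fun p : ℕ × ℕ => p.2 ∈ hS p.1
  aS_mono : Monotone aS
  hS_mono : Monotone hS

/-- actor, move flag, index -/
abbrev Act := ℕ × Bool × ℕ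
abbrev Hist := List (Option Act)

section prim2
variable {α β : Type} [Primcodable α] [Primcodable β]

@[fun_prop] theorem pr_elimP {f : α → Option β} {g : α → β → Prop} (hf : Primrec f)
    (hg : PrimrecPred fun p : α × β => g p.1 p.2) :
    PrimrecPred fun a => (f a).elim False (g a) := by
  have : PrimrecPred fun a => ((f a).elim 0 fun b => if g a b then 1 else 0) = 1 := by fun_prop
  refine this.of_eq fun a => ?_
  cases f a <;> simp

theorem pr_restr {B : α → Set ℕ} {n : α → ℕ} (hn : Primrec n)
    (hB : PrimrecPred fun p : α × ℕ => p.2 ∈ B p.1) : Primrec fun a => restrSet (B a) (n a) := by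
  unfold restrSet; fun_prop

@[fun_prop] theorem pr_zeroStr {n : α → ℕ} (hn : Primrec n) : Primrec fun a => zeroStr (n a) := by
  have : Primrec fun a => (List.range (n a)).map fun _ => false := by fun_prop
  refine this.of_eq fun a => ?_
  simp [zeroStr]

def gam (i : ℕ) : ℕ := 16 ^ i
@[fun_prop] theorem pr_gam {n : α → ℕ} (hn : Primrec n) : Primrec fun a => gam (n a) := by
  unfold gam; fun_prop

def hget (l : Hist) (k : ℕ) : Option Act := l.getD k Option.none
@[fun_prop] theorem pr_hget {l : α → Hist} {n : α → ℕ} (hl : Primrec l) (hn : Primrec n) :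
    Primrec fun a => hget (l a) (n a) := by
  unfold hget; fun_prop

def aLt (o : Option Act) (e : ℕ) : Prop := o.elim False fun p => p.1 < e
@[fun_prop] theorem pr_aLt {l : α → Option Act} {n : α → ℕ} (hl : Primrec l) (hn : Primrec n) :
    PrimrecPred fun a => aLt (l a) (n a) := by
  unfold aLt; fun_prop
def aMv (o : Option Act) (e : ℕ) : Prop := o.elim False fun p => p.1 = e ∧ p.2.1 = true
@[fun_prop] theorem pr_aMv {l : α → Option Act} {n : α → ℕ} (hl : Primrec l) (hn : Primrec n) :
    PrimrecPred fun a => aMv (l a) (n a) := by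
  unfold aMv; fun_prop
def aIx (o : Option Act) (j : ℕ) : Prop := o.elim False fun p => p.2.2 = j
@[fun_prop] theorem pr_aIx {l : α → Option Act} {n : α → ℕ} (hl : Primrec l) (hn : Primrec n) :
    PrimrecPred fun a => aIx (l a) (n a) := by
  unfold aIx; fun_prop

noncomputable def cbL (l : Hist) (e s : ℕ) : ℕ :=
  Nat.rec (motive := fun _ => ℕ) 0 (fun k r => if aLt (hget l k) e then k + 1 else r) s
@[fun_prop] theorem pr_cbL {l : α → Hist} {e s : α → ℕ} (hl : Primrec l) (he : Primrec e)
    (hs : Primrec s) : Primrec fun a => cbL (l a) (e a) (s a) := by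
  unfold cbL
  apply pr_natrec hs (by fun_prop)
  fun_prop
noncomputable def chL (l : Hist) (e s : ℕ) : ℕ :=
  Nat.rec (motive := fun _ => ℕ) 0
    (fun k r => if aLt (hget l k) e ∨ aMv (hget l k) e then k + 1 else r) s
@[fun_prop] theorem pr_chL {l : α → Hist} {e s : α → ℕ} (hl : Primrec l) (he : Primrec e)
    (hs : Primrec s) : Primrec fun a => chL (l a) (e a) (s a) := by
  unfold chL
  apply pr_natrec hs (by fun_prop)
  fun_prop
noncomputable def bbL (l : Hist) (e s : ℕ) : ℕ := 2 * e + 1 + cbL l e s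
noncomputable def hhL (l : Hist) (e s : ℕ) : ℕ := 2 * e + 2 + chL l e s
@[fun_prop] theorem pr_bbL {l : α → Hist} {e s : α → ℕ} (hl : Primrec l) (he : Primrec e)
    (hs : Primrec s) : Primrec fun a => bbL (l a) (e a) (s a) := by
  unfold bbL; fun_prop
@[fun_prop] theorem pr_hhL {l : α → Hist} {e s : α → ℕ} (hl : Primrec l) (he : Primrec e)
    (hs : Primrec s) : Primrec fun a => hhL (l a) (e a) (s a) := by
  unfold hhL; fun_prop

noncomputable def cntL (l : Hist) (j s : ℕ) : ℕ :=
  ∑ k ∈ Finset.range s, if aIx (hget l k) j then 1 else 0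
@[fun_prop] theorem pr_cntL {l : α → Hist} {e s : α → ℕ} (hl : Primrec l) (he : Primrec e)
    (hs : Primrec s) : Primrec fun a => cntL (l a) (e a) (s a) := by
  unfold cntL; fun_prop
noncomputable def vvL (l : Hist) (s : ℕ) : Option ℕ :=
  (hget l s).map fun p => gam (p.2.2 - 1) + cntL l p.2.2 s
@[fun_prop] theorem pr_vvL {l : α → Hist} {s : α → ℕ} (hl : Primrec l)
    (hs : Primrec s) : Primrec fun a => vvL (l a) (s a) := by
  unfold vvL; fun_prop
def BL (l : Hist) (s : ℕ) : Set ℕ := {n | ∃ k < s, vvL l k = Option.some n}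
theorem pr_BL {l : α → Hist} {s n : α → ℕ} (hl : Primrec l)
    (hs : Primrec s) (hn : Primrec n) : PrimrecPred fun a => n a ∈ BL (l a) (s a) := by
  unfold BL; simp only [Set.mem_ofPred_eq]; fun_prop
@[fun_prop] theorem pr_BrL {l : α → Hist} {s n : α → ℕ} (hl : Primrec l)
    (hs : Primrec s) (hn : Primrec n) : Primrec fun a => restrSet (BL (l a) (s a)) (n a) := by
  apply pr_restr hn
  apply pr_BL <;> fun_prop
end prim2

namespace Dat
variable (D : Dat)
section prim3
variable {α β : Type} [Primcodable α] [Primcodable β]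

@[fun_prop] theorem pr_us {n : α → ℕ} (hn : Primrec n) : Primrec fun a => D.us (n a) :=
  D.us_pr.comp hn
@[fun_prop] theorem pr_ul {n : α → ℕ} (hn : Primrec n) : Primrec fun a => D.ul (n a) :=
  D.ul_pr.comp hn
@[fun_prop] theorem pr_Ar {s n : α → ℕ} (hs : Primrec s) (hn : Primrec n) :
    Primrec fun a => restrSet (D.aS (s a)) (n a) := by
  apply pr_restr hn
  exact D.aS_pr.comp (f := fun p : α × ℕ => (s p.1, p.2)) (by fun_prop)
@[fun_prop] theorem pr_hS {s n : α → ℕ} (hs : Primrec s) (hn : Primrec n) :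
    PrimrecPred fun a => n a ∈ D.hS (s a) :=
  D.hS_pr.comp (f := fun p => (s p, n p)) (by fun_prop)

def pP (g h t : ℕ) : Prop := ∃ i < h, g ≤ i ∧ D.us t = Option.some (zeroStr (gam i))
def alv (t s : ℕ) : Prop := (D.us t).elim False fun σ => t < s ∧ σ = restrSet (D.aS s) σ.length
def qP (s g t : ℕ) : Prop := D.alv t s ∧ (D.us t).elim False fun σ => gam (g - 1) < σ.length
def rPL (l : Hist) (s g h t : ℕ) : Prop :=
  ∃ i < h, g ≤ i ∧ D.us t = Option.some (restrSet (BL l s) (gam i))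
@[fun_prop] theorem pr_pP {g h t : α → ℕ} (hg : Primrec g) (hh : Primrec h) (ht : Primrec t) :
    PrimrecPred fun a => D.pP (g a) (h a) (t a) := by
  unfold pP; fun_prop
@[fun_prop] theorem pr_alv {t s : α → ℕ} (ht : Primrec t) (hs : Primrec s) :
    PrimrecPred fun a => D.alv (t a) (s a) := by
  unfold alv; fun_prop
@[fun_prop] theorem pr_qP {g h t : α → ℕ} (hg : Primrec g) (hh : Primrec h) (ht : Primrec t) :
    PrimrecPred fun a => D.qP (g a) (h a) (t a) := by
  unfold qP; fun_prop
@[fun_prop] theorem pr_rPL {l : α → Hist} {s g h t : α → ℕ} (hl : Primrec l) (hs : Primrec s)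
    (hg : Primrec g) (hh : Primrec h) (ht : Primrec t) :
    PrimrecPred fun a => D.rPL (l a) (s a) (g a) (h a) (t a) := by
  unfold rPL; fun_prop

/-- mass scaled by `2^s` -/
noncomputable def nm (s : ℕ) (p : ℕ → Prop) : ℕ :=
  ∑ t ∈ Finset.range s, if p t then 2 ^ (s - D.ul t) else 0
@[fun_prop] theorem pr_nm {s : α → ℕ} {p : α → ℕ → Prop} (hs : Primrec s)
    (hp : PrimrecPred fun x : α × ℕ => p x.1 x.2) : Primrec fun a => D.nm (s a) (p a) := by
  unfold nm; fun_prop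

def goodL (l : Hist) (e g s : ℕ) : Prop :=
  D.nm s (D.qP s g) * 2 ^ (2 * e + 2) ≤ D.nm s (D.pP g (hhL l e s))
@[fun_prop] theorem pr_goodL {l : α → Hist} {e g s : α → ℕ} (hl : Primrec l) (he : Primrec e)
    (hg : Primrec g) (hs : Primrec s) : PrimrecPred fun a => D.goodL (l a) (e a) (g a) (s a) := by
  unfold goodL; fun_prop
def condML (l : Hist) (e s : ℕ) : Prop :=
  (¬ ∃ g < hhL l e s, bbL l e s ≤ g ∧ D.goodL l e g s) ∨ (e ∈ D.hS (s + 1) ∧ ¬ e ∈ D.hS s)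
@[fun_prop] theorem pr_condML {l : α → Hist} {e s : α → ℕ} (hl : Primrec l) (he : Primrec e)
    (hs : Primrec s) : PrimrecPred fun a => D.condML (l a) (e a) (s a) := by
  unfold condML; fun_prop
def condTL (l : Hist) (e s g : ℕ) : Prop :=
  bbL l e s ≤ g ∧ D.goodL l e g s ∧ 2 ^ s ≤ D.nm s (D.pP g (g+1)) * 2 ^ (e + g) ∧
    D.nm s (D.pP g (hhL l e s)) ≤ 2 ^ e * D.nm s (D.rPL l s g (hhL l e s))
@[fun_prop] theorem pr_condTL {l : α → Hist} {e g s : α → ℕ} (hl : Primrec l) (he : Primrec e)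
    (hs : Primrec s) (hg : Primrec g) : PrimrecPred fun a => D.condTL (l a) (e a) (s a) (g a) := by
  unfold condTL; fun_prop

noncomputable def decE (l : Hist) (s : ℕ) : ℕ :=
  mu s fun e => D.condML l e s ∨ ∃ g < hhL l e s, D.condTL l e s g
@[fun_prop] theorem pr_decE {l : α → Hist} {s : α → ℕ} (hl : Primrec l)
    (hs : Primrec s) : Primrec fun a => D.decE (l a) (s a) := by
  unfold decE; fun_prop
noncomputable def dec (l : Hist) (s : ℕ) : Option Act :=
  if D.decE l s < s then
    if D.condML l (D.decE l s) s then Option.some (D.decE l s, true, hhL l (D.decE l s) s)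
    else Option.some (D.decE l s, false, mu (hhL l (D.decE l s) s) (D.condTL l (D.decE l s) s))
  else Option.none
@[fun_prop] theorem pr_dec {l : α → Hist} {s : α → ℕ} (hl : Primrec l)
    (hs : Primrec s) : Primrec fun a => D.dec (l a) (s a) := by
  unfold dec; fun_prop

noncomputable def hist (s : ℕ) : Hist :=
  Nat.rec (motive := fun _ => Hist) [] (fun k l => l ++ [D.dec l k]) s
@[fun_prop] theorem pr_hist {s : α → ℕ} (hs : Primrec s) : Primrec fun a => D.hist (s a) := by
  unfold hist
  apply pr_natrec hs (by fun_prop)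
  fun_prop
end prim3

noncomputable def act (s : ℕ) : Option Act := D.dec (D.hist s) s
noncomputable def b (e s : ℕ) : ℕ := bbL (D.hist s) e s
noncomputable def h (e s : ℕ) : ℕ := hhL (D.hist s) e s
noncomputable def cb (e s : ℕ) : ℕ := cbL (D.hist s) e s
noncomputable def ch (e s : ℕ) : ℕ := chL (D.hist s) e s
noncomputable def cnt (j s : ℕ) : ℕ := cntL (D.hist s) j s
def B (s : ℕ) : Set ℕ := BL (D.hist s) s
noncomputable def v (s : ℕ) : Option ℕ :=
  (D.act s).map fun p => gam (p.2.2 - 1) + D.cnt p.2.2 s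

section prim4
variable {α β : Type} [Primcodable α] [Primcodable β]
@[fun_prop] theorem pr_act {s : α → ℕ} (hs : Primrec s) : Primrec fun a => D.act (s a) := by
  unfold act; fun_prop
@[fun_prop] theorem pr_b {e s : α → ℕ} (he : Primrec e) (hs : Primrec s) :
    Primrec fun a => D.b (e a) (s a) := by
  unfold b; fun_prop
@[fun_prop] theorem pr_h {e s : α → ℕ} (he : Primrec e) (hs : Primrec s) :
    Primrec fun a => D.h (e a) (s a) := by
  unfold h; fun_prop
@[fun_prop] theorem pr_Br {s n : α → ℕ} (hs : Primrec s) (hn : Primrec n) :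
    Primrec fun a => restrSet (D.B (s a)) (n a) := by
  unfold B; fun_prop
@[fun_prop] theorem pr_v {s : α → ℕ} (hs : Primrec s) : Primrec fun a => D.v (s a) := by
  unfold v cnt; fun_prop
end prim4

theorem hist_succ (s : ℕ) : D.hist (s+1) = D.hist s ++ [D.act s] := rfl
theorem hist_len (s : ℕ) : (D.hist s).length = s := by
  induction s with
  | zero => rfl
  | succ n ih => rw [hist_succ]; simp [ih]
theorem hget_hist {s k : ℕ} (hk : k < s) : hget (D.hist s) k = D.act k := by
  induction s with
  | zero => omega
  | succ n ih =>
    unfold hget at ih ⊢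
    rw [hist_succ]
    rcases Nat.lt_succ_iff_lt_or_eq.1 hk with h | h
    · rw [List.getD_append _ _ _ _ (by rw [hist_len]; exact h)]; exact ih h
    · subst h
      rw [List.getD_append_right _ _ _ _ (by rw [hist_len])]
      simp [hist_len]

theorem cbL_congr (e : ℕ) {s m : ℕ} (hs : s ≤ m) : cbL (D.hist m) e s = D.cb e s := by
  unfold cb cbL
  suffices ∀ k, k ≤ s → ∀ m', s ≤ m' → Nat.rec (motive := fun _ => ℕ) 0 (fun k r => if aLt (hget (D.hist m) k) e then k + 1 else r) k = Nat.rec (motive := fun _ => ℕ) 0 (fun k r => if aLt (hget (D.hist m') k) e then k + 1 else r) k from this s le_rfl s le_rfl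
  intro k hk m' hm'
  induction k with
  | zero => rfl
  | succ k ih =>
    simp only
    rw [ih (by omega), hget_hist D (show k < m by omega), hget_hist D (show k < m' by omega)]
theorem chL_congr (e : ℕ) {s m : ℕ} (hs : s ≤ m) : chL (D.hist m) e s = D.ch e s := by
  unfold ch chL
  suffices ∀ k, k ≤ s → ∀ m', s ≤ m' → Nat.rec (motive := fun _ => ℕ) 0 (fun k r => if aLt (hget (D.hist m) k) e ∨ aMv (hget (D.hist m) k) e then k + 1 else r) k = Nat.rec (motive := fun _ => ℕ) 0 (fun k r => if aLt (hget (D.hist m') k) e ∨ aMv (hget (D.hist m') k) e then k + 1 else r) k from this s le_rfl s le_rfl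
  intro k hk m' hm'
  induction k with
  | zero => rfl
  | succ k ih =>
    simp only
    rw [ih (by omega), hget_hist D (show k < m by omega), hget_hist D (show k < m' by omega)]
theorem cntL_congr (j : ℕ) {s m : ℕ} (hs : s ≤ m) : cntL (D.hist m) j s = D.cnt j s := by
  unfold cnt cntL
  refine Finset.sum_congr rfl fun k hk => ?_
  have := Finset.mem_range.1 hk
  rw [hget_hist D (show k < m by omega), hget_hist D this]
theorem vvL_congr {s m : ℕ} (hs : s < m) : vvL (D.hist m) s = D.v s := by
  unfold vvL v
  rw [hget_hist D hs]
  congr 1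
  funext p
  rw [cntL_congr D _ hs.le]

theorem b_eq (e s : ℕ) : D.b e s = 2 * e + 1 + D.cb e s := rfl
theorem h_eq (e s : ℕ) : D.h e s = 2 * e + 2 + D.ch e s := rfl
theorem cb_zero (e : ℕ) : D.cb e 0 = 0 := rfl
theorem ch_zero (e : ℕ) : D.ch e 0 = 0 := rfl
theorem cb_succ (e s : ℕ) : D.cb e (s+1) = if aLt (D.act s) e then s + 1 else D.cb e s := by
  rw [← cbL_congr D e (show s ≤ s+1 by omega), ← hget_hist D (show s < s+1 by omega)]; rfl
theorem ch_succ (e s : ℕ) :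
    D.ch e (s+1) = if aLt (D.act s) e ∨ aMv (D.act s) e then s + 1 else D.ch e s := by
  rw [← chL_congr D e (show s ≤ s+1 by omega), ← hget_hist D (show s < s+1 by omega)]; rfl
theorem cnt_eq (j s : ℕ) : D.cnt j s = ∑ k ∈ Finset.range s, if aIx (D.act k) j then 1 else 0 := by
  unfold cnt cntL
  refine Finset.sum_congr rfl fun k hk => ?_
  rw [hget_hist D (Finset.mem_range.1 hk)]
theorem mem_B {n s : ℕ} : n ∈ D.B s ↔ ∃ k < s, D.v k = Option.some n := by
  unfold B BL
  constructor
  · rintro ⟨k, hk, h⟩; exact ⟨k, hk, by rw [← vvL_congr D hk]; exact h⟩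
  · rintro ⟨k, hk, h⟩; exact ⟨k, hk, by rw [vvL_congr D hk]; exact h⟩

end Dat
end KPaper

namespace KPaper
/-! ### Basic facts on the construction -/

theorem length_restr (A : Set ℕ) (n : ℕ) : (restrSet A n).length = n := by simp [restrSet]
theorem length_zero (n : ℕ) : (zeroStr n).length = n := by simp [zeroStr]
theorem restr_eq_iff {A B : Set ℕ} {n : ℕ} :
    restrSet A n = restrSet B n ↔ ∀ i < n, (i ∈ A ↔ i ∈ B) := by
  unfold restrSet
  rw [List.map_inj_left]
  simp
theorem gam_pos (i : ℕ) : 0 < gam i := by unfold gam; positivity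
theorem gam_strictMono : StrictMono gam := fun i j h => by
  unfold gam; exact Nat.pow_lt_pow_right (by norm_num) h
theorem gam_mono {i j : ℕ} (h : i ≤ j) : gam i ≤ gam j := gam_strictMono.monotone h
theorem lt_gam (i : ℕ) : i < gam i := Nat.lt_pow_self (by norm_num)

namespace Dat
variable (D : Dat)

noncomputable def w (t : ℕ) : ℝ := if D.us t = Option.none then 0 else (1/2) ^ D.ul t
noncomputable def W (F : Finset ℕ) : ℝ := ∑ t ∈ F, D.w t
theorem w_nonneg (t : ℕ) : 0 ≤ D.w t := by unfold w; split_ifs <;> positivity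
theorem w_some {t : ℕ} {σ : Str} (h : D.us t = Option.some σ) : D.w t = (1/2) ^ D.ul t := by
  simp [w, h]
theorem W_nonneg (F : Finset ℕ) : 0 ≤ D.W F := Finset.sum_nonneg fun _ _ => D.w_nonneg _
theorem W_mono {F G : Finset ℕ} (h : F ⊆ G) : D.W F ≤ D.W G :=
  Finset.sum_le_sum_of_subset_of_nonneg h fun _ _ _ => D.w_nonneg _
theorem W_le_one (F : Finset ℕ) : D.W F ≤ 1 := by
  have : D.W F = ∑ t ∈ F.filter (fun t => D.us t ≠ Option.none), (1/2:ℝ) ^ D.ul t := by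
    unfold W w
    rw [Finset.sum_filter]
    refine Finset.sum_congr rfl fun t _ => ?_
    by_cases h : D.us t = Option.none <;> simp [h]
  rw [this]
  exact D.kraft _ fun t ht => (Finset.mem_filter.1 ht).2
theorem W_union_le (F G : Finset ℕ) : D.W (F ∪ G) ≤ D.W F + D.W G := by
  unfold W
  rw [← Finset.sum_union_inter]
  have : 0 ≤ ∑ t ∈ F ∩ G, D.w t := Finset.sum_nonneg fun _ _ => D.w_nonneg _
  linarith
theorem W_disj {ι : Type} (I : Finset ι) (F : ι → Finset ℕ)
    (h : ∀ i ∈ I, ∀ j ∈ I, i ≠ j → Disjoint (F i) (F j)) :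
    ∑ i ∈ I, D.W (F i) = D.W (I.biUnion F) := by
  unfold W
  rw [Finset.sum_biUnion]
  intro i hi j hj hij
  exact h i hi j hj hij
theorem W_disj_le {ι : Type} (I : Finset ι) (F : ι → Finset ℕ)
    (h : ∀ i ∈ I, ∀ j ∈ I, i ≠ j → Disjoint (F i) (F j)) :
    ∑ i ∈ I, D.W (F i) ≤ 1 := by
  rw [D.W_disj I F h]; exact D.W_le_one _

noncomputable def PF (s g h : ℕ) : Finset ℕ := (Finset.range s).filter (D.pP g h)
noncomputable def QF (s g : ℕ) : Finset ℕ := (Finset.range s).filter (D.qP s g)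
noncomputable def RF (s g h : ℕ) : Finset ℕ := (Finset.range s).filter (D.rPL (D.hist s) s g h)
theorem mem_RF {s g h t : ℕ} : t ∈ D.RF s g h ↔ t < s ∧
    ∃ i < h, g ≤ i ∧ D.us t = Option.some (restrSet (D.B s) (gam i)) := by
  unfold RF; rw [Finset.mem_filter, Finset.mem_range]; rfl
theorem mem_PF {s g h t : ℕ} : t ∈ D.PF s g h ↔ t < s ∧
    ∃ i < h, g ≤ i ∧ D.us t = Option.some (zeroStr (gam i)) := by
  unfold PF; rw [Finset.mem_filter, Finset.mem_range]; rfl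

theorem nm_eq (s : ℕ) (p : ℕ → Prop) (hp : ∀ t, p t → D.us t ≠ Option.none) :
    (D.nm s p : ℝ) = 2 ^ s * D.W ((Finset.range s).filter p) := by
  unfold nm W
  rw [Finset.sum_filter, Finset.mul_sum]
  push_cast
  refine Finset.sum_congr rfl fun t ht => ?_
  by_cases h : p t
  · have hl := D.ul_le t
    have := Finset.mem_range.1 ht
    simp only [h, if_true, w, hp t h, if_false]
    rw [one_div, inv_pow, pow_sub₀ _ (by norm_num) (by omega)]
  · simp [h]

theorem pP_ne {g h t : ℕ} (hp : D.pP g h t) : D.us t ≠ Option.none := by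
  obtain ⟨i, _, _, h⟩ := hp; simp [h]
theorem alv_iff {t s : ℕ} : D.alv t s ↔
    ∃ σ, D.us t = Option.some σ ∧ t < s ∧ σ = restrSet (D.aS s) σ.length := by
  unfold alv
  rcases h : D.us t with _ | σ
  · simp
  · simp
theorem qP_iff {t s g : ℕ} : D.qP s g t ↔
    ∃ σ, D.us t = Option.some σ ∧ t < s ∧ σ = restrSet (D.aS s) σ.length ∧
      gam (g - 1) < σ.length := by
  unfold qP alv
  rcases h : D.us t with _ | σ
  · simp
  · simp [and_assoc]
theorem nm_P (s g h : ℕ) : (D.nm s (D.pP g h) : ℝ) = 2 ^ s * D.W (D.PF s g h) :=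
  D.nm_eq _ _ fun _ h => D.pP_ne h
theorem nm_Q (s g : ℕ) : (D.nm s (D.qP s g) : ℝ) = 2 ^ s * D.W (D.QF s g) :=
  D.nm_eq _ _ fun t h => by obtain ⟨σ, h, _⟩ := D.qP_iff.1 h; simp [h]
theorem nm_R (s g h : ℕ) : (D.nm s (D.rPL (D.hist s) s g h) : ℝ) = 2 ^ s * D.W (D.RF s g h) :=
  D.nm_eq _ (D.rPL (D.hist s) s g h) fun t h => by obtain ⟨i, _, _, h⟩ := h; simp [h]

def good (e g s : ℕ) : Prop := D.W (D.QF s g) * 2 ^ (2*e+2) ≤ D.W (D.PF s g (D.h e s))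
def condM (e s : ℕ) : Prop :=
  (∀ g, D.b e s ≤ g → g < D.h e s → ¬ D.good e g s) ∨ (e ∈ D.hS (s + 1) ∧ e ∉ D.hS s)
def condT (e s g : ℕ) : Prop :=
  D.b e s ≤ g ∧ D.good e g s ∧ 1 ≤ D.W (D.PF s g (g+1)) * 2 ^ (e + g) ∧
    D.W (D.PF s g (D.h e s)) ≤ 2 ^ e * D.W (D.RF s g (D.h e s))

theorem good_iff (e g s : ℕ) : D.goodL (D.hist s) e g s ↔ D.good e g s := by
  unfold goodL good
  have : (0:ℝ) < 2 ^ s := by positivity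
  rw [← Nat.cast_le (α := ℝ)]
  push_cast
  rw [nm_P, nm_Q, mul_assoc, mul_le_mul_iff_right₀ this]
  rfl
theorem condM_iff (e s : ℕ) : D.condML (D.hist s) e s ↔ D.condM e s := by
  unfold condML condM
  simp only [good_iff]
  have : (¬∃ g < hhL (D.hist s) e s, bbL (D.hist s) e s ≤ g ∧ D.good e g s) ↔
    ∀ g, D.b e s ≤ g → g < D.h e s → ¬ D.good e g s := by
    constructor
    · intro h g h1 h2 h3; exact h ⟨g, h2, h1, h3⟩
    · rintro h ⟨g, h2, h1, h3⟩; exact h g h1 h2 h3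
  rw [this]
theorem condT_iff (e s g : ℕ) : D.condTL (D.hist s) e s g ↔ D.condT e s g := by
  unfold condTL condT
  have hp : (0:ℝ) < 2 ^ s := by positivity
  have h1 : 2 ^ s ≤ D.nm s (D.pP g (g+1)) * 2 ^ (e + g) ↔
      1 ≤ D.W (D.PF s g (g+1)) * 2 ^ (e + g) := by
    rw [← Nat.cast_le (α := ℝ)]
    push_cast
    rw [nm_P, mul_assoc]
    constructor
    · intro h; refine le_of_mul_le_mul_left ?_ hp; simpa using h
    · intro h; have := mul_le_mul_of_nonneg_left h hp.le; simpa using this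
  have h2 : D.nm s (D.pP g (hhL (D.hist s) e s)) ≤
      2 ^ e * D.nm s (D.rPL (D.hist s) s g (hhL (D.hist s) e s)) ↔
      D.W (D.PF s g (D.h e s)) ≤ 2 ^ e * D.W (D.RF s g (D.h e s)) := by
    rw [← Nat.cast_le (α := ℝ)]
    push_cast
    rw [nm_P, nm_R, mul_left_comm, mul_le_mul_iff_right₀ hp]
    rfl
  rw [h1, h2, good_iff]
  rfl

theorem act_none {s : ℕ} (h : D.act s = Option.none) {e : ℕ} (he : e < s) :
    ¬ D.condM e s ∧ ∀ g < D.h e s, ¬ D.condT e s g := by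
  unfold act dec at h
  split_ifs at h with h1 h2
  rcases mu_spec s fun e => D.condML (D.hist s) e s ∨ ∃ g < hhL (D.hist s) e s, D.condTL (D.hist s) e s g
    with h3 | h3
  · exact absurd h3.1 h1
  · have := h3.2 e he
    simp only [condM_iff, condT_iff] at this
    push Not at this
    exact this

theorem act_some {s e j : ℕ} {m : Bool} (h : D.act s = Option.some (e, m, j)) :
    e < s ∧ (∀ e' < e, ¬ D.condM e' s ∧ ∀ g < D.h e' s, ¬ D.condT e' s g) ∧
    ((m = true ∧ j = D.h e s ∧ D.condM e s) ∨
      (m = false ∧ j < D.h e s ∧ ¬ D.condM e s ∧ D.condT e s j)) := by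
  unfold act dec at h
  rcases mu_spec s fun e => D.condML (D.hist s) e s ∨ ∃ g < hhL (D.hist s) e s, D.condTL (D.hist s) e s g
    with h3 | h3
  swap
  · rw [if_neg] at h
    · simp at h
    · unfold decE; omega
  have h1 : D.decE (D.hist s) s < s := h3.1
  rw [if_pos h1] at h
  have key : D.decE (D.hist s) s = e := by
    split_ifs at h <;> simp at h <;> exact h.1
  have h3' := h3.2
  change _ ∧ ∀ i < D.decE (D.hist s) s, _ at h3'
  have h4 := h3'.1
  change (D.condML _ (D.decE (D.hist s) s) _ ∨ ∃ g < hhL _ (D.decE (D.hist s) s) s,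
    D.condTL _ (D.decE (D.hist s) s) _ _) at h4
  rw [key] at h1 h3' h h4
  refine ⟨h1, ?_, ?_⟩
  · intro e' he'
    have := h3'.2 e' he'
    simp only [condM_iff, condT_iff] at this
    push Not at this
    exact this
  · by_cases hM : D.condML (D.hist s) e s
    · rw [if_pos hM] at h
      simp at h
      left
      exact ⟨h.1, h.2.symm, (D.condM_iff e s).1 hM⟩
    · rw [if_neg hM] at h
      simp at h
      right
      obtain ⟨g, hg, hT⟩ := h4.resolve_left hM
      rcases mu_spec (hhL (D.hist s) e s) (D.condTL (D.hist s) e s) with h5 | h5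
      · rw [h.2] at h5
        exact ⟨h.1, h5.1, fun hc => hM ((D.condM_iff e s).2 hc), (D.condT_iff _ _ _).1 h5.2.1⟩
      · exact absurd hT (h5.2 g hg)

theorem act_of_cond {s e : ℕ} (he : e < s) (h : D.condM e s ∨ ∃ g < D.h e s, D.condT e s g) :
    ∃ e' m j, e' ≤ e ∧ D.act s = Option.some (e', m, j) := by
  rcases ha : D.act s with _ | ⟨e', m, j⟩
  · have := D.act_none ha he
    rcases h with h | ⟨g, hg, h⟩
    · exact absurd h this.1
    · exact absurd h (this.2 g hg)
  · refine ⟨e', m, j, ?_, rfl⟩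
    by_contra hcon
    have := (D.act_some ha).2.1 e (by omega)
    rcases h with h | ⟨g, hg, h⟩
    · exact this.1 h
    · exact this.2 g hg h

theorem aLt_iff {s e : ℕ} : aLt (D.act s) e ↔ ∃ e' m j, D.act s = Option.some (e', m, j) ∧ e' < e := by
  unfold aLt
  rcases D.act s with _ | ⟨e', m, j⟩ <;> simp
theorem aMv_iff {s e : ℕ} : aMv (D.act s) e ↔ ∃ j, D.act s = Option.some (e, true, j) := by
  unfold aMv
  rcases D.act s with _ | ⟨e', m, j⟩
  · simp
  · simp
theorem aIx_iff {s j : ℕ} : aIx (D.act s) j ↔ ∃ e m, D.act s = Option.some (e, m, j) := by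
  unfold aIx
  rcases D.act s with _ | ⟨e', m, j⟩ <;> simp

theorem cb_le (e s : ℕ) : D.cb e s ≤ s := by
  induction s with
  | zero => simp [cb_zero]
  | succ n ih => rw [cb_succ]; split_ifs <;> omega
theorem ch_le (e s : ℕ) : D.ch e s ≤ s := by
  induction s with
  | zero => simp [ch_zero]
  | succ n ih => rw [ch_succ]; split_ifs <;> omega
theorem cb_le_ch (e s : ℕ) : D.cb e s ≤ D.ch e s := by
  induction s with
  | zero => simp [cb_zero]
  | succ n ih =>
    have := D.cb_le e n
    rw [cb_succ, ch_succ]; split_ifs with h1 h2 h2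
    · omega
    · exact absurd (Or.inl h1) h2
    · omega
    · exact ih
theorem ch_le_cb {e e' : ℕ} (he : e < e') (s : ℕ) : D.ch e s ≤ D.cb e' s := by
  induction s with
  | zero => simp [ch_zero]
  | succ n ih =>
    have := D.ch_le e n
    rw [cb_succ, ch_succ]; split_ifs with h1 h2 h2
    · omega
    · exfalso; apply h2
      rcases h1 with h1 | h1
      · obtain ⟨e'', m, j, h, hl⟩ := D.aLt_iff.1 h1
        exact D.aLt_iff.2 ⟨e'', m, j, h, by omega⟩
      · obtain ⟨j, h⟩ := D.aMv_iff.1 h1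
        exact D.aLt_iff.2 ⟨e, true, j, h, by omega⟩
    · omega
    · exact ih
theorem cb_mono (e : ℕ) : Monotone (D.cb e) := by
  apply monotone_nat_of_le_succ
  intro n; rw [cb_succ]; have := D.cb_le e n; split_ifs <;> omega
theorem ch_mono (e : ℕ) : Monotone (D.ch e) := by
  apply monotone_nat_of_le_succ
  intro n; rw [ch_succ]; have := D.ch_le e n; split_ifs <;> omega
theorem b_mono (e : ℕ) : Monotone (D.b e) := fun s s' h => by
  have := D.cb_mono e h; rw [b_eq, b_eq]; omega
theorem h_mono (e : ℕ) : Monotone (D.h e) := fun s s' h => by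
  have := D.ch_mono e h; rw [h_eq, h_eq]; omega
theorem b_lt_h (e s : ℕ) : D.b e s < D.h e s := by
  have := D.cb_le_ch e s; rw [b_eq, h_eq]; omega
theorem h_lt_b {e e' : ℕ} (he : e < e') (s : ℕ) : D.h e s < D.b e' s := by
  have := D.ch_le_cb he s; rw [b_eq, h_eq]; omega
theorem lt_b (e s : ℕ) : 2 * e < D.b e s := by rw [b_eq]; omega

/-- an act does not touch the markers of stronger requirements -/
theorem b_keep {e s : ℕ} (h : ¬ aLt (D.act s) e) : D.b e (s+1) = D.b e s := by
  rw [b_eq, b_eq, cb_succ, if_neg h]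
theorem h_keep {e s : ℕ} (h : ¬ aLt (D.act s) e) (h' : ¬ aMv (D.act s) e) :
    D.h e (s+1) = D.h e s := by
  rw [h_eq, h_eq, ch_succ, if_neg (by tauto)]
theorem h_move {e s : ℕ} (h : aLt (D.act s) e ∨ aMv (D.act s) e) :
    D.h e (s+1) = 2 * e + 2 + (s + 1) := by
  rw [h_eq, ch_succ, if_pos h]
theorem b_cut {e s : ℕ} (h : aLt (D.act s) e) : D.b e (s+1) = 2 * e + 1 + (s + 1) := by
  rw [b_eq, cb_succ, if_pos h]
theorem h_le (e s : ℕ) : D.h e s ≤ 2 * e + 2 + s := by have := D.ch_le e s; rw [h_eq]; omega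

theorem idx_ge {s e j : ℕ} {m : Bool} (h : D.act s = Option.some (e, m, j)) :
    D.b e s ≤ j ∧ j ≤ D.h e s := by
  rcases (D.act_some h).2.2 with h1 | h1
  · have := D.b_lt_h e s; omega
  · exact ⟨h1.2.2.2.1, h1.2.1.le⟩

theorem QF_empty {s g : ℕ} (h : s ≤ gam (g-1)) : D.QF s g = ∅ := by
  apply Finset.filter_eq_empty_iff.2
  intro t ht hq
  obtain ⟨σ, h1, h2, _, h3⟩ := D.qP_iff.1 hq
  have := D.us_le t σ h1
  omega

theorem GOOD (e s : ℕ) : ∃ g, D.b e (s+1) ≤ g ∧ g < D.h e (s+1) ∧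
    D.W (D.QF s g) * 2 ^ (2*e+2) ≤ D.W (D.PF s g (D.h e (s+1))) := by
  have fresh : s ≤ D.h e (s+1) - 2 → ∃ g, D.b e (s+1) ≤ g ∧ g < D.h e (s+1) ∧
    D.W (D.QF s g) * 2 ^ (2*e+2) ≤ D.W (D.PF s g (D.h e (s+1))) := by
    intro hs
    have := D.b_lt_h e (s+1)
    refine ⟨D.h e (s+1) - 1, by omega, by omega, ?_⟩
    rw [QF_empty]
    · simp [W]; exact D.W_nonneg _
    · have := lt_gam (D.h e (s+1) - 1 - 1)
      omega
  by_cases h1 : aLt (D.act s) e ∨ aMv (D.act s) e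
  · apply fresh; rw [D.h_move h1]; omega
  · push Not at h1
    by_cases hs : s ≤ e
    · apply fresh; rw [h_eq]; omega
    · have hM : ¬ D.condM e s := by
        rcases ha : D.act s with _ | ⟨e', m, j⟩
        · exact (D.act_none ha (by omega)).1
        · obtain ⟨_, h3, h4⟩ := D.act_some ha
          rcases lt_trichotomy e e' with h5 | h5 | h5
          · exact (h3 e h5).1
          · subst h5
            rcases h4 with h4 | h4
            · exact absurd (D.aMv_iff.2 ⟨j, by rw [ha, h4.1]⟩) h1.2
            · exact h4.2.2.1
          · exact absurd (D.aLt_iff.2 ⟨e', m, j, ha, h5⟩) h1.1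
      unfold condM at hM
      push Not at hM
      obtain ⟨g, hg1, hg2, hg3⟩ := hM.1
      exact ⟨g, by rw [D.b_keep h1.1]; exact hg1, by rw [D.h_keep h1.1 h1.2]; exact hg2,
        by rw [D.h_keep h1.1 h1.2]; exact hg3⟩
end Dat
end KPaper

namespace KPaper
namespace Dat
variable (D : Dat)

/-! ### Supply of elements -/

def Sup (s : ℕ) : Prop := ∀ e m j, D.act s = Option.some (e, m, j) →
  ∃ x, D.v s = Option.some x ∧ gam (j-1) ≤ x ∧ x < gam j ∧ x ∉ D.B s

theorem B_mono : Monotone D.B := fun s s' h n hn => by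
  obtain ⟨k, hk, hv⟩ := D.mem_B.1 hn
  exact D.mem_B.2 ⟨k, by omega, hv⟩

theorem kill_disj {k k' e e' j j' : ℕ} {m m' : Bool} (hk : k < k') (hS : D.Sup k)
    (ha : D.act k = Option.some (e, m, j))
    (g' h h' : ℕ) : Disjoint (D.RF k j h) (D.RF k' g' h') := by
  rw [Finset.disjoint_left]
  intro t h1 h2
  obtain ⟨_, i, hi, hji, hu⟩ := D.mem_RF.1 h1
  obtain ⟨_, i', hi', hji', hu'⟩ := D.mem_RF.1 h2
  obtain ⟨x, hx, _, hx2, hx3⟩ := hS _ _ _ ha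
  rw [hu] at hu'
  simp only [Option.some.injEq] at hu'
  have hl := congrArg List.length hu'
  rw [length_restr, length_restr] at hl
  rw [← hl] at hu'
  have := restr_eq_iff.1 hu' x (lt_of_lt_of_le hx2 (gam_mono hji))
  exact hx3 (this.2 (D.mem_B.2 ⟨k, hk, hx⟩))

theorem idx_pos {s e j : ℕ} {m : Bool} (h : D.act s = Option.some (e, m, j)) : 2 * e < j := by
  have := D.idx_ge h; have := D.lt_b e s; omega

theorem move_lt {k k' e j j' : ℕ} (hk : k < k') (h : D.act k = Option.some (e, true, j))
    (h' : D.act k' = Option.some (e, true, j')) : j < j' := by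
  have h1 := (D.act_some h).2.2
  have h2 := (D.act_some h').2.2
  simp at h1 h2
  have h3 := D.h_mono e (show k + 1 ≤ k' from hk)
  rw [D.h_move (Or.inr (D.aMv_iff.2 ⟨j, h⟩))] at h3
  have h4 := D.h_le e k
  omega

theorem sup_all (s : ℕ) : D.Sup s := by
  induction s using Nat.strong_induction_on with
  | _ s ih =>
  intro e m j ha
  have hj := D.idx_pos ha
  -- count of move acts
  let Mv := (Finset.range s).filter fun k => ∃ e, D.act k = Option.some (e, true, j)
  let Tv := (Finset.range s).filter fun k => ∃ e, D.act k = Option.some (e, false, j)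
  let actor : ℕ → ℕ := fun k => (D.act k).elim 0 fun p => p.1
  have hM : Mv.card ≤ j := by
    have : Mv.card ≤ (Finset.range j).card := by
      refine Finset.card_le_card_of_injOn actor ?_ ?_
      · intro k hk
        obtain ⟨_, e', he'⟩ := Finset.mem_filter.1 hk
        have := D.idx_pos he'
        simp [actor, he']; omega
      · intro k hk k' hk' heq
        obtain ⟨_, e1, h1⟩ := Finset.mem_filter.1 hk
        obtain ⟨_, e2, h2⟩ := Finset.mem_filter.1 hk'
        simp [actor, h1, h2] at heq
        subst heq
        rcases lt_trichotomy k k' with h | h | h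
        · exact absurd (D.move_lt h h1 h2) (by omega)
        · exact h
        · exact absurd (D.move_lt h h2 h1) (by omega)
    simpa using this
  have hT : Tv.card ≤ 4 ^ j := by
    have hd := D.W_disj_le Tv (fun k => D.RF k j (D.h (actor k) k)) (by
      intro k hk k' hk' hne
      obtain ⟨hks, e1, h1⟩ := Finset.mem_filter.1 hk
      obtain ⟨hks', e2, h2⟩ := Finset.mem_filter.1 hk'
      rw [Finset.mem_range] at hks hks'
      rcases lt_or_gt_of_ne hne with h | h
      · exact D.kill_disj (m' := false) (e' := 0) (j' := 0) h (ih k hks) h1 _ _ _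
      · exact (D.kill_disj (m' := false) (e' := 0) (j' := 0) h (ih k' hks') h2 _ _ _).symm)
    have hw : ∀ k ∈ Tv, (1/4:ℝ)^j ≤ D.W (D.RF k j (D.h (actor k) k)) := by
      intro k hk
      obtain ⟨hks, e1, h1⟩ := Finset.mem_filter.1 hk
      have hac : actor k = e1 := by simp [actor, h1]
      rw [hac]
      have h2 := (D.act_some h1).2.2
      simp at h2
      obtain ⟨h3, _, _, _, h4, h5⟩ := h2
      have h6 : D.W (D.PF k j (j+1)) ≤ D.W (D.PF k j (D.h e1 k)) := by
        apply W_mono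
        intro t ht
        obtain ⟨a1, i, a2, a3, a4⟩ := D.mem_PF.1 ht
        exact D.mem_PF.2 ⟨a1, i, by omega, a3, a4⟩
      have h7 := D.idx_pos h1
      have h8 : (1:ℝ) ≤ D.W (D.RF k j (D.h e1 k)) * 2 ^ (2*e1+j) := by
        have : (0:ℝ) < 2 ^ (e1+j) := by positivity
        calc (1:ℝ) ≤ D.W (D.PF k j (j+1)) * 2 ^ (e1 + j) := h4
          _ ≤ (2 ^ e1 * D.W (D.RF k j (D.h e1 k))) * 2 ^ (e1 + j) := by
            gcongr; linarith
          _ = _ := by rw [show 2 * e1 + j = e1 + (e1 + j) by ring, pow_add 2 e1]; ring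
      have h9 : (2:ℝ) ^ (2*e1+j) ≤ 4 ^ j := by
        rw [show (4:ℝ) = 2^2 by norm_num, ← pow_mul]
        exact pow_le_pow_right₀ (by norm_num) (by omega)
      have h10 := D.W_nonneg (D.RF k j (D.h e1 k))
      rw [one_div, inv_pow, inv_le_iff_one_le_mul₀ (by positivity)]
      nlinarith
    have h1 := (Finset.card_nsmul_le_sum Tv _ _ hw).trans hd
    rw [nsmul_eq_mul, one_div, inv_pow, ← div_eq_mul_inv, div_le_one (by positivity)] at h1
    exact_mod_cast h1
  have hcnt : D.cnt j s ≤ 4 ^ j + j := by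
    have : D.cnt j s ≤ Mv.card + Tv.card := by
      rw [cnt_eq, ← Finset.card_filter]
      refine le_trans (Finset.card_le_card ?_) (Finset.card_union_le Mv Tv)
      intro k hk
      obtain ⟨h1, h2⟩ := Finset.mem_filter.1 hk
      obtain ⟨e1, m1, h3⟩ := D.aIx_iff.1 h2
      rw [Finset.mem_union]
      cases m1
      · right; exact Finset.mem_filter.2 ⟨h1, e1, h3⟩
      · left; exact Finset.mem_filter.2 ⟨h1, e1, h3⟩
    omega
  have hlt : gam (j-1) + D.cnt j s < gam j := by
    obtain ⟨i, rfl⟩ : ∃ i, j = i + 1 := ⟨j-1, by omega⟩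
    have h1 := lt_gam i
    unfold gam at h1 ⊢
    have h2 : 4 ^ i ≤ 16 ^ i := Nat.pow_le_pow_left (by norm_num) i
    rw [pow_succ] at hcnt ⊢
    simp only [Nat.add_sub_cancel]
    omega
  refine ⟨gam (j-1) + D.cnt j s, by simp [v, ha], by omega, hlt, ?_⟩
  intro hB
  obtain ⟨k, hk, hv⟩ := D.mem_B.1 hB
  rcases hak : D.act k with _ | ⟨e', m', j'⟩
  · simp [v, hak] at hv
  · obtain ⟨x, hx, h1, h2, _⟩ := ih k hk _ _ _ hak
    have hj' := D.idx_pos hak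
    rw [hx] at hv
    simp at hv
    subst hv
    have hjj : j = j' := by
      rcases lt_trichotomy j j' with h | h | h
      · have := gam_mono (show j ≤ j' - 1 by omega); omega
      · exact h
      · have := gam_mono (show j' ≤ j - 1 by omega); omega
    subst hjj
    simp [v, hak] at hx
    rw [cnt_eq, cnt_eq] at hx
    have h3 : ∑ i ∈ Finset.range k, (if aIx (D.act i) j then 1 else 0) + 1 ≤
        ∑ i ∈ Finset.range s, (if aIx (D.act i) j then 1 else 0) := by
      have : ∑ i ∈ Finset.range (k+1), (if aIx (D.act i) j then 1 else 0) ≤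
        ∑ i ∈ Finset.range s, (if aIx (D.act i) j then 1 else 0) :=
        Finset.sum_le_sum_of_subset (Finset.range_mono hk)
      rw [Finset.sum_range_succ, if_pos (D.aIx_iff.2 ⟨e', m', hak⟩)] at this
      exact this
    omega

theorem B_succ_of_none {s : ℕ} (h : D.act s = Option.none) : D.B (s+1) = D.B s := by
  ext n
  rw [mem_B, mem_B]
  constructor
  · rintro ⟨k, hk, hv⟩
    rcases Nat.lt_succ_iff_lt_or_eq.1 hk with h1 | h1
    · exact ⟨k, h1, hv⟩
    · subst h1; simp [v, h] at hv
  · rintro ⟨k, hk, hv⟩; exact ⟨k, by omega, hv⟩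

/-- an act with index `j` changes `B` only at or above `gam (j-1)` -/
theorem B_succ_restr {s e j n : ℕ} {m : Bool} (h : D.act s = Option.some (e, m, j))
    (hn : n ≤ gam (j-1)) : restrSet (D.B (s+1)) n = restrSet (D.B s) n := by
  obtain ⟨x, hx, h1, h2, h3⟩ := D.sup_all s _ _ _ h
  apply restr_eq_iff.2
  intro i hi
  rw [mem_B, mem_B]
  constructor
  · rintro ⟨k, hk, hv⟩
    rcases Nat.lt_succ_iff_lt_or_eq.1 hk with h4 | h4
    · exact ⟨k, h4, hv⟩
    · subst h4; rw [hx] at hv; simp at hv; omega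
  · rintro ⟨k, hk, hv⟩; exact ⟨k, by omega, hv⟩
theorem B_changed {s e j n : ℕ} {m : Bool} (h : D.act s = Option.some (e, m, j))
    (hn : gam j ≤ n) : restrSet (D.B (s+1)) n ≠ restrSet (D.B s) n := by
  obtain ⟨x, hx, h1, h2, h3⟩ := D.sup_all s _ _ _ h
  intro heq
  exact h3 ((restr_eq_iff.1 heq x (by omega)).1 (D.mem_B.2 ⟨s, by omega, hx⟩))

/-- total kill by T-acts -/
theorem kill_le (I : Finset ℕ) (jf hf : ℕ → ℕ)
    (hI : ∀ k ∈ I, ∃ e m, D.act k = Option.some (e, m, jf k)) :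
    ∑ k ∈ I, D.W (D.RF k (jf k) (hf k)) ≤ 1 := by
  apply D.W_disj_le
  intro k hk k' hk' hne
  obtain ⟨e1, m1, h1⟩ := hI k hk
  obtain ⟨e2, m2, h2⟩ := hI k' hk'
  rcases lt_or_gt_of_ne hne with h | h
  · exact D.kill_disj (m' := false) (e' := 0) (j' := 0) h (D.sup_all k) h1 _ _ _
  · exact (D.kill_disj (m' := false) (e' := 0) (j' := 0) h (D.sup_all k') h2 _ _ _).symm
end Dat
end KPaper

namespace KPaper
/-! ### Machine-building lemmas -/

theorem KEnv.kc2 (E : KEnv) (r : ℕ → ℕ → Option (ℕ × Str)) (hr : Primrec fun p : ℕ × ℕ => r p.1 p.2)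
    (C : ℕ) (hC : ∀ S, ∑ s ∈ Finset.range S, ∑ t ∈ Finset.range S, rw' (r s t) ≤ C) :
    ∃ c : ℕ, ∀ s t d τ, r s t = Option.some (d, τ) → E.K τ ≤ d + c := by
  obtain ⟨c, hc⟩ := E.kc (fun i => r i.unpair.1 i.unpair.2)
    (Primrec.comp (f := fun p : ℕ × ℕ => r p.1 p.2) (g := fun i : ℕ => (i.unpair.1, i.unpair.2)) hr (by fun_prop)) C (by
      intro F
      refine le_trans ?_ (hC (F.sup id + 1))
      rw [← Finset.sum_product']
      rw [← Finset.sum_image (f := fun p : ℕ × ℕ => rw' (r p.1 p.2)) (s := F) (g := Nat.unpair)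
        (fun a _ b _ h => by
          have := congrArg (fun p => Nat.pair p.1 p.2) h
          simpa using this)]
      refine Finset.sum_le_sum_of_subset_of_nonneg ?_ fun _ _ _ => rw'_nonneg _
      intro p hp
      obtain ⟨i, hi, rfl⟩ := Finset.mem_image.1 hp
      have h1 : i ≤ F.sup id := Finset.le_sup (f := id) hi
      have h2 := Nat.unpair_left_le i
      have h3 := Nat.unpair_right_le i
      simp only [Finset.mem_product, Finset.mem_range]
      omega)
  refine ⟨c, fun s t d τ h => hc (Nat.pair s t) d τ (by simpa using h)⟩

theorem KEnv.kmap (E : KEnv) (f : Str → Str) (hf : Primrec f) :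
    ∃ c : ℕ, ∀ σ, E.K (f σ) ≤ E.K σ + c := by
  have hu := E.us_pr
  have hl := E.ul_pr
  obtain ⟨c, hc⟩ := E.kc (fun t => (E.us t).map fun σ => (E.ul t, f σ)) (by
      apply Primrec.option_map hu
      exact Primrec.pair (hl.comp Primrec.fst) (hf.comp Primrec.snd)) 1 (by
      intro F
      have := E.kraft (F.filter fun t => E.us t ≠ Option.none) (by simp)
      rw [Finset.sum_filter] at this
      push_cast
      refine le_trans (Finset.sum_le_sum fun t _ => ?_) this
      rcases h : E.us t with _ | σ <;> simp [rw'])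
  refine ⟨c, fun σ => ?_⟩
  obtain ⟨t, ht, hl⟩ := E.K_ex σ
  rw [← hl]
  exact hc t _ _ (by simp [ht])

namespace Dat
variable (D : Dat)

/-- complexity bound for short lengths -/
theorem K_zero_gam : ∃ c : ℕ, ∀ g, D.K (zeroStr (gam g)) ≤ g + c := by
  obtain ⟨c, hc⟩ := D.kc (fun m => Option.some (m, zeroStr (gam m))) (by fun_prop) 2 (by
    intro F
    have := sum_geom_inj F id (fun a _ b _ h => h) 0 (by simp)
    simpa [rw'] using this)
  exact ⟨c, fun g => hc g _ _ rfl⟩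

theorem alv_lt {t s : ℕ} (h : D.alv t s) : t < s := by
  obtain ⟨σ, _, h, _⟩ := D.alv_iff.1 h; exact h
theorem not_alv_zero (t : ℕ) : ¬ D.alv t 0 := fun h => by have := D.alv_lt h; omega
theorem alv_mid {t a b c : ℕ} (h1 : D.alv t a) (h2 : D.alv t c) (hab : a ≤ b) (hbc : b ≤ c) :
    D.alv t b := by
  obtain ⟨σ, h, h3, h4⟩ := D.alv_iff.1 h1
  obtain ⟨σ', h', h3', h4'⟩ := D.alv_iff.1 h2
  rw [h] at h'; obtain rfl := Option.some.inj h'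
  refine D.alv_iff.2 ⟨σ, h, by omega, ?_⟩
  rw [h4', length_restr] at h4
  rw [h4']
  rw [length_restr]
  apply restr_eq_iff.2
  have h5 := restr_eq_iff.1 h4
  intro i hi
  have m1 : i ∈ D.aS a → i ∈ D.aS b := fun h => D.aS_mono hab h
  have m2 : i ∈ D.aS b → i ∈ D.aS c := fun h => D.aS_mono hbc h
  have := h5 i hi
  exact ⟨fun h => m1 (this.1 h), fun h => m2 h⟩

noncomputable def len (t : ℕ) : ℕ := (D.us t).elim 0 List.length
theorem len_le (t : ℕ) : D.len t ≤ t := by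
  unfold len
  rcases h : D.us t with _ | σ
  · simp
  · simpa using D.us_le t σ h
theorem qP_iff' {t s g : ℕ} : D.qP s g t ↔ D.alv t s ∧ gam (g-1) < D.len t := by
  unfold qP len
  rcases h : D.us t with _ | σ <;> simp

def chE (e s t : ℕ) : Prop :=
  aMv (D.act s) e ∧ gam (D.h e s - 1) < D.len t ∧ D.alv t (s-1) ∧ D.alv t s
def chg (s t : ℕ) : Prop := ∃ e, D.chE e s t
def Y (e s t : ℕ) : Prop := D.alv t s ∧ ∃ s', D.cb e s ≤ s' ∧ s' < s ∧ D.chE e s' t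
noncomputable def YF (e s : ℕ) : Finset ℕ := (Finset.range s).filter (D.Y e s)
theorem mem_YF {e s t : ℕ} : t ∈ D.YF e s ↔ D.Y e s t := by
  unfold YF
  rw [Finset.mem_filter, Finset.mem_range]
  exact ⟨fun h => h.2, fun h => ⟨D.alv_lt h.1, h⟩⟩

theorem PF_mono {s s' g h g' h' : ℕ} (hs : s ≤ s') (hg : g' ≤ g) (hh : h ≤ h') :
    D.PF s g h ⊆ D.PF s' g' h' := by
  intro t ht
  obtain ⟨h1, i, h2, h3, h4⟩ := D.mem_PF.1 ht
  exact D.mem_PF.2 ⟨by omega, i, by omega, by omega, h4⟩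
theorem zeroStr_inj {a b : ℕ} (h : zeroStr a = zeroStr b) : a = b := by
  have := congrArg List.length h
  simpa [length_zero] using this
theorem PF_disj {s s' g h g' h' : ℕ} (hh : h ≤ g') : Disjoint (D.PF s g h) (D.PF s' g' h') := by
  rw [Finset.disjoint_left]
  intro t ht ht'
  obtain ⟨h1, i, h2, h3, h4⟩ := D.mem_PF.1 ht
  obtain ⟨h1', i', h2', h3', h4'⟩ := D.mem_PF.1 ht'
  rw [h4] at h4'
  have := gam_strictMono.injective (zeroStr_inj (Option.some.inj h4'))
  omega
theorem PF_add (s : ℕ) {a b c : ℕ} (hab : a ≤ b) (hbc : b ≤ c) :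
    D.W (D.PF s a b) + D.W (D.PF s b c) ≤ D.W (D.PF s a c) := by
  unfold W
  rw [← Finset.sum_union (D.PF_disj le_rfl)]
  exact D.W_mono (Finset.union_subset (D.PF_mono le_rfl le_rfl hbc) (D.PF_mono le_rfl hab le_rfl))

theorem not_aLt_of_aMv {s e : ℕ} (h : aMv (D.act s) e) : ¬ aLt (D.act s) e := by
  obtain ⟨j, h⟩ := D.aMv_iff.1 h
  rw [aLt_iff]
  rintro ⟨e', m, j', h', he⟩
  rw [h] at h'; simp at h'; omega

theorem chE_pos {e s t : ℕ} (h : D.chE e s t) : 1 ≤ s := by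
  have := D.alv_lt h.2.2.2; omega

theorem Y_inv (e s : ℕ) : ∀ j, D.b e s ≤ j → j ≤ D.h e s →
    D.W ((D.YF e s).filter fun t => D.len t ≤ gam (j-1)) * 2 ^ (2*e+2) ≤ D.W (D.PF s (D.b e s) j) := by
  induction s with
  | zero =>
    intro j _ _
    have : D.YF e 0 = ∅ := by unfold YF; simp
    rw [this]
    simp [W]
    exact D.W_nonneg _
  | succ s ih =>
    intro j hj hj'
    have pw : (0:ℝ) < 2 ^ (2*e+2) := by positivity
    by_cases hc : aLt (D.act s) e
    · have : D.YF e (s+1) = ∅ := by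
        apply Finset.eq_empty_of_forall_notMem
        intro t ht
        obtain ⟨_, s', h1, h2, _⟩ := D.mem_YF.1 ht
        rw [cb_succ, if_pos hc] at h1
        omega
      rw [this]
      simp [W]
      exact D.W_nonneg _
    have hb := D.b_keep hc
    have hcb : D.cb e (s+1) = D.cb e s := by rw [cb_succ, if_neg hc]
    rw [hb] at hj ⊢
    -- old elements
    have old : ∀ t, D.Y e (s+1) t → ¬ D.chE e s t → D.Y e s t ∧ D.alv t (s-1) := by
      intro t ⟨h1, s', h2, h3, h4⟩ hn
      have h5 : s' ≠ s := fun h => hn (h ▸ h4)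
      rw [hcb] at h2
      have := D.chE_pos h4
      exact ⟨⟨D.alv_mid h4.2.2.2 h1 (by omega) (by omega), s', h2, by omega, h4⟩,
        D.alv_mid h4.2.2.2 h1 (by omega) (by omega)⟩
    have key1 : (∀ t, D.Y e (s+1) t → D.len t ≤ gam (j-1) → ¬ D.chE e s t) → j ≤ D.h e s →
        D.W ((D.YF e (s+1)).filter fun t => D.len t ≤ gam (j-1)) * 2 ^ (2*e+2) ≤
          D.W (D.PF (s+1) (D.b e s) j) := by
      intro h1 h2
      refine le_trans ?_ (le_trans (ih j hj h2) (D.W_mono (D.PF_mono (by omega) le_rfl le_rfl)))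
      apply mul_le_mul_of_nonneg_right _ pw.le
      apply D.W_mono
      intro t ht
      rw [Finset.mem_filter, mem_YF] at ht ⊢
      exact ⟨(old t ht.1 (h1 t ht.1 ht.2)).1, ht.2⟩
    by_cases hm : aMv (D.act s) e
    · by_cases hjh : j ≤ D.h e s
      · apply key1 _ hjh
        intro t _ hl hch
        have := hch.2.1
        have := gam_mono (show j - 1 ≤ D.h e s - 1 by omega)
        omega
      · obtain ⟨j0, hact⟩ := D.aMv_iff.1 hm
        have hes := (D.act_some hact).1
        obtain ⟨s0, rfl⟩ : ∃ s0, s = s0 + 1 := ⟨s - 1, by omega⟩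
        obtain ⟨g, hg1, hg2, hg3⟩ := D.GOOD e s0
        have h1 := ih g hg1 hg2.le
        have hsub : (D.YF e (s0+1+1)).filter (fun t => D.len t ≤ gam (j-1)) ⊆
            (D.YF e (s0+1)).filter (fun t => D.len t ≤ gam (g-1)) ∪ D.QF s0 g := by
          intro t ht
          rw [Finset.mem_filter, mem_YF] at ht
          rw [Finset.mem_union, Finset.mem_filter, mem_YF]
          unfold QF
          rw [Finset.mem_filter, Finset.mem_range, qP_iff']
          have h2 : D.alv t s0 := by
            by_cases hch : D.chE e (s0+1) t
            · exact hch.2.2.1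
            · exact (old t ht.1 hch).2
          by_cases hl : D.len t ≤ gam (g-1)
          · left
            refine ⟨(old t ht.1 ?_).1, hl⟩
            intro hch
            have := hch.2.1
            have := gam_mono (show g - 1 ≤ D.h e (s0+1) - 1 by omega)
            omega
          · right
            exact ⟨D.alv_lt h2, h2, by omega⟩
        have h3 := (D.W_mono hsub).trans (D.W_union_le _ _)
        have h4 := D.PF_add (s0+1+1) hg1 (show g ≤ j by omega)
        have h5 := D.W_mono (D.PF_mono (show s0+1 ≤ s0+1+1 by omega) (le_refl (D.b e (s0+1))) (le_refl g))
        have h6 := D.W_mono (D.PF_mono (show s0 ≤ s0+1+1 by omega) (le_refl g) (show D.h e (s0+1) ≤ j by omega))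
        have := mul_le_mul_of_nonneg_right h3 pw.le
        linarith
    · apply key1 (fun t _ _ h => hm h.1)
      rwa [D.h_keep hc hm] at hj'

theorem Y_len {e s t : ℕ} (h : D.Y e s t) : D.len t ≤ gam (D.h e s - 1) ∧ e < s ∧ t + 2 ≤ D.h e s - 1 := by
  obtain ⟨h1, s', h2, h3, h4⟩ := h
  obtain ⟨j, hj⟩ := D.aMv_iff.1 h4.1
  have := (D.act_some hj).1
  have h5 := D.h_mono e (show s'+1 ≤ s from h3)
  rw [D.h_move (Or.inr h4.1)] at h5
  have := D.alv_lt h4.2.2.2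
  have := D.len_le t
  have := lt_gam (D.h e s - 1)
  refine ⟨by omega, by omega, by omega⟩

theorem Y_bound (e s : ℕ) : D.W (D.YF e s) * 2 ^ (2*e+2) ≤ D.W (D.PF s (D.b e s) (D.h e s)) := by
  have := D.Y_inv e s (D.h e s) (D.b_lt_h e s).le le_rfl
  rwa [Finset.filter_true_of_mem] at this
  intro t ht
  exact (D.Y_len (D.mem_YF.1 ht)).1

theorem cut_sum (e S : ℕ) : ∑ c ∈ (Finset.range S).filter (fun c => aLt (D.act c) e), D.W (D.YF e c)
    ≤ (1/2) ^ (2*e+2) := by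
  have h1 : ∑ c ∈ (Finset.range S).filter (fun c => aLt (D.act c) e),
      D.W (D.PF c (D.b e c) (D.h e c)) ≤ 1 := by
    apply D.W_disj_le
    have : ∀ c c', aLt (D.act c) e → c < c' → Disjoint (D.PF c (D.b e c) (D.h e c)) (D.PF c' (D.b e c') (D.h e c')) := by
      intro c c' hc hlt
      apply D.PF_disj
      have h1 := D.b_mono e (show c + 1 ≤ c' from hlt)
      rw [D.b_cut hc] at h1
      have := D.h_le e c
      omega
    intro c hc c' hc' hne
    rw [Finset.mem_filter] at hc hc'
    rcases lt_or_gt_of_ne hne with h | h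
    · exact this c c' hc.2 h
    · exact (this c' c hc'.2 h).symm
  have h2 : (∑ c ∈ (Finset.range S).filter (fun c => aLt (D.act c) e), D.W (D.YF e c)) * 2 ^ (2*e+2) ≤ 1 := by
    rw [Finset.sum_mul]
    exact le_trans (Finset.sum_le_sum fun c _ => D.Y_bound e c) h1
  rw [one_div, inv_pow, ← one_div, le_div_iff₀ (by positivity)]
  exact h2

theorem charge_inv (t S : ℕ) :
    let N := ∑ s ∈ Finset.range S, (if D.chg s t then 1 else 0)
    let m := ∑ c ∈ Finset.range S, ∑ e ∈ Finset.range c, (if aLt (D.act c) e ∧ D.Y e c t then 1 else 0)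
    N ≤ m + 1 ∧ (D.alv t S → (∀ e, ¬ D.Y e S t) → N ≤ m) := by
  induction S with
  | zero => simp
  | succ S ih =>
    simp only at ih ⊢
    rw [Finset.sum_range_succ, Finset.sum_range_succ]
    have cutS : (∃ e, aLt (D.act S) e ∧ D.Y e S t) → 1 ≤ ∑ e ∈ Finset.range S, (if aLt (D.act S) e ∧ D.Y e S t then 1 else 0) := by
      rintro ⟨e, h⟩
      have : e ∈ Finset.range S := Finset.mem_range.2 (D.Y_len h.2).2.1
      refine le_trans ?_ (Finset.single_le_sum (f := fun e => if aLt (D.act S) e ∧ D.Y e S t then 1 else 0) (by intros; positivity) this)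
      simp [h]
    by_cases hch : D.chg S t
    · rw [if_pos hch]
      obtain ⟨e, hch⟩ := hch
      have hY' : D.alv t (S+1) → D.Y e (S+1) t := by
        intro h
        refine ⟨h, S, ?_, by omega, hch⟩
        rw [cb_succ, if_neg (D.not_aLt_of_aMv hch.1)]
        exact D.cb_le e S
      refine ⟨?_, fun h h' => absurd (hY' h) (h' e)⟩
      by_cases hY : ∃ e', D.Y e' S t
      · obtain ⟨e', hY⟩ := hY
        have : e < e' := by
          by_contra hle
          have h1 := (D.Y_len hY).2.2
          have h2 : D.h e' S ≤ D.h e S := by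
            rcases Nat.eq_or_lt_of_le (not_lt.1 hle) with h | h
            · rw [h]
            · have := D.h_lt_b h S
              have := D.b_lt_h e S
              omega
          have h3 := hch.2.1
          have := lt_gam (D.h e S - 1)
          have := D.len_le t
          omega
        obtain ⟨j, hj⟩ := D.aMv_iff.1 hch.1
        have := cutS ⟨e', D.aLt_iff.2 ⟨e, true, j, hj, this⟩, hY⟩
        omega
      · have := ih.2 hch.2.2.2 (fun e h => hY ⟨e, h⟩)
        omega
    · rw [if_neg hch]
      refine ⟨by omega, fun h1 h2 => ?_⟩
      by_cases hal : D.alv t S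
      · by_cases hY : ∃ e', D.Y e' S t
        · obtain ⟨e', hY⟩ := hY
          have : aLt (D.act S) e' := by
            by_contra hn
            obtain ⟨_, s', h3, h4, h5⟩ := hY
            exact h2 e' ⟨h1, s', by rw [cb_succ, if_neg hn]; exact h3, by omega, h5⟩
          have := cutS ⟨e', this, hY⟩
          omega
        · have := ih.2 hal (fun e h => hY ⟨e, h⟩)
          omega
      · have : ∑ s ∈ Finset.range S, (if D.chg s t then 1 else 0) = 0 := by
          apply Finset.sum_eq_zero
          intro s hs
          rw [if_neg]
          rintro ⟨e, he⟩
          exact hal (D.alv_mid he.2.2.2 h1 (Finset.mem_range.1 hs).le (by omega))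
        omega

theorem geom_e (S : ℕ) : ∑ e ∈ Finset.range S, (1/2:ℝ) ^ (2*e+2) ≤ 1 := by
  have := sum_geom_inj (Finset.range S) (fun e => 2*e+2) (fun a _ b _ h => by simp at h; omega) 2 (by simp)
  linarith [this]

theorem ite_w {p : Prop} [Decidable p] (t : ℕ) : (if p then D.w t else 0) = D.w t * ((if p then 1 else 0 : ℕ) : ℝ) := by
  split_ifs <;> simp

/-- total cost of the moves -/
theorem move_cost (S : ℕ) :
    ∑ s ∈ Finset.range S, ∑ t ∈ Finset.range S, (if D.chg s t then D.w t else 0) ≤ 2 := by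
  rw [Finset.sum_comm]
  have h1 : ∀ t ∈ Finset.range S, ∑ s ∈ Finset.range S, (if D.chg s t then D.w t else 0) ≤
      D.w t + ∑ c ∈ Finset.range S, ∑ e ∈ Finset.range c, (if aLt (D.act c) e ∧ D.Y e c t then D.w t else 0) := by
    intro t _
    have := (D.charge_inv t S).1
    have : ((∑ s ∈ Finset.range S, (if D.chg s t then 1 else 0) : ℕ) : ℝ) ≤ ((∑ c ∈ Finset.range S, ∑ e ∈ Finset.range c, (if aLt (D.act c) e ∧ D.Y e c t then 1 else 0) : ℕ) : ℝ) + 1 := by exact_mod_cast this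
    have := mul_le_mul_of_nonneg_left this (D.w_nonneg t)
    simp only [ite_w]
    simp only [← Finset.mul_sum, ← Nat.cast_sum]
    linarith
  refine (Finset.sum_le_sum h1).trans ?_
  rw [Finset.sum_add_distrib]
  have h2 : ∑ t ∈ Finset.range S, D.w t ≤ 1 := D.W_le_one _
  have h3 : ∑ t ∈ Finset.range S, ∑ c ∈ Finset.range S, ∑ e ∈ Finset.range c, (if aLt (D.act c) e ∧ D.Y e c t then D.w t else 0) ≤
      ∑ c ∈ Finset.range S, ∑ e ∈ Finset.range S, if aLt (D.act c) e then D.W (D.YF e c) else 0 := by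
    rw [Finset.sum_comm]
    apply Finset.sum_le_sum
    intro c hc
    rw [Finset.sum_comm]
    have hsub : Finset.range c ⊆ Finset.range S := by
      have := Finset.mem_range.1 hc
      intro x hx; rw [Finset.mem_range] at hx ⊢; omega
    refine le_trans ?_ (Finset.sum_le_sum_of_subset_of_nonneg hsub ?_)
    · apply Finset.sum_le_sum
      intro e _
      split_ifs with h
      · simp only [h, true_and]
        rw [← Finset.sum_filter]
        apply D.W_mono
        intro t ht
        rw [mem_YF]; exact (Finset.mem_filter.1 ht).2
      · simp [h]
    · intro e _ _
      split_ifs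
      · exact D.W_nonneg _
      · exact le_rfl
  have h4 : ∑ e ∈ Finset.range S, ∑ c ∈ Finset.range S, (if aLt (D.act c) e then D.W (D.YF e c) else 0) ≤ ∑ e ∈ Finset.range S, (1/2:ℝ) ^ (2*e+2) := by
    apply Finset.sum_le_sum
    intro e _
    rw [← Finset.sum_filter]
    exact D.cut_sum e S
  rw [Finset.sum_comm (f := fun c e => if aLt (D.act c) e then D.W (D.YF e c) else 0)] at h3
  linarith [geom_e S]
end Dat
end KPaper

namespace KPaper

theorem KEnv.kc3 (E : KEnv) (r : ℕ → ℕ → ℕ → Option (ℕ × Str))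
    (hr : Primrec fun p : ℕ × ℕ × ℕ => r p.1 p.2.1 p.2.2)
    (C : ℕ) (hC : ∀ S, ∑ e ∈ Finset.range S, ∑ s ∈ Finset.range S, ∑ t ∈ Finset.range S,
      rw' (r e s t) ≤ C) :
    ∃ c : ℕ, ∀ e s t d τ, r e s t = Option.some (d, τ) → E.K τ ≤ d + c := by
  let f : ℕ → ℕ × ℕ × ℕ := fun i => (i.unpair.1, i.unpair.2.unpair.1, i.unpair.2.unpair.2)
  have hf : Primrec f := by unfold f; fun_prop
  obtain ⟨c, hc⟩ := E.kc (fun i => r (f i).1 (f i).2.1 (f i).2.2)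
    (Primrec.comp (f := fun p : ℕ × ℕ × ℕ => r p.1 p.2.1 p.2.2) (g := f) hr hf) C (by
      intro F
      refine le_trans ?_ (hC (F.sup id + 1))
      simp only [← Finset.sum_product']
      rw [← Finset.sum_image (f := fun p : ℕ × ℕ × ℕ => rw' (r p.1 p.2.1 p.2.2)) (s := F) (g := f)
        (fun a _ b _ h => by
          have := congrArg (fun p : ℕ × ℕ × ℕ => Nat.pair p.1 (Nat.pair p.2.1 p.2.2)) h
          simpa [f] using this)]
      have := Finset.sum_le_sum_of_subset_of_nonneg (f := fun p : ℕ × ℕ × ℕ => rw' (r p.1 p.2.1 p.2.2))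
        (s := F.image f) (t := Finset.range (F.sup id + 1) ×ˢ Finset.range (F.sup id + 1) ×ˢ Finset.range (F.sup id + 1)) ?_ fun _ _ _ => rw'_nonneg _
      · refine this.trans (le_of_eq ?_)
        rw [Finset.sum_product]
      intro p hp
      obtain ⟨i, hi, rfl⟩ := Finset.mem_image.1 hp
      have h1 : i ≤ F.sup id := Finset.le_sup (f := id) hi
      have h2 := Nat.unpair_left_le i
      have h3 := Nat.unpair_right_le i
      have h2' := Nat.unpair_left_le i.unpair.2
      have h3' := Nat.unpair_right_le i.unpair.2
      simp only [f, Finset.mem_product, Finset.mem_range]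
      omega)
  refine ⟨c, fun e s t d τ h => hc (Nat.pair e (Nat.pair s t)) d τ (by simpa [f] using h)⟩

theorem settle (X : ℕ → Set ℕ) (hX : Monotone X) (n : ℕ) :
    ∃ s0, ∀ s ≥ s0, restrSet (X s) n = restrSet {i | ∃ s, i ∈ X s} n := by
  have : ∀ i, ∃ s0, ∀ s ≥ s0, (i ∈ X s ↔ ∃ s, i ∈ X s) := by
    intro i
    by_cases h : ∃ s, i ∈ X s
    · obtain ⟨s, hs⟩ := h
      exact ⟨s, fun s' h' => ⟨fun h => ⟨s', h⟩, fun _ => hX h' hs⟩⟩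
    · exact ⟨0, fun s' _ => ⟨fun h => ⟨s', h⟩, fun h' => absurd h' h⟩⟩
  choose f hf using this
  refine ⟨(Finset.range n).sup f, fun s hs => restr_eq_iff.2 fun i hi => ?_⟩
  exact hf i s (le_trans (Finset.le_sup (f := f) (Finset.mem_range.2 hi)) hs)

namespace Dat
variable (D : Dat)

def Alim : Set ℕ := {n | ∃ s, n ∈ D.aS s}
def Blim : Set ℕ := {n | ∃ s, n ∈ D.B s}
theorem A_settle (n : ℕ) : ∃ s0, ∀ s ≥ s0, restrSet (D.aS s) n = restrSet D.Alim n :=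
  settle D.aS D.aS_mono n
theorem B_settle (n : ℕ) : ∃ s0, ∀ s ≥ s0, restrSet (D.B s) n = restrSet D.Blim n :=
  settle D.B D.B_mono n

section
variable {α : Type} [Primcodable α]
@[fun_prop] theorem pr_len {t : α → ℕ} (ht : Primrec t) : Primrec fun a => D.len (t a) := by
  unfold len; fun_prop
end

theorem len_eq {t : ℕ} {σ : Str} (h : D.us t = Option.some σ) : D.len t = σ.length := by
  simp [len, h]

/-- a predicate holding on an interval starts at most once -/
theorem start_le (p : ℕ → Prop) (hp : ∀ a b c, p a → p c → a ≤ b → b ≤ c → p b) 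
    (w : ℝ) (hw : 0 ≤ w) (S : ℕ) :
    ∑ s ∈ Finset.range S, (if p s ∧ ¬ p (s-1) then w else 0) ≤ w := by
  rw [← Finset.sum_filter, Finset.sum_const, nsmul_eq_mul]
  have : ((Finset.range S).filter fun s => p s ∧ ¬ p (s-1)).card ≤ 1 := by
    apply Finset.card_le_one.2
    have key : ∀ a b, p a → p b → ¬ p (b-1) → ¬ a < b := fun a b h1 h2 h3 h4 =>
      h3 (hp a (b-1) b h1 h2 (by omega) (by omega))
    intro a ha b hb
    rw [Finset.mem_filter] at ha hb
    have h1 := key a b ha.2.1 hb.2.1 hb.2.2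
    have h2 := key b a hb.2.1 ha.2.1 ha.2.2
    omega
  have : (((Finset.range S).filter fun s => p s ∧ ¬ p (s-1)).card : ℝ) ≤ 1 := by exact_mod_cast this
  nlinarith

def TT (s t : ℕ) : Prop := ∃ e j, D.act s = Option.some (e, false, j) ∧ D.qP s j t

theorem T_good {s e j : ℕ} (h : D.act s = Option.some (e, false, j)) :
    D.W (D.PF s j (D.h e s)) ≤ 2 ^ e * D.W (D.RF s j (D.h e s)) ∧
    D.W (D.QF s j) ≤ D.W (D.RF s j (D.h e s)) := by
  have h1 := (D.act_some h).2.2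
  simp at h1
  obtain ⟨_, _, _, h2, _, h3⟩ := h1
  refine ⟨h3, ?_⟩
  unfold good at h2
  have h4 := h2.trans h3
  have hp : (0:ℝ) < 2 ^ e := by positivity
  have h5 : (2:ℝ) ^ e ≤ 2 ^ (2*e+2) := pow_le_pow_right₀ (by norm_num) (by omega)
  have h6 := mul_le_mul_of_nonneg_left h5 (D.W_nonneg (D.QF s j))
  have : 2 ^ e * D.W (D.QF s j) ≤ 2 ^ e * D.W (D.RF s j (D.h e s)) := by linarith
  exact le_of_mul_le_mul_left this hp

/-- kill mass of stage `s` -/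
noncomputable def km (s : ℕ) : ℝ := (D.act s).elim 0 fun p => D.W (D.RF s p.2.2 (D.h p.1 s))
theorem km_nonneg (s : ℕ) : 0 ≤ D.km s := by
  unfold km
  rcases D.act s with _ | p
  · simp
  · exact D.W_nonneg _
theorem km_sum (S : ℕ) : ∑ s ∈ Finset.range S, D.km s ≤ 1 := by
  have := D.kill_le ((Finset.range S).filter fun s => D.act s ≠ Option.none)
    (fun s => (D.act s).elim 0 fun p => p.2.2) (fun s => (D.act s).elim 0 fun p => D.h p.1 s) (by
      intro k hk
      have := (Finset.mem_filter.1 hk).2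
      rcases h : D.act k with _ | ⟨e, m, j⟩
      · exact absurd h this
      · exact ⟨e, m, by simp⟩)
  rw [Finset.sum_filter] at this
  refine le_trans (Finset.sum_le_sum fun s _ => ?_) this
  unfold km
  rcases h : D.act s with _ | p <;> simp

theorem T_cost (S : ℕ) :
    ∑ s ∈ Finset.range S, ∑ t ∈ Finset.range S, (if D.TT s t then D.w t else 0) ≤ 1 := by
  refine le_trans (Finset.sum_le_sum fun s _ => ?_) (D.km_sum S)
  by_cases h : ∃ e j, D.act s = Option.some (e, false, j)
  · obtain ⟨e, j, h⟩ := h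
    have h1 := (D.T_good h).2
    have h2 : D.km s = D.W (D.RF s j (D.h e s)) := by simp [km, h]
    rw [h2]
    refine le_trans ?_ h1
    rw [← Finset.sum_filter]
    apply D.W_mono
    intro t ht
    obtain ⟨e', j', h3, h4⟩ := (Finset.mem_filter.1 ht).2
    rw [h] at h3
    simp at h3
    unfold QF
    rw [Finset.mem_filter, Finset.mem_range, h3.2]
    exact ⟨D.alv_lt h4.1, h4⟩
  · have : ∀ t, ¬ D.TT s t := fun t ⟨e, j, h1, _⟩ => h ⟨e, j, h1⟩
    simp [this, D.km_nonneg s]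

def r1P (s t : ℕ) : Prop := D.alv t s ∧
  ¬ (D.alv t (s-1) ∧ restrSet (D.B (s+1)) (D.len t) = restrSet (D.B s) (D.len t))
noncomputable def r1 (s t : ℕ) : Option (ℕ × Str) :=
  if D.r1P s t then Option.some (D.ul t, restrSet (D.B (s+1)) (D.len t)) else Option.none

theorem r1_pr : Primrec fun p : ℕ × ℕ => D.r1 p.1 p.2 := by
  unfold r1 r1P; fun_prop

theorem alv_w {t s : ℕ} (h : D.alv t s) : D.w t = (1/2) ^ D.ul t := by
  obtain ⟨σ, h, _⟩ := D.alv_iff.1 h; exact D.w_some h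

theorem r1_le (s t : ℕ) : rw' (D.r1 s t) ≤ (if D.alv t s ∧ ¬ D.alv t (s-1) then D.w t else 0) +
    (if D.TT s t then D.w t else 0) + (if D.chg s t then D.w t else 0) := by
  have hw := D.w_nonneg t
  have hz : ∀ (p : Prop) [Decidable p], 0 ≤ (if p then D.w t else 0) := fun p _ => by split_ifs <;> simp [hw]
  unfold r1
  by_cases h : D.r1P s t
  swap
  · rw [if_neg h]
    have : rw' Option.none = 0 := rfl
    rw [this]
    have := hz (D.alv t s ∧ ¬ D.alv t (s-1)); have := hz (D.TT s t); have := hz (D.chg s t); linarith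
  rw [if_pos h]
  have hr : rw' (Option.some (D.ul t, restrSet (D.B (s+1)) (D.len t))) = D.w t := by
    rw [D.alv_w h.1]; rfl
  rw [hr]
  obtain ⟨h1, h2⟩ := h
  have z1 := hz (D.alv t s ∧ ¬ D.alv t (s-1)); have z2 := hz (D.TT s t); have z3 := hz (D.chg s t)
  by_cases h3 : D.alv t (s-1)
  · have h4 : restrSet (D.B (s+1)) (D.len t) ≠ restrSet (D.B s) (D.len t) := fun h => h2 ⟨h3, h⟩
    rcases ha : D.act s with _ | ⟨e, m, j⟩
    · exact absurd (by rw [D.B_succ_of_none ha]) h4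
    · have h5 : gam (j-1) < D.len t := by
        by_contra hn
        exact h4 (D.B_succ_restr ha (by omega))
      cases m
      · have : D.TT s t := ⟨e, j, ha, D.qP_iff'.2 ⟨h1, h5⟩⟩
        rw [if_pos this]; linarith
      · have hj := (D.act_some ha).2.2
        simp at hj
        have : D.chg s t := ⟨e, D.aMv_iff.2 ⟨j, ha⟩, by rw [← hj.1]; exact h5, h3, h1⟩
        rw [if_pos this]; linarith
  · rw [if_pos (show D.alv t s ∧ ¬ D.alv t (s-1) from ⟨h1, h3⟩)]; linarith

theorem r1_sum (S : ℕ) : ∑ s ∈ Finset.range S, ∑ t ∈ Finset.range S, rw' (D.r1 s t) ≤ (4 : ℕ) := by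
  refine le_trans (Finset.sum_le_sum fun s _ => Finset.sum_le_sum fun t _ => D.r1_le s t) ?_
  simp only [Finset.sum_add_distrib]
  have h1 := D.T_cost S
  have h2 := D.move_cost S
  have h3 : ∑ s ∈ Finset.range S, ∑ t ∈ Finset.range S, (if D.alv t s ∧ ¬ D.alv t (s-1) then D.w t else 0) ≤ 1 := by
    rw [Finset.sum_comm]
    refine le_trans (Finset.sum_le_sum fun t _ => start_le (D.alv t) (fun a b c h1 h2 h3 h4 => D.alv_mid h1 h2 h3 h4) (D.w t) (D.w_nonneg t) S) (D.W_le_one _)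
  push_cast
  linarith

theorem M1 : ∃ c : ℕ, ∀ n, D.K (restrSet D.Blim n) ≤ D.K (restrSet D.Alim n) + c := by
  obtain ⟨c, hc⟩ := D.kc2 D.r1 D.r1_pr 4 D.r1_sum
  refine ⟨c, fun n => ?_⟩
  obtain ⟨t, ht, hl⟩ := D.K_ex (restrSet D.Alim n)
  rw [← hl]
  have hlen : D.len t = n := by rw [D.len_eq ht, length_restr]
  have hex : ∃ s, D.alv t s ∧ restrSet (D.B (s+1)) n = restrSet D.Blim n := by
    obtain ⟨s1, h1⟩ := D.A_settle n
    obtain ⟨s2, h2⟩ := D.B_settle n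
    refine ⟨s1 + s2 + t + 1, D.alv_iff.2 ⟨_, ht, by omega, ?_⟩, h2 _ (by omega)⟩
    rw [length_restr, h1 _ (by omega)]
  let s := Nat.find hex
  have hs : D.alv t s ∧ restrSet (D.B (s+1)) n = restrSet D.Blim n := Nat.find_spec hex
  apply hc s t
  unfold r1
  rw [if_pos, hlen, hs.2]
  refine ⟨hs.1, fun hn => ?_⟩
  rw [hlen, hs.2] at hn
  have hpos : 1 ≤ s := by have := D.alv_lt hs.1; omega
  refine Nat.find_min hex (m := s - 1) (show s - 1 < s by omega) ⟨hn.1, ?_⟩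
  rw [show s - 1 + 1 = s by omega]
  exact hn.2.symm

/-! ### The strictness machine -/
def inw (e t s : ℕ) : Prop := t < s ∧ D.pP (D.b e s) (D.h e s) t
theorem inw_mid {e t a b c : ℕ} (h1 : D.inw e t a) (h2 : D.inw e t c) (hab : a ≤ b) (hbc : b ≤ c) :
    D.inw e t b := by
  obtain ⟨h3, i, h4, h5, h6⟩ := h1
  obtain ⟨h3', i', h4', h5', h6'⟩ := h2
  rw [h6] at h6'
  have := gam_strictMono.injective (zeroStr_inj (Option.some.inj h6'))
  subst this
  have := D.h_mono e hab
  have := D.b_mono e hbc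
  exact ⟨by omega, i, by omega, by omega, h6⟩

def r2P (e s t : ℕ) : Prop := D.inw e t s ∧
  ¬ (D.inw e t (s-1) ∧ restrSet (D.B s) (D.len t) = restrSet (D.B (s-1)) (D.len t))
noncomputable def r2 (e s t : ℕ) : Option (ℕ × Str) :=
  if D.r2P e s t then Option.some (D.ul t + (e + 1), restrSet (D.B s) (D.len t)) else Option.none
theorem r2_pr : Primrec fun p : ℕ × ℕ × ℕ => D.r2 p.1 p.2.1 p.2.2 := by
  unfold r2 r2P inw; fun_prop

def T2 (e s t : ℕ) : Prop := 1 ≤ s ∧ ∃ j, D.act (s-1) = Option.some (e, false, j) ∧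
  t ∈ D.PF (s-1) j (D.h e (s-1))

theorem r2_le (e s t : ℕ) : rw' (D.r2 e s t) ≤ (1/2)^(e+1) *
   ((if D.inw e t s ∧ ¬ D.inw e t (s-1) then D.w t else 0) + if D.T2 e s t then D.w t else 0) := by
  have hw := D.w_nonneg t
  have hz : ∀ (p : Prop) [Decidable p], 0 ≤ (if p then D.w t else 0) := fun p _ => by split_ifs <;> simp [hw]
  have z1 := hz (D.inw e t s ∧ ¬ D.inw e t (s-1)); have z2 := hz (D.T2 e s t)
  have pp : (0:ℝ) < (1/2)^(e+1) := by positivity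
  unfold r2
  by_cases h : D.r2P e s t
  swap
  · rw [if_neg h]
    have : rw' Option.none = 0 := rfl
    rw [this]
    positivity
  rw [if_pos h]
  obtain ⟨h1, h2⟩ := h
  have hr : rw' (Option.some (D.ul t + (e + 1), restrSet (D.B s) (D.len t))) = (1/2)^(e+1) * D.w t := by
    obtain ⟨_, i, _, _, hu⟩ := h1
    rw [D.w_some hu, ← pow_add, add_comm (e+1)]; rfl
  rw [hr]
  apply mul_le_mul_of_nonneg_left _ pp.le
  by_cases h3 : D.inw e t (s-1)
  · have h4 : restrSet (D.B s) (D.len t) ≠ restrSet (D.B (s-1)) (D.len t) := fun h => h2 ⟨h3, h⟩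
    obtain ⟨s0, rfl⟩ : ∃ s0, s = s0 + 1 := ⟨s - 1, by have := h1.1; omega⟩
    simp only [Nat.add_sub_cancel] at *
    rcases ha : D.act s0 with _ | ⟨e', m, j⟩
    · exact absurd (by rw [D.B_succ_of_none ha]) h4
    · have h5 : gam (j-1) < D.len t := by
        by_contra hn
        exact h4 (D.B_succ_restr ha (by omega))
      have hT : D.T2 e (s0+1) t := by
        obtain ⟨ht, i, hi1, hi2, hu⟩ := h1
        obtain ⟨ht', i', hi1', hi2', hu'⟩ := h3
        rw [hu] at hu'
        have := gam_strictMono.injective (zeroStr_inj (Option.some.inj hu'))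
        subst this
        rw [D.len_eq hu, length_zero] at h5
        have hji := gam_strictMono.lt_iff_lt.1 h5
        have hx := D.idx_ge ha
        rcases lt_trichotomy e' e with hlt | heq | hgt
        · rw [D.b_cut (D.aLt_iff.2 ⟨e', m, j, ha, hlt⟩)] at hi2
          have := D.h_le e s0
          omega
        · subst heq
          have hj := (D.act_some ha).2.2
          cases m
          · refine ⟨by omega, j, ha, D.mem_PF.2 ⟨ht', i, hi1', by omega, hu⟩⟩
          · simp at hj; omega
        · have := D.h_lt_b hgt s0
          omega
      rw [if_pos hT]
      linarith
  · rw [if_pos (show D.inw e t s ∧ ¬ D.inw e t (s-1) from ⟨h1, h3⟩)]; linarith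

theorem geom1 (S : ℕ) : ∑ e ∈ Finset.range S, (1/2:ℝ) ^ (e+1) ≤ 1 := by
  have := sum_geom_inj (Finset.range S) (fun e => e+1) (fun a _ b _ h => by simpa using h) 1 (by simp)
  linarith [this]

theorem T2_cost (S : ℕ) : ∑ e ∈ Finset.range S, ∑ s ∈ Finset.range S, ∑ t ∈ Finset.range S,
    (1/2:ℝ)^(e+1) * (if D.T2 e s t then D.w t else 0) ≤ 1 := by
  rw [Finset.sum_comm]
  have key : ∀ s ∈ Finset.range S, ∑ e ∈ Finset.range S, ∑ t ∈ Finset.range S,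
    (1/2:ℝ)^(e+1) * (if D.T2 e s t then D.w t else 0) ≤ if 1 ≤ s then D.km (s-1) else 0 := by
    intro s hs
    by_cases h : 1 ≤ s ∧ ∃ e j, D.act (s-1) = Option.some (e, false, j)
    · obtain ⟨h0, e, j, h⟩ := h
      rw [if_pos h0]
      have hT := (D.T_good h).1
      have hkm : D.km (s-1) = D.W (D.RF (s-1) j (D.h e (s-1))) := by simp [km, h]
      have hes := (D.act_some h).1
      rw [hkm, Finset.sum_eq_single_of_mem e (by rw [Finset.mem_range] at hs ⊢; omega)]
      · rw [← Finset.mul_sum, ← Finset.sum_filter]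
        have : D.W ((Finset.range S).filter fun t => D.T2 e s t) ≤ D.W (D.PF (s-1) j (D.h e (s-1))) := by
          apply D.W_mono
          intro t ht
          obtain ⟨_, j', h1, h2⟩ := (Finset.mem_filter.1 ht).2
          rw [h] at h1
          simp at h1
          rw [h1]; exact h2
        have h3 := mul_le_mul_of_nonneg_left (this.trans hT) (show (0:ℝ) ≤ (1/2)^(e+1) by positivity)
        refine h3.trans ?_
        have hh : (1/2:ℝ)^(e+1) * 2^e = 1/2 := by
          rw [pow_succ, mul_right_comm, ← mul_pow]; norm_num
        rw [← mul_assoc, hh]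
        linarith [D.W_nonneg (D.RF (s-1) j (D.h e (s-1)))]
      · intro e' _ hne
        apply Finset.sum_eq_zero
        intro t _
        rw [if_neg, mul_zero]
        rintro ⟨_, j', h1, _⟩
        rw [h] at h1
        simp at h1
        exact hne h1.1.symm
    · have : ∀ e t, ¬ D.T2 e s t := fun e t ⟨h1, j, h2, _⟩ => h ⟨h1, e, j, h2⟩
      simp only [this, if_false, mul_zero, Finset.sum_const_zero]
      split_ifs
      · exact D.km_nonneg _
      · exact le_rfl
  refine (Finset.sum_le_sum key).trans ?_
  rcases S with _ | S
  · simp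
  · rw [Finset.sum_range_succ']
    simpa using D.km_sum S

theorem r2_sum (S : ℕ) : ∑ e ∈ Finset.range S, ∑ s ∈ Finset.range S, ∑ t ∈ Finset.range S,
    rw' (D.r2 e s t) ≤ (2 : ℕ) := by
  refine le_trans (Finset.sum_le_sum fun e _ => Finset.sum_le_sum fun s _ => Finset.sum_le_sum fun t _ => D.r2_le e s t) ?_
  simp only [mul_add, Finset.sum_add_distrib]
  have h2 := D.T2_cost S
  have h1 : ∑ e ∈ Finset.range S, ∑ s ∈ Finset.range S, ∑ t ∈ Finset.range S,
    (1/2:ℝ)^(e+1) * (if D.inw e t s ∧ ¬ D.inw e t (s-1) then D.w t else 0) ≤ 1 := by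
    refine le_trans (Finset.sum_le_sum fun e _ => ?_) (geom1 S)
    rw [Finset.sum_comm]
    simp only [← Finset.mul_sum]
    have : ∑ t ∈ Finset.range S, ∑ s ∈ Finset.range S, (if D.inw e t s ∧ ¬ D.inw e t (s-1) then D.w t else 0) ≤ 1 :=
      le_trans (Finset.sum_le_sum fun t _ => start_le (D.inw e t) (fun a b c h1 h2 h3 h4 => D.inw_mid h1 h2 h3 h4) (D.w t) (D.w_nonneg t) S) (D.W_le_one _)
    exact mul_le_of_le_one_right (by positivity) this
  push_cast
  linarith

theorem M2a : ∃ c : ℕ, ∀ e i s0, (∀ s ≥ s0, D.b e s ≤ i ∧ i < D.h e s) →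
    D.K (restrSet D.Blim (gam i)) ≤ D.K (zeroStr (gam i)) + (e + 1) + c := by
  obtain ⟨c, hc⟩ := D.kc3 D.r2 D.r2_pr 2 D.r2_sum
  refine ⟨c, fun e i s0 hs0 => ?_⟩
  obtain ⟨t, ht, hl⟩ := D.K_ex (zeroStr (gam i))
  rw [← hl, add_assoc (D.ul t)] 
  rw [← add_assoc]
  have hlen : D.len t = gam i := by rw [D.len_eq ht, length_zero]
  have hex : ∃ s, D.inw e t s ∧ restrSet (D.B s) (gam i) = restrSet D.Blim (gam i) := by
    obtain ⟨s2, h2⟩ := D.B_settle (gam i)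
    have := hs0 (s0 + s2 + t + 1) (by omega)
    exact ⟨s0 + s2 + t + 1, ⟨by omega, i, this.2, this.1, ht⟩, h2 _ (by omega)⟩
  let s := Nat.find hex
  have hs : D.inw e t s ∧ restrSet (D.B s) (gam i) = restrSet D.Blim (gam i) := Nat.find_spec hex
  apply hc e s t
  unfold r2
  rw [if_pos, hlen, hs.2]
  refine ⟨hs.1, fun hn => ?_⟩
  rw [hlen, hs.2] at hn
  have hpos : 1 ≤ s := by have := hs.1.1; omega
  exact Nat.find_min hex (m := s - 1) (show s - 1 < s by omega) ⟨hn.1, hn.2.symm⟩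
end Dat
end KPaper

namespace KPaper
theorem gam_div {i : ℕ} (h : 1 ≤ i) : gam i / 16 = gam (i-1) := by
  obtain ⟨j, rfl⟩ : ∃ j, i = j + 1 := ⟨i - 1, by omega⟩
  unfold gam
  rw [pow_succ]
  simp

namespace Dat
variable (D : Dat)

def acts (e s : ℕ) : Prop := ∃ m j, D.act s = Option.some (e, m, j)

/-! ### The machine witnessing triviality if a marker moves forever -/
section tmach
variable (e s0 b : ℕ)

def mvS (s : ℕ) : Prop := s0 ≤ s ∧ aMv (D.act s) e
def q3 (s t : ℕ) : Prop := D.mvS e s0 s ∧ t < s ∧ D.pP b (D.h e s) t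
def r3P (s t : ℕ) : Prop := D.q3 e s0 b s t ∧
  ¬ ∃ s' < s, D.q3 e s0 b s' t ∧ restrSet (D.aS s') (D.len t / 16) = restrSet (D.aS s) (D.len t / 16)
noncomputable def r3 (s t : ℕ) : Option (ℕ × Str) :=
  if D.r3P e s0 b s t then Option.some (D.ul t, restrSet (D.aS s) (D.len t / 16)) else Option.none
theorem r3_pr : Primrec fun p : ℕ × ℕ => D.r3 e s0 b p.1 p.2 := by
  unfold r3 r3P q3 mvS; fun_prop

noncomputable def pv (s : ℕ) : ℕ := Nat.findGreatest (D.mvS e s0) (s-1)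

def first3 (s t : ℕ) : Prop := D.q3 e s0 b s t ∧ ∀ s' < s, ¬ D.q3 e s0 b s' t
def sec3 (s t : ℕ) : Prop := D.r3P e s0 b s t ∧ ∃ s' < s, D.q3 e s0 b s' t

theorem sec3_bound (hb : 1 ≤ b)
    (hM : ∀ s, D.mvS e s0 s → ∀ g, b ≤ g → g < D.h e s → ¬ D.good e g s) (s S : ℕ) : ∃ G : Finset ℕ,
    D.W ((Finset.range S).filter (D.sec3 e s0 b s)) ≤ 2 ^ (2*e+2) * D.W G ∧
    ∀ t ∈ G, D.mvS e s0 s ∧ pv D e s0 s < s ∧ D.alv t (pv D e s0 s) ∧ ¬ D.alv t s := by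
  by_cases hex : ∃ t, D.sec3 e s0 b s t
  swap
  · refine ⟨∅, ?_, by simp⟩
    have : (Finset.range S).filter (D.sec3 e s0 b s) = ∅ := by
      apply Finset.filter_eq_empty_iff.2
      intro t _ ht; exact hex ⟨t, ht⟩
    rw [this]; simp [W]
  obtain ⟨t0, ht0⟩ := hex
  obtain ⟨⟨hq0, hn0⟩, s', hs', hq'⟩ := ht0
  set p := D.pv e s0 s with hp
  have hpm : D.mvS e s0 p := Nat.findGreatest_spec (P := D.mvS e s0) (m := s') (by omega) hq'.1
  have hps : p < s := by
    have : p ≤ s - 1 := Nat.findGreatest_le (P := D.mvS e s0) (s-1)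
    omega
  have hpge : ∀ s1 < s, D.mvS e s0 s1 → s1 ≤ p := fun s1 h1 h2 =>
    Nat.le_findGreatest (P := D.mvS e s0) (by omega) h2
  -- description of the second requests
  have desc : ∀ t, D.sec3 e s0 b s t → ∃ i, b ≤ i ∧ i < D.h e p ∧ t < p ∧
      D.us t = Option.some (zeroStr (gam i)) ∧
      restrSet (D.aS p) (gam (i-1)) ≠ restrSet (D.aS s) (gam (i-1)) := by
    rintro t ⟨⟨h1, h2⟩, s1, h3, h4⟩
    obtain ⟨h5, h6, i, h7, h8, h9⟩ := h4
    have := hpge s1 h3 h5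
    have hh := D.h_mono e this
    have hlen : D.len t / 16 = gam (i-1) := by
      rw [D.len_eq h9, length_zero, gam_div (by omega)]
    refine ⟨i, h8, by omega, by omega, h9, fun heq => h2 ⟨p, hps, ⟨hpm, by omega, i, by omega, h8, h9⟩, ?_⟩⟩
    rw [hlen]; exact heq
  have hexi : ∃ i, b ≤ i ∧ i < D.h e p ∧ restrSet (D.aS p) (gam (i-1)) ≠ restrSet (D.aS s) (gam (i-1)) := by
    obtain ⟨i, h1, h2, h3, h4, h5⟩ := desc t0 ⟨⟨hq0, hn0⟩, s', hs', hq'⟩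
    exact ⟨i, h1, h2, h5⟩
  obtain ⟨hi1, hi2, hi3⟩ := Nat.find_spec hexi
  have himin := fun m (hm : m < Nat.find hexi) => Nat.find_min hexi hm
  set i0 := Nat.find hexi
  refine ⟨D.QF p i0, ?_, ?_⟩
  · have h1 := hM p hpm i0 hi1 hi2
    unfold good at h1
    push Not at h1
    rw [mul_comm]
    refine le_trans ?_ h1.le
    apply D.W_mono
    intro t ht
    obtain ⟨i, h2, h3, h4, h5, h6⟩ := desc t (Finset.mem_filter.1 ht).2
    refine D.mem_PF.2 ⟨h4, i, h3, ?_, h5⟩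
    by_contra hlt
    exact himin i (by omega) ⟨h2, h3, h6⟩
  · intro t ht
    have h1 := (Finset.mem_filter.1 ht).2
    obtain ⟨σ, h2, h3, h4, h5⟩ := D.qP_iff.1 h1
    refine ⟨hq0.1, hps, h1.1, fun hal => hi3 ?_⟩
    obtain ⟨σ', h2', _, h4'⟩ := D.alv_iff.1 hal
    rw [h2] at h2'
    obtain rfl := Option.some.inj h2'
    rw [h4] at h4'
    rw [length_restr] at h4'
    have h6 := restr_eq_iff.1 h4'
    exact restr_eq_iff.2 fun i hi => h6 i (by omega)

theorem sec3_sum (hb : 1 ≤ b)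
    (hM : ∀ s, D.mvS e s0 s → ∀ g, b ≤ g → g < D.h e s → ¬ D.good e g s) (S : ℕ) : ∑ s ∈ Finset.range S, ∑ t ∈ Finset.range S,
    (if D.sec3 e s0 b s t then D.w t else 0) ≤ 2 ^ (2*e+2) := by
  choose G hG1 hG2 using fun s => D.sec3_bound e s0 b hb hM s S
  have hdisj : ∑ s ∈ Finset.range S, D.W (G s) ≤ 1 := by
    apply D.W_disj_le
    have key : ∀ a c, a < c → Disjoint (G a) (G c) := by
      intro a c hac
      rw [Finset.disjoint_left]
      intro t h1 h2
      obtain ⟨a1, a2, a3, a4⟩ := hG2 a t h1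
      obtain ⟨c1, c2, c3, c4⟩ := hG2 c t h2
      have : a ≤ D.pv e s0 c := Nat.le_findGreatest (P := D.mvS e s0) (by omega) a1
      exact a4 (D.alv_mid a3 c3 a2.le this)
    intro a _ c _ hne
    rcases lt_or_gt_of_ne hne with h | h
    · exact key a c h
    · exact (key c a h).symm
  have : ∀ s ∈ Finset.range S, ∑ t ∈ Finset.range S, (if D.sec3 e s0 b s t then D.w t else 0) ≤ 2 ^ (2*e+2) * D.W (G s) := by
    intro s _
    rw [← Finset.sum_filter]
    exact hG1 s
  refine (Finset.sum_le_sum this).trans ?_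
  rw [← Finset.mul_sum]
  exact mul_le_of_le_one_right (by positivity) hdisj

theorem r3_sum (hb : 1 ≤ b)
    (hM : ∀ s, D.mvS e s0 s → ∀ g, b ≤ g → g < D.h e s → ¬ D.good e g s) (S : ℕ) : ∑ s ∈ Finset.range S, ∑ t ∈ Finset.range S,
    rw' (D.r3 e s0 b s t) ≤ ((1 + 2 ^ (2*e+2) : ℕ) : ℝ) := by
  have h1 : ∀ s t, rw' (D.r3 e s0 b s t) ≤ (if D.first3 e s0 b s t then D.w t else 0) +
      (if D.sec3 e s0 b s t then D.w t else 0) := by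
    intro s t
    have hw := D.w_nonneg t
    have hz : ∀ (p : Prop) [Decidable p], 0 ≤ (if p then D.w t else 0) := fun p _ => by
      split_ifs <;> simp [hw]
    have z1 := hz (D.first3 e s0 b s t); have z2 := hz (D.sec3 e s0 b s t)
    unfold r3
    by_cases h : D.r3P e s0 b s t
    swap
    · rw [if_neg h]
      have : rw' Option.none = 0 := rfl
      rw [this]; positivity
    rw [if_pos h]
    have hr : rw' (Option.some (D.ul t, restrSet (D.aS s) (D.len t / 16))) = D.w t := by
      obtain ⟨⟨_, _, i, _, _, hu⟩, _⟩ := h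
      rw [D.w_some hu]; rfl
    rw [hr]
    by_cases h' : ∃ s' < s, D.q3 e s0 b s' t
    · rw [if_pos (show D.sec3 e s0 b s t from ⟨h, h'⟩)]; linarith
    · push Not at h'
      rw [if_pos (show D.first3 e s0 b s t from ⟨h.1, h'⟩)]; linarith
  refine le_trans (Finset.sum_le_sum fun s _ => Finset.sum_le_sum fun t _ => h1 s t) ?_
  simp only [Finset.sum_add_distrib]
  have h2 := D.sec3_sum e s0 b hb hM S
  have h3 : ∑ s ∈ Finset.range S, ∑ t ∈ Finset.range S, (if D.first3 e s0 b s t then D.w t else 0) ≤ 1 := by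
    rw [Finset.sum_comm]
    refine le_trans (Finset.sum_le_sum fun t _ => ?_) (D.W_le_one (Finset.range S))
    rw [← Finset.sum_filter, Finset.sum_const, nsmul_eq_mul]
    have : ((Finset.range S).filter fun s => D.first3 e s0 b s t).card ≤ 1 := by
      apply Finset.card_le_one.2
      intro x hx y hy
      rw [Finset.mem_filter] at hx hy
      by_contra hne
      rcases lt_or_gt_of_ne hne with h | h
      · exact hy.2.2 x h hx.2.1
      · exact hx.2.2 y h hy.2.1
    have : (((Finset.range S).filter fun s => D.first3 e s0 b s t).card : ℝ) ≤ 1 := by exact_mod_cast this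
    nlinarith [D.w_nonneg t]
  push_cast
  linarith

theorem M3 (hb : 1 ≤ b)
    (hM : ∀ s, D.mvS e s0 s → ∀ g, b ≤ g → g < D.h e s → ¬ D.good e g s) (hinf : ∀ N, ∃ s ≥ N, D.mvS e s0 s) : ∃ c : ℕ, ∀ i ≥ b,
    D.K (restrSet D.Alim (gam (i-1))) ≤ D.K (zeroStr (gam i)) + c := by
  obtain ⟨c, hc⟩ := D.kc2 (D.r3 e s0 b) (D.r3_pr e s0 b) _ (D.r3_sum e s0 b hb hM)
  refine ⟨c, fun i hi => ?_⟩
  obtain ⟨t, ht, hl⟩ := D.K_ex (zeroStr (gam i))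
  rw [← hl]
  have hlen : D.len t / 16 = gam (i-1) := by rw [D.len_eq ht, length_zero, gam_div (by omega)]
  have hex : ∃ s, D.q3 e s0 b s t ∧ restrSet (D.aS s) (gam (i-1)) = restrSet D.Alim (gam (i-1)) := by
    obtain ⟨s1, h1⟩ := D.A_settle (gam (i-1))
    obtain ⟨s2, h2, h3⟩ := hinf (i + 1)
    obtain ⟨s3, h4, h5⟩ := hinf (s1 + s2 + t + 1)
    have h6 := D.h_mono e (show s2 + 1 ≤ s3 by omega)
    rw [D.h_move (Or.inr h3.2)] at h6
    exact ⟨s3, ⟨h5, by omega, i, by omega, hi, ht⟩, h1 _ (by omega)⟩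
  obtain ⟨hs1, hs2⟩ := Nat.find_spec hex
  have hmin := fun m (hm : m < Nat.find hex) => Nat.find_min hex hm
  set s := Nat.find hex
  apply hc s t
  unfold r3
  rw [if_pos, hlen, hs2]
  refine ⟨hs1, ?_⟩
  rintro ⟨s', h1, h2, h3⟩
  rw [hlen, hs2] at h3
  exact hmin s' h1 ⟨h2, h3⟩
end tmach

def KTriv (X : Set ℕ) : Prop := ∃ c : ℕ, ∀ n, D.K (restrSet X n) ≤ D.K (zeroStr n) + c

theorem triv_of (X : Set ℕ) (b : ℕ) (hb : 1 ≤ b) (h : ∃ c : ℕ, ∀ i ≥ b,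
    D.K (restrSet X (gam (i-1))) ≤ D.K (zeroStr (gam i)) + c) : D.KTriv X := by
  obtain ⟨c, hc⟩ := h
  obtain ⟨c1, hc1⟩ := D.kmap (fun σ => (List.range (1 + mu (σ.length + 1) fun i => gam i = σ.length)).map fun i => σ.getD i false) (by fun_prop)
  obtain ⟨c2, hc2⟩ := D.kmap (fun σ => zeroStr (gam σ.length)) (by fun_prop)
  refine ⟨c + c1 + c2 + ∑ n ∈ Finset.range b, D.K (restrSet X n), fun n => ?_⟩
  by_cases hn : n < b
  · have := Finset.single_le_sum (f := fun n => D.K (restrSet X n)) (by intros; positivity) (Finset.mem_range.2 hn)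
    omega
  · have h1 := hc n (by omega)
    have h2 := hc1 (restrSet X (gam (n-1)))
    have h3 := hc2 (zeroStr n)
    simp only [length_zero] at h3
    have h4 : (List.range (1 + mu ((restrSet X (gam (n-1))).length + 1) fun i => gam i = (restrSet X (gam (n-1))).length)).map (fun i => (restrSet X (gam (n-1))).getD i false) = restrSet X n := by
      have : mu ((restrSet X (gam (n-1))).length + 1) (fun i => gam i = (restrSet X (gam (n-1))).length) = n - 1 := by
        rw [length_restr]
        have hlt := lt_gam (n-1)
        rcases mu_spec (gam (n-1) + 1) (fun i => gam i = gam (n-1)) with h | h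
        · exact gam_strictMono.injective h.2.1
        · exact absurd rfl (h.2 (n-1) (by omega))
      rw [this, show 1 + (n-1) = n by omega]
      unfold restrSet
      apply List.map_congr_left
      intro i hi
      have := List.mem_range.1 hi
      have := lt_gam (n-1)
      rw [List.getD_eq_getElem _ _ (by simp; omega)]
      simp
    rw [h4] at h2
    omega

theorem converge (hA : ¬ D.KTriv D.Alim) (e : ℕ) : ∃ s0, ∀ s ≥ s0, ∀ e' ≤ e, ¬ D.acts e' s := by
  induction e using Nat.strong_induction_on with
  | _ e ih =>
  have hlow : ∃ s0, ∀ s ≥ s0, ∀ e' < e, ¬ D.acts e' s := by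
    rcases Nat.eq_zero_or_pos e with h | h
    · exact ⟨0, fun s _ e' he' => by omega⟩
    · obtain ⟨s0, h0⟩ := ih (e-1) (by omega)
      exact ⟨s0, fun s hs e' he' => h0 s hs e' (by omega)⟩
  obtain ⟨s1, h1⟩ := hlow
  have hH : ∃ s2, ∀ s ≥ s2, ¬ (e ∈ D.hS (s + 1) ∧ e ∉ D.hS s) := by
    by_cases h : ∃ s, e ∈ D.hS s
    · obtain ⟨s, hs⟩ := h
      exact ⟨s, fun s' hs' hh => hh.2 (D.hS_mono hs' hs)⟩
    · exact ⟨0, fun s _ hh => h ⟨_, hh.1⟩⟩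
  obtain ⟨s2, h2⟩ := hH
  have hcut : ∀ s ≥ s1 + s2, ¬ aLt (D.act s) e := by
    intro s hs hlt
    obtain ⟨e', m, j, h3, h4⟩ := D.aLt_iff.1 hlt
    exact h1 s (by omega) e' h4 ⟨m, j, h3⟩
  have hb : ∀ s ≥ s1 + s2, D.b e s = D.b e (s1+s2) := by
    intro s hs
    induction s, hs using Nat.le_induction with
    | base => rfl
    | succ n hn ihn => rw [D.b_keep (hcut n hn), ihn]
  have hfin : ∃ N, ∀ s ≥ N, ¬ D.mvS e (s1+s2) s := by
    by_contra hinf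
    push Not at hinf
    apply hA
    have hb1 : 1 ≤ D.b e (s1+s2) := by have := D.lt_b e (s1+s2); omega
    refine D.triv_of _ _ hb1 (D.M3 e (s1+s2) (D.b e (s1+s2)) hb1 ?_ hinf)
    intro s hs g hg1 hg2
    obtain ⟨j, hj⟩ := D.aMv_iff.1 hs.2
    have h3 := (D.act_some hj).2.2
    simp at h3
    rcases h3.2 with h4 | h4
    · exact h4 g (by rw [hb s hs.1]; exact hg1) hg2
    · exact absurd h4 (h2 s (by have := hs.1; omega))
  obtain ⟨N, hN⟩ := hfin
  set M := N + (s1 + s2) with hM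
  have hnm : ∀ s ≥ M, ¬ aMv (D.act s) e := fun s hs h => hN s (by omega) ⟨by omega, h⟩
  have hh : ∀ s ≥ M, D.h e s = D.h e M := by
    intro s hs
    induction s, hs using Nat.le_induction with
    | base => rfl
    | succ n hn ihn => rw [D.h_keep (hcut n (by omega)) (hnm n hn), ihn]
  have hT : {s | M ≤ s ∧ D.acts e s}.Finite := by
    by_contra hinf
    have hx : ∀ s, D.acts e s → ∃ x, D.v s = Option.some x ∧ x < gam (D.h e s) ∧ x ∉ D.B s := by
      rintro s ⟨m, j, h⟩
      obtain ⟨x, h3, h4, h5, h6⟩ := D.sup_all s _ _ _ h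
      have := gam_mono (D.idx_ge h).2
      exact ⟨x, h3, by omega, h6⟩
    obtain ⟨a, ha, c, hc, hne, heq⟩ := Set.Infinite.exists_ne_map_eq_of_mapsTo (f := fun s => (D.v s).getD 0)
      (t := Set.Iio (gam (D.h e M))) hinf (by
        rintro s ⟨hs1, hs2⟩
        obtain ⟨x, h3, h4, _⟩ := hx s hs2
        rw [hh s hs1] at h4
        simpa [h3] using h4) (Set.finite_Iio _)
    obtain ⟨x, hx1, hx2, hx3⟩ := hx a ha.2
    obtain ⟨y, hy1, hy2, hy3⟩ := hx c hc.2
    simp [hx1, hy1] at heq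
    subst heq
    rcases lt_or_gt_of_ne hne with h | h
    · exact hy3 (D.mem_B.2 ⟨a, h, hx1⟩)
    · exact hx3 (D.mem_B.2 ⟨c, h, hy1⟩)
  obtain ⟨L, hL⟩ := hT.bddAbove
  refine ⟨L + 1 + M, fun s hs e' he' hact => ?_⟩
  rcases Nat.eq_or_lt_of_le he' with h | h
  · subst h
    have := hL (show s ∈ {s | M ≤ s ∧ D.acts e' s} from ⟨by omega, hact⟩)
    omega
  · exact h1 s (by omega) e' h hact

end Dat
end KPaper

namespace KPaper
namespace Dat
variable (D : Dat)

theorem W_ge (F I : Finset ℕ) (τ : ℕ → Str) (hinj : ∀ i ∈ I, ∀ j ∈ I, τ i = τ j → i = j) (t : ℕ → ℕ)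
    (ht : ∀ i ∈ I, t i ∈ F ∧ D.us (t i) = Option.some (τ i) ∧ D.ul (t i) = D.K (τ i)) :
    ∑ i ∈ I, (1/2:ℝ) ^ D.K (τ i) ≤ D.W F := by
  have h1 : ∑ i ∈ I, (1/2:ℝ) ^ D.K (τ i) = ∑ i ∈ I, D.w (t i) := by
    apply Finset.sum_congr rfl
    intro i hi
    obtain ⟨_, h2, h3⟩ := ht i hi
    rw [D.w_some h2, h3]
  rw [h1, ← Finset.sum_image (f := D.w) (s := I) (g := t)]
  · apply D.W_mono
    intro x hx
    obtain ⟨i, hi, rfl⟩ := Finset.mem_image.1 hx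
    exact (ht i hi).1
  · intro i hi j hj hij
    have h2 := (ht i hi).2.1
    have h3 := (ht j hj).2.1
    rw [hij, h3] at h2
    exact (hinj j hj i hi (Option.some.inj h2)).symm

theorem W_us_le (F I : Finset ℕ) (τ : ℕ → Str) (hF : ∀ t ∈ F, ∃ i ∈ I, D.us t = Option.some (τ i)) :
    D.W F ≤ ∑ i ∈ I, 2 * (1/2:ℝ) ^ D.K (τ i) := by
  have hsub : F ⊆ I.biUnion fun i => F.filter fun t => D.us t = Option.some (τ i) := by
    intro t ht
    obtain ⟨i, hi, h⟩ := hF t ht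
    rw [Finset.mem_biUnion]
    exact ⟨i, hi, Finset.mem_filter.2 ⟨ht, h⟩⟩
  refine (D.W_mono hsub).trans ?_
  have h1 : D.W (I.biUnion fun i => F.filter fun t => D.us t = Option.some (τ i)) ≤
      ∑ i ∈ I, D.W (F.filter fun t => D.us t = Option.some (τ i)) := by
    induction I using Finset.induction_on with
    | empty => simp [W]
    | insert a I ha ih =>
      have : ∀ J : Finset ℕ, D.W (J.biUnion fun i => F.filter fun t => D.us t = Option.some (τ i)) ≤
      ∑ i ∈ J, D.W (F.filter fun t => D.us t = Option.some (τ i)) := by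
        intro J
        induction J using Finset.induction_on with
        | empty => simp [W]
        | insert a J ha ih =>
          rw [Finset.biUnion_insert, Finset.sum_insert ha]
          exact (D.W_union_le _ _).trans (by linarith)
      exact this _
  refine h1.trans (Finset.sum_le_sum fun i _ => ?_)
  have h2 := D.K_sum (τ i) (F.filter fun t => D.us t = Option.some (τ i)) (fun t ht => (Finset.mem_filter.1 ht).2)
  refine le_trans (le_of_eq ?_) h2
  apply Finset.sum_congr rfl
  intro t ht
  exact D.w_some (Finset.mem_filter.1 ht).2

theorem stable {e s0 : ℕ} (h : ∀ s ≥ s0, ∀ e' ≤ e, ¬ D.acts e' s) :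
    ∀ s ≥ s0, D.b e s = D.b e s0 ∧ D.h e s = D.h e s0 := by
  have h1 : ∀ s ≥ s0, ¬ aLt (D.act s) e := by
    intro s hs hlt
    obtain ⟨e', m, j, h3, h4⟩ := D.aLt_iff.1 hlt
    exact h s hs e' h4.le ⟨m, j, h3⟩
  have h2 : ∀ s ≥ s0, ¬ aMv (D.act s) e := by
    intro s hs hlt
    obtain ⟨j, h3⟩ := D.aMv_iff.1 hlt
    exact h s hs e le_rfl ⟨true, j, h3⟩
  intro s hs
  induction s, hs using Nat.le_induction with
  | base => exact ⟨rfl, rfl⟩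
  | succ n hn ih => rw [D.b_keep (h1 n hn), D.h_keep (h1 n hn) (h2 n hn)]; exact ih

theorem quiet {e s0 : ℕ} (h : ∀ s ≥ s0, ∀ e' ≤ e, ¬ D.acts e' s) {s : ℕ} (hs : s0 ≤ s) (hes : e < s) :
    (∃ g, D.b e s ≤ g ∧ g < D.h e s ∧ D.good e g s) ∧ (∀ g < D.h e s, ¬ D.condT e s g) := by
  have h1 : ¬ (D.condM e s ∨ ∃ g < D.h e s, D.condT e s g) := by
    intro hc
    obtain ⟨e', m, j, h2, h3⟩ := D.act_of_cond hes hc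
    exact h s hs e' h2 ⟨m, j, h3⟩
  push Not at h1
  refine ⟨?_, h1.2⟩
  have h2 := h1.1
  unfold condM at h2
  push Not at h2
  exact h2.1

/-- a large stage at which all relevant computations have converged -/
theorem late (X : ℕ → Set ℕ) (hX : Monotone X) (n s0 : ℕ) : ∃ s ≥ s0, ∀ i < n,
    ∃ t < s, D.us t = Option.some (restrSet {i | ∃ s, i ∈ X s} (gam i)) ∧
      D.ul t = D.K (restrSet {i | ∃ s, i ∈ X s} (gam i)) ∧
      ∀ s' ≥ s, restrSet (X s') (gam i) = restrSet {i | ∃ s, i ∈ X s} (gam i) := by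
  choose f hf using settle X hX
  choose t ht using D.K_ex
  let F : ℕ → ℕ := fun i => f (gam i) + t (restrSet {i | ∃ s, i ∈ X s} (gam i)) + 1
  refine ⟨s0 + (Finset.range n).sup F, by omega, fun i hi => ?_⟩
  have h1 : F i ≤ (Finset.range n).sup F := Finset.le_sup (f := F) (Finset.mem_range.2 hi)
  refine ⟨t (restrSet {i | ∃ s, i ∈ X s} (gam i)), ?_, (ht _).1, (ht _).2, ?_⟩
  · simp only [F] at h1 ⊢; omega
  · intro s' hs'
    apply hf
    simp only [F] at h1; simp only [F] at hs'; omega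

theorem restr_empty (n : ℕ) : restrSet {i : ℕ | ∃ _s : ℕ, i ∈ (∅ : Set ℕ)} n = zeroStr n := by
  simp [restrSet, zeroStr]

theorem gamstr_inj (X : Set ℕ) {i j : ℕ} (h : restrSet X (gam i) = restrSet X (gam j)) : i = j := by
  have := congrArg List.length h
  rw [length_restr, length_restr] at this
  exact gam_strictMono.injective this

theorem PF_le (s g h : ℕ) : D.W (D.PF s g h) ≤ ∑ i ∈ Finset.Ico g h, 2 * (1/2:ℝ) ^ D.K (zeroStr (gam i)) := by
  apply D.W_us_le
  intro t ht
  obtain ⟨_, i, h1, h2, h3⟩ := D.mem_PF.1 ht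
  exact ⟨i, Finset.mem_Ico.2 ⟨h2, h1⟩, h3⟩

theorem half_le {a b : ℕ} (h : (1/2:ℝ)^a ≤ (1/2)^b) : b ≤ a := by
  by_contra hlt
  have : (1/2:ℝ)^b < (1/2)^a := pow_lt_pow_right_of_lt_one₀ (by norm_num) (by norm_num) (by omega)
  linarith

theorem strict (hA : ¬ D.KTriv D.Alim) :
    ¬ ∃ c : ℕ, ∀ n, D.K (restrSet D.Alim n) ≤ D.K (restrSet D.Blim n) + c := by
  rintro ⟨d, hd⟩
  obtain ⟨c, hc⟩ := D.M2a
  set e := c + d + 1 with he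
  obtain ⟨s0, hs0⟩ := D.converge hA e
  have hst := D.stable hs0
  obtain ⟨s, hs, hl⟩ := D.late D.aS D.aS_mono (D.h e s0) (s0 + e + 1)
  obtain ⟨⟨g, hg1, hg2, hg3⟩, _⟩ := D.quiet hs0 (show s0 ≤ s by omega) (show e < s by omega)
  rw [(hst s (by omega)).1] at hg1
  unfold good at hg3
  rw [(hst s (by omega)).2] at hg2 hg3
  have hg0 : 1 ≤ g := by have := D.lt_b e s0; omega
  choose! t ht using hl
  have h1 : ∑ i ∈ Finset.Ico g (D.h e s0), (1/2:ℝ) ^ D.K (restrSet D.Alim (gam i)) ≤ D.W (D.QF s g) := by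
    apply D.W_ge (D.QF s g) (Finset.Ico g (D.h e s0)) (fun i => restrSet D.Alim (gam i)) (fun i _ j _ h => gamstr_inj _ h) t
    intro i hi
    rw [Finset.mem_Ico] at hi
    obtain ⟨h1, h2, h3, h4⟩ := ht i hi.2
    refine ⟨?_, h2, h3⟩
    unfold QF
    rw [Finset.mem_filter, Finset.mem_range]
    refine ⟨h1, D.qP_iff.2 ⟨_, h2, h1, ?_, ?_⟩⟩
    · rw [length_restr]; exact (h4 s le_rfl).symm
    · rw [length_restr]; exact gam_strictMono (by omega)
  have h2 := D.PF_le s g (D.h e s0)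
  have h3 : ∑ i ∈ Finset.Ico g (D.h e s0), (1/2:ℝ) ^ D.K (restrSet D.Alim (gam i)) * 2 ^ (2*e+2) ≤
      ∑ i ∈ Finset.Ico g (D.h e s0), 2 * (1/2:ℝ) ^ D.K (zeroStr (gam i)) := by
    rw [← Finset.sum_mul]
    have := mul_le_mul_of_nonneg_right h1 (show (0:ℝ) ≤ 2 ^ (2*e+2) by positivity)
    linarith
  obtain ⟨i, hi, h4⟩ := Finset.exists_le_of_sum_le (Finset.nonempty_Ico.2 hg2) h3
  rw [Finset.mem_Ico] at hi
  have h5 := hc e i s0 (fun s hs => by rw [(hst s hs).1, (hst s hs).2]; omega)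
  have h6 := hd (gam i)
  have h7 : D.K (zeroStr (gam i)) + (2*e+1) ≤ D.K (restrSet D.Alim (gam i)) := by
    apply half_le
    have hp : (1/2:ℝ)^(2*e+1) * 2^(2*e+2) = 2 := by
      rw [pow_succ (2:ℝ) (2*e+1), ← mul_assoc, ← mul_pow]; norm_num
    have hq : (0:ℝ) < 2^(2*e+2) := by positivity
    refine le_of_mul_le_mul_right ?_ hq
    refine h4.trans (le_of_eq ?_)
    rw [pow_add, mul_assoc, hp]; ring
  omega

theorem nontriv (hA : ¬ D.KTriv D.Alim) : ¬ D.KTriv D.Blim := by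
  rintro ⟨c, hc⟩
  obtain ⟨c0, hc0⟩ := D.K_zero_gam
  set e := c + c0 + 1 with he
  obtain ⟨s0, hs0⟩ := D.converge hA e
  have hst := D.stable hs0
  obtain ⟨s1, hs1, hl1⟩ := D.late D.B D.B_mono (D.h e s0) (s0 + e + 1)
  obtain ⟨s, hs, hl2⟩ := D.late (fun _ => ∅) (fun _ _ _ => le_rfl) (D.h e s0) s1
  obtain ⟨⟨g, hg1, hg2, hg3⟩, hT⟩ := D.quiet hs0 (show s0 ≤ s by omega) (show e < s by omega)
  choose! t ht using hl1
  choose! z hz using hl2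
  have hh := (hst s (by omega)).2
  apply hT g hg2
  rw [hh] at hg2
  refine ⟨hg1, hg3, ?_, ?_⟩
  · have h1 : ∑ i ∈ {g}, (1/2:ℝ) ^ D.K (zeroStr (gam i)) ≤ D.W (D.PF s g (g+1)) := by
      apply D.W_ge _ _ (fun i => zeroStr (gam i)) (by simp) z
      intro i hi
      rw [Finset.mem_singleton] at hi
      subst hi
      obtain ⟨h1, h2, h3, _⟩ := hz i hg2
      rw [restr_empty] at h2 h3
      exact ⟨D.mem_PF.2 ⟨h1, i, by omega, le_rfl, h2⟩, h2, h3⟩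
    rw [Finset.sum_singleton] at h1
    have h2 : (1/2:ℝ)^(e+g) ≤ (1/2)^D.K (zeroStr (gam g)) := by
      apply pow_le_pow_of_le_one (by norm_num) (by norm_num)
      have := hc0 g; omega
    have h3 : (1/2:ℝ)^(e+g) * 2^(e+g) = 1 := by rw [← mul_pow]; norm_num
    rw [← h3]
    exact mul_le_mul_of_nonneg_right (h2.trans h1) (by positivity)
  · rw [hh]
    refine (D.PF_le s g (D.h e s0)).trans ?_
    have h1 : ∑ i ∈ Finset.Ico g (D.h e s0), (1/2:ℝ) ^ D.K (restrSet D.Blim (gam i)) ≤ D.W (D.RF s g (D.h e s0)) := by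
      apply D.W_ge _ _ (fun i => restrSet D.Blim (gam i)) (fun i _ j _ h => gamstr_inj _ h) t
      intro i hi
      rw [Finset.mem_Ico] at hi
      obtain ⟨h1, h2, h3, h4⟩ := ht i hi.2
      exact ⟨D.mem_RF.2 ⟨by omega, i, hi.2, hi.1, by rw [h4 s hs]; exact h2⟩, h2, h3⟩
    refine le_trans ?_ (mul_le_mul_of_nonneg_left h1 (by positivity))
    rw [Finset.mul_sum]
    apply Finset.sum_le_sum
    intro i _
    have h2 : (1/2:ℝ)^(D.K (zeroStr (gam i)) + c) ≤ (1/2)^D.K (restrSet D.Blim (gam i)) :=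
      pow_le_pow_of_le_one (by norm_num) (by norm_num) (hc (gam i))
    have h3 : (2:ℝ)^(c+1) ≤ 2^e := pow_le_pow_right₀ (by norm_num) (by omega)
    have h4 : (2:ℝ)^(c+1) * (1/2)^(D.K (zeroStr (gam i)) + c) = 2 * (1/2)^(D.K (zeroStr (gam i))) := by
      have : (2:ℝ)^c * (1/2)^c = 1 := by rw [← mul_pow]; norm_num
      rw [pow_succ, pow_add]
      calc (2:ℝ)^c * 2 * ((1/2)^(D.K (zeroStr (gam i))) * (1/2)^c) = (2^c * (1/2)^c) * (2 * (1/2)^(D.K (zeroStr (gam i)))) := by ring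
        _ = _ := by rw [this, one_mul]
    rw [← h4]
    exact mul_le_mul h3 h2 (by positivity) (by positivity)
end Dat
end KPaper

namespace KPaper
/-! ### Relative computability -/

theorem RecursiveIn.of_partrec {O f : ℕ →. ℕ} (hf : Nat.Partrec f) : RecursiveIn O f := by
  induction hf with
  | zero => exact .zero
  | succ => exact .succ
  | left => exact .left
  | right => exact .right
  | pair _ _ h1 h2 => exact .pair h1 h2
  | comp _ _ h1 h2 => exact .comp h1 h2
  | prec _ _ h1 h2 => exact .prec h1 h2
  | rfind _ h1 => exact .rfind h1

theorem RecursiveIn.of_eq {O f g : ℕ →. ℕ} (hf : RecursiveIn O f) (h : ∀ n, f n = g n) :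
    RecursiveIn O g := (funext h : f = g) ▸ hf

def TotIn (O : ℕ →. ℕ) (f : ℕ → ℕ) : Prop := RecursiveIn O fun n => Part.some (f n)

theorem TotIn.of_primrec {O : ℕ →. ℕ} {f : ℕ → ℕ} (hf : Primrec f) : TotIn O f :=
  RecursiveIn.of_partrec (Nat.Partrec.of_primrec (Primrec.nat_iff.1 hf))

theorem TotIn.comp {O : ℕ →. ℕ} {f g : ℕ → ℕ} (hf : TotIn O f) (hg : TotIn O g) :
    TotIn O fun n => f (g n) := by
  refine (RecursiveIn.comp hf hg).of_eq fun n => ?_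
  simp

theorem TotIn.pair {O : ℕ →. ℕ} {f g : ℕ → ℕ} (hf : TotIn O f) (hg : TotIn O g) :
    TotIn O fun n => Nat.pair (f n) (g n) := by
  refine (RecursiveIn.pair hf hg).of_eq fun n => ?_
  simp [Seq.seq]

theorem TotIn.count {O : ℕ →. ℕ} {f : ℕ → ℕ} (hf : TotIn O f) :
    TotIn O fun n => ∑ i ∈ Finset.range n, f i := by
  have hg : TotIn O fun p => p.unpair.2.unpair.2 + f p.unpair.2.unpair.1 := by
    have h1 : TotIn O fun p => Nat.pair p.unpair.2.unpair.2 (f p.unpair.2.unpair.1) :=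
      TotIn.pair (TotIn.of_primrec (by fun_prop)) (TotIn.comp hf (TotIn.of_primrec (by fun_prop)))
    have h2 : TotIn O fun p => p.unpair.1 + p.unpair.2 := TotIn.of_primrec (by fun_prop)
    have := TotIn.comp h2 h1
    simpa using this
  have h0 : TotIn O fun _ => 0 := TotIn.of_primrec (by fun_prop)
  have h1 := RecursiveIn.prec h0 hg
  have h2 : TotIn O fun n => Nat.pair 0 n := TotIn.of_primrec (by fun_prop)
  refine (RecursiveIn.comp h1 h2).of_eq fun n => ?_
  simp only [Nat.unpaired, Part.bind_eq_bind, Part.bind_some, Nat.unpair_pair]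
  induction n with
  | zero => rfl
  | succ n ih => simp only [ih, Part.bind_some, Finset.sum_range_succ]

theorem TotIn.rfind {O : ℕ →. ℕ} {f g : ℕ → ℕ} (hf : TotIn O f)
    (h0 : ∀ a, f (Nat.pair a (g a)) = 0) (h1 : ∀ a, ∀ n < g a, f (Nat.pair a n) ≠ 0) :
    TotIn O g := by
  refine (RecursiveIn.rfind hf).of_eq fun a => ?_
  refine Part.eq_some_iff.2 (Nat.mem_rfind.2 ⟨?_, ?_⟩)
  · simp [h0]
  · intro m hm
    simpa using h1 a m hm

theorem ce_le_halting {X : Set ℕ} (hX : CESet X) : TuringLeSet X haltingSet := by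
  obtain ⟨f, hf, hX⟩ := hX
  obtain ⟨c, rfl⟩ := Nat.Partrec.Code.exists_code.1 hf
  let c' := Nat.Partrec.Code.comp c Nat.Partrec.Code.left
  have hg : Primrec fun n => Encodable.encode (Nat.Partrec.Code.curry c' n) :=
    Primrec.encode.comp (Nat.Partrec.Code.primrec₂_curry.comp (Primrec.const c') Primrec.id)
  have h1 : TotIn (chi haltingSet) fun n => if n ∈ haltingSet then 1 else 0 := RecursiveIn.oracle
  have h2 := TotIn.comp h1 (TotIn.of_primrec hg)
  refine RecursiveIn.of_eq h2 fun n => congrArg Part.some (if_congr ?_ rfl rfl)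
  rw [hX, haltingSet, Set.mem_ofPred_eq, Denumerable.ofNat_encode, Nat.Partrec.Code.eval_curry]
  simp only [c', Nat.Partrec.Code.eval, PFun.coe_val, Nat.unpair_pair]
  exact iff_of_eq (congrArg Part.Dom (Part.bind_some n c.eval))

namespace Dat
variable (D : Dat)

theorem B_ce : CESet D.Blim := by
  have h1 : Primrec fun p : ℕ => if D.v p.unpair.2 = Option.some p.unpair.1 then 0 else 1 := by
    fun_prop
  refine ⟨_, Nat.Partrec.rfind (Nat.Partrec.of_primrec (Primrec.nat_iff.1 h1)), fun n => ?_⟩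
  refine Iff.trans ?_ Nat.rfind_dom'.symm
  constructor
  · rintro ⟨s, hs⟩
    obtain ⟨k, _, hk⟩ := D.mem_B.1 hs
    exact ⟨k, by simp [hk], by simp⟩
  · rintro ⟨k, hk, -⟩
    refine ⟨k+1, D.mem_B.2 ⟨k, by omega, ?_⟩⟩
    simpa using hk

theorem no_act {e s : ℕ} (h : ∀ i < gam (D.h e s), i ∈ D.Blim → i ∈ D.B s) :
    ∀ s' ≥ s, ∀ e' ≤ e, ¬ D.acts e' s' := by
  intro s'
  induction s' using Nat.strong_induction_on with
  | _ s' ih =>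
  rintro hs e' he ⟨m, j, ha⟩
  have hh : ∀ k, s ≤ k → k ≤ s' → D.h e k = D.h e s := by
    intro k hk
    induction k, hk using Nat.le_induction with
    | base => intro _; rfl
    | succ k hk ih2 =>
      intro hk'
      rw [← ih2 (by omega)]
      apply D.h_keep
      · intro hlt
        obtain ⟨e1, m, j, h3, h4⟩ := D.aLt_iff.1 hlt
        exact ih k (by omega) hk e1 h4.le ⟨m, j, h3⟩
      · intro hmv
        obtain ⟨j, h3⟩ := D.aMv_iff.1 hmv
        exact ih k (by omega) hk e le_rfl ⟨_, j, h3⟩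
  obtain ⟨x, hx, h1, h2, h3⟩ := D.sup_all s' e' m j ha
  have h4 : D.h e' s' ≤ D.h e s' := by
    rcases he.lt_or_eq with he | rfl
    · exact ((D.h_lt_b he s').trans (D.b_lt_h e s')).le
    · exact le_rfl
  have h5 := (D.idx_ge ha).2
  have h6 : x < gam (D.h e s) := by
    rw [← hh s' hs le_rfl]
    exact h2.trans_le (gam_mono (h5.trans h4))
  exact h3 (D.B_mono hs (h x h6 ⟨s'+1, D.mem_B.2 ⟨s', by omega, hx⟩⟩))

noncomputable def cB (s n : ℕ) : ℕ := ∑ i ∈ Finset.range n, if i ∈ D.B s then 1 else 0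

theorem pr_cB {α : Type} [Primcodable α] {s n : α → ℕ} (hs : Primrec s) (hn : Primrec n) :
    Primrec fun a => D.cB (s a) (n a) := by
  unfold cB
  apply pr_sum hn
  apply pr_ite
  · unfold B
    apply pr_BL <;> fun_prop
  · fun_prop
  · fun_prop

theorem cB_eq {s n : ℕ} : D.cB s n = (∑ i ∈ Finset.range n, if i ∈ D.Blim then 1 else 0) ↔
    ∀ i < n, i ∈ D.Blim → i ∈ D.B s := by
  unfold cB
  rw [Finset.sum_eq_sum_iff_of_le]
  · constructor
    · intro h i hi hB
      have := h i (Finset.mem_range.2 hi)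
      by_contra hc
      rw [if_neg hc, if_pos hB] at this
      omega
    · intro h i hi
      by_cases hc : i ∈ D.B s
      · rw [if_pos hc, if_pos ⟨s, hc⟩]
      · rw [if_neg hc, if_neg fun h' => hc (h i (Finset.mem_range.1 hi) h')]
  · intro i _
    by_cases hc : i ∈ D.B s
    · rw [if_pos hc, if_pos ⟨s, hc⟩]
    · rw [if_neg hc]; omega

theorem halting_le (hA : ¬ D.KTriv D.Alim) : TuringLeSet {e | ∃ s, e ∈ D.hS s} D.Blim := by
  have hex : ∀ e, ∃ s, e < s ∧ ∀ i < gam (D.h e s), i ∈ D.Blim → i ∈ D.B s := by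
    intro e
    obtain ⟨s0, h0⟩ := D.converge hA e
    obtain ⟨s1, h1⟩ := D.B_settle (gam (D.h e s0))
    refine ⟨s0 + s1 + e + 1, by omega, fun i hi hB => ?_⟩
    rw [(D.stable h0 _ (by omega)).2] at hi
    have := h1 (s0 + s1 + e + 1) (by omega)
    unfold restrSet at this
    have := (List.map_inj_left.1 this) i (List.mem_range.2 hi)
    simpa [hB] using this
  let g : ℕ → ℕ := fun e => Nat.find (hex e)
  let C : ℕ → ℕ := fun n => ∑ i ∈ Finset.range n, if i ∈ D.Blim then 1 else 0
  have hC : TotIn (chi D.Blim) C := TotIn.count RecursiveIn.oracle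
  have hF : TotIn (chi D.Blim) fun p =>
      if p.unpair.1 < p.unpair.2 ∧
        D.cB p.unpair.2 (gam (D.h p.unpair.1 p.unpair.2)) = C (gam (D.h p.unpair.1 p.unpair.2))
      then 0 else 1 := by
    have h1 : TotIn (chi D.Blim) fun p => Nat.pair p (C (gam (D.h p.unpair.1 p.unpair.2))) :=
      TotIn.pair (TotIn.of_primrec (by fun_prop)) (TotIn.comp hC (TotIn.of_primrec (by fun_prop)))
    have h2 : TotIn (chi D.Blim) fun q => if q.unpair.1.unpair.1 < q.unpair.1.unpair.2 ∧
        D.cB q.unpair.1.unpair.2 (gam (D.h q.unpair.1.unpair.1 q.unpair.1.unpair.2)) = q.unpair.2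
        then 0 else 1 := by
      apply TotIn.of_primrec
      have : Primrec fun q : ℕ => D.cB q.unpair.1.unpair.2
        (gam (D.h q.unpair.1.unpair.1 q.unpair.1.unpair.2)) := D.pr_cB (by fun_prop) (by fun_prop)
      fun_prop
    have := TotIn.comp h2 h1
    simpa only [Nat.unpair_pair] using this
  have hg : TotIn (chi D.Blim) g := by
    apply TotIn.rfind hF
    · intro a
      rw [if_pos]
      simp only [Nat.unpair_pair]
      have := Nat.find_spec (hex a)
      exact ⟨this.1, D.cB_eq.2 this.2⟩
    · intro a n hn
      rw [if_neg]
      · omega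
      simp only [Nat.unpair_pair]
      rintro ⟨h1, h2⟩
      exact Nat.find_min (hex a) hn ⟨h1, D.cB_eq.1 h2⟩
  have h1 : TotIn (chi D.Blim) fun p => if p.unpair.1 ∈ D.hS p.unpair.2 then 1 else 0 := by
    apply TotIn.of_primrec
    fun_prop
  have h2 := TotIn.comp h1 (TotIn.pair (TotIn.of_primrec (f := fun n => n) (by fun_prop)) hg)
  simp only [Nat.unpair_pair] at h2
  refine RecursiveIn.of_eq h2 fun e => congrArg Part.some (if_congr (Iff.symm ?_) rfl rfl)
  obtain ⟨h3, h4⟩ := Nat.find_spec (hex e)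
  have h5 := D.no_act h4
  constructor
  swap
  · intro h; exact ⟨_, h⟩
  rintro ⟨t, ht⟩
  by_contra hc
  change e ∉ D.hS (Nat.find (hex e)) at hc
  generalize Nat.find (hex e) = s at *
  have : ∀ k, s ≤ k → e ∉ D.hS k := by
    intro k hk
    induction k, hk using Nat.le_induction with
    | base => exact hc
    | succ k hk ih =>
      intro h6
      obtain ⟨e', m, j, h7, h8⟩ := D.act_of_cond (s := k) (e := e) (by omega) (Or.inl (Or.inr ⟨h6, ih⟩))
      exact h5 k hk e' h7 ⟨m, j, h8⟩
  exact this (max s t) (le_max_left _ _) (D.hS_mono (le_max_right _ _) ht)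

end Dat

open Nat.Partrec in
theorem main_step (U : Str →. Str) (hU : OptimalPF U) (A : Set ℕ) (hA : CESet A)
    (hAnt : ¬ KTrivialSet U A) : ∃ B : Set ℕ, CESet B ∧ KLtSet U B A ∧ ¬ KTrivialSet U B ∧
      TuringEquivSet B haltingSet := by
  obtain ⟨E, hE⟩ := exists_env U hU
  obtain ⟨f, hf, hA⟩ := hA
  obtain ⟨c, rfl⟩ := Code.exists_code.1 hf
  have hmono : ∀ (c : Code) n {s t : ℕ}, s ≤ t → (Code.evaln s c n).isSome →
      (Code.evaln t c n).isSome := by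
    intro c n s t h1 h2
    obtain ⟨x, hx⟩ := Option.isSome_iff_exists.1 h2
    exact Option.isSome_iff_exists.2 ⟨x, Code.evaln_mono h1 hx⟩
  have hdom : ∀ (c : Code) n, (c.eval n).Dom ↔ ∃ s, (Code.evaln s c n).isSome := by
    intro c n
    rw [Part.dom_iff_mem]
    constructor
    · rintro ⟨x, hx⟩
      obtain ⟨s, hs⟩ := Code.evaln_complete.1 hx
      exact ⟨s, Option.isSome_iff_exists.2 ⟨x, hs⟩⟩
    · rintro ⟨s, hs⟩
      obtain ⟨x, hx⟩ := Option.isSome_iff_exists.1 hs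
      exact ⟨x, Code.evaln_sound hx⟩
  let D : Dat := { E with
    aS := fun s => {n | (Code.evaln s c n).isSome = true}
    hS := fun s => {n | (Code.evaln s (Denumerable.ofNat Code n) n).isSome = true}
    aS_pr := by
      have : Primrec fun p : ℕ × ℕ => (Code.evaln p.1 c p.2).isSome :=
        Primrec.option_isSome.comp (Code.primrec_evaln.comp
          (Primrec.fst.pair (Primrec.const c) |>.pair Primrec.snd))
      simp only [Set.mem_ofPred_eq]
      fun_prop
    hS_pr := by
      have : Primrec fun p : ℕ × ℕ => (Code.evaln p.1 (Denumerable.ofNat Code p.2) p.2).isSome :=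
        Primrec.option_isSome.comp (Code.primrec_evaln.comp
          (Primrec.fst.pair ((Primrec.ofNat Code).comp Primrec.snd) |>.pair Primrec.snd))
      simp only [Set.mem_ofPred_eq]
      fun_prop
    aS_mono := fun s t h n hn => hmono _ _ h hn
    hS_mono := fun s t h n hn => hmono _ _ h hn }
  have hAl : D.Alim = A := by
    ext n
    rw [hA, hdom]
    rfl
  have hHl : {e | ∃ s, e ∈ D.hS s} = haltingSet := by
    ext n
    unfold haltingSet
    rw [Set.mem_ofPred_eq, Set.mem_ofPred_eq, hdom]
    rfl
  have hle : ∀ σ τ (c : ℕ), KC U σ ≤ KC U τ + c ↔ D.K σ ≤ D.K τ + c := by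
    intro σ τ c
    rw [hE, hE]
    norm_cast
  have hK : ∀ X, KTrivialSet U X ↔ D.KTriv X := by
    intro X
    simp only [KTrivialSet, Dat.KTriv, hle]
  have hnt : ¬ D.KTriv D.Alim := by rw [hAl, ← hK]; exact hAnt
  refine ⟨D.Blim, D.B_ce, ⟨?_, ?_⟩, ?_, ce_le_halting D.B_ce, ?_⟩
  · have := D.M1
    rw [hAl] at this
    simpa only [KLeSet, hle] using this
  · have := D.strict hnt
    rw [hAl] at this
    simpa only [KLeSet, hle] using this
  · rw [hK]; exact D.nontriv hnt
  · rw [← hHl]; exact D.halting_le hnt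

theorem restr_empty (n : ℕ) : restrSet ∅ n = zeroStr n := by
  simp [restrSet, zeroStr]

theorem empty_le (U : Str →. Str) (hU : OptimalPF U) (X : Set ℕ) : KLeSet U ∅ X := by
  obtain ⟨E, hE⟩ := exists_env U hU
  obtain ⟨c, hc⟩ := E.kmap (fun σ => zeroStr σ.length) (by fun_prop)
  refine ⟨c, fun n => ?_⟩
  have := hc (restrSet X n)
  rw [hE, hE, restr_empty]
  have h2 : (restrSet X n).length = n := by simp [restrSet]
  rw [h2] at this
  exact_mod_cast this

/-- For every c.e. set `A` that is not `K`-trivial there are c.e. sets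
`B` and `C` with `∅ <_K C <_K B <_K A` and `B ≡_T ∅'`. -/
theorem stmt17 (U : Str →. Str) (hU : OptimalPF U)
    (A : Set ℕ) (hA : CESet A) (hAnt : ¬ KTrivialSet U A) :
    ∃ B C : Set ℕ, CESet B ∧ CESet C ∧
      KLtSet U (∅ : Set ℕ) C ∧ KLtSet U C B ∧ KLtSet U B A ∧
      TuringEquivSet B haltingSet := by
  obtain ⟨B, hB, hBA, hBn, hBT⟩ := main_step U hU A hA hAnt
  obtain ⟨C, hC, hCB, hCn, _⟩ := main_step U hU B hB hBn
  refine ⟨B, C, hB, hC, ⟨empty_le U hU C, ?_⟩, hCB, hBA, hBT⟩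
  intro h
  apply hCn
  simpa only [KLeSet, KTrivialSet, restr_empty] using h

end KPaper
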